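/- (Edwards–Kirby fragmentation) Let M be a compact topological d-manifold without boundary and let 𝒰 be an open cover of M. Then every homeomorphism g of M that is isotopic to the identity can be written as a composition g = g_1 ∘ g_2 ∘ ⋯ ∘ g_k of finitely many homeomorphisms of M, where each g_j is supported in some member of 𝒰. -/

import Mathlib

open Topology

/-- A self-homeomorphism `g` of `M` is isotopic to the identity if there is a continuous map
`H : [0,1] × M → M` with `H(0,·) = id`, `H(1,·) = g`, and `H(t,·)` a homeomorphism for all `t`. -/
def IsotopicToId {M : Type*} [TopologicalSpace M] (g : M ≃ₜ M) : Prop :=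
  ∃ H : unitInterval × M → M, Continuous H ∧
    (∀ x, H (0, x) = x) ∧ (∀ x, H (1, x) = g x) ∧
    ∀ t : unitInterval, ∃ h : M ≃ₜ M, ∀ x, H (t, x) = h x

section
open Topology Set Metric

namespace EK

/-- `g` restricts to an open embedding on the set `V`. -/
structure OE {X Y : Type*} [TopologicalSpace X] [TopologicalSpace Y] (g : X → Y) (V : Set X) :
    Prop where
  cont : ContinuousOn g V
  inj : InjOn g V
  opn : ∀ W ⊆ V, IsOpen W → IsOpen (g '' W)

section basics
variable {X Y Z : Type*} [TopologicalSpace X] [TopologicalSpace Y] [TopologicalSpace Z]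

lemma OE.mono {g : X → Y} {V W : Set X} (h : OE g V) (hW : W ⊆ V) : OE g W :=
  ⟨h.cont.mono hW, h.inj.mono hW, fun U hU => h.opn U (hU.trans hW)⟩

lemma OE.congr {g g' : X → Y} {V : Set X} (h : OE g V) (hh : ∀ x ∈ V, g' x = g x) : OE g' V := by
  refine ⟨h.cont.congr hh, h.inj.congr (fun x hx => (hh x hx).symm), fun W hW hWo => ?_⟩
  rw [image_congr (fun x hx => hh x (hW hx))]
  exact h.opn W hW hWo

lemma OE.comp {f : X → Y} {g : Y → Z} {U : Set X} {V : Set Y} (hg : OE g V) (hf : OE f U)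
    (hm : MapsTo f U V) : OE (g ∘ f) U := by
  refine ⟨hg.cont.comp hf.cont hm, hg.inj.comp hf.inj hm, fun W hW hWo => ?_⟩
  rw [image_comp]
  exact hg.opn _ ((image_mono hW).trans hm.image_subset) (hf.opn W hW hWo)

lemma OE.of_homeo (h : X ≃ₜ Y) (V : Set X) : OE h V :=
  ⟨h.continuous.continuousOn, h.injective.injOn, fun W _ hW => h.isOpenMap W hW⟩

lemma OE.of_openEmbedding {h : X → Y} (hh : IsOpenEmbedding h) (V : Set X) : OE h V :=
  ⟨hh.continuous.continuousOn, hh.injective.injOn, fun W _ hW => hh.isOpenMap W hW⟩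

lemma OE.id (V : Set X) : OE (fun x => x) V := OE.of_homeo (Homeomorph.refl X) V

/-- glue along an open cover -/
lemma OE.of_cover {ι : Type*} {g : X → Y} {V : Set X} (W : ι → Set X) (hWo : ∀ i, IsOpen (W i))
    (h : ∀ i, OE g (W i)) (hV : V ⊆ ⋃ i, W i) (hinj : InjOn g V) : OE g V := by
  refine ⟨?_, hinj, fun U hU hUo => ?_⟩
  · intro x hx
    obtain ⟨i, hi⟩ := mem_iUnion.1 (hV hx)
    exact ((h i).cont.continuousAt ((hWo i).mem_nhds hi)).continuousWithinAt
  · have : g '' U = ⋃ i, g '' (U ∩ W i) := by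
      rw [← image_iUnion, ← inter_iUnion, inter_eq_self_of_subset_left (hU.trans hV)]
    rw [this]
    exact isOpen_iUnion fun i => (h i).opn _ inter_subset_right (hUo.inter (hWo i))

lemma OE.of_two {g : X → Y} {V W1 W2 : Set X} (h1o : IsOpen W1) (h2o : IsOpen W2)
    (h1 : OE g W1) (h2 : OE g W2) (hV : V ⊆ W1 ∪ W2) (hinj : InjOn g V) : OE g V := by
  refine OE.of_cover (fun b : Bool => cond b W1 W2) ?_ ?_ ?_ hinj
  · rintro (_ | _) <;> simpa
  · rintro (_ | _) <;> simpa
  · intro x hx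
    rcases hV hx with h | h
    · exact mem_iUnion.2 ⟨true, h⟩
    · exact mem_iUnion.2 ⟨false, h⟩

lemma OE.continuousOn_inv [Nonempty X] {g : X → Y} {V : Set X} (h : OE g V) (hV : IsOpen V) :
    ContinuousOn (Function.invFunOn g V) (g '' V) := by
  rintro _ ⟨x, hx, rfl⟩
  have hx' : Function.invFunOn g V (g x) = x := h.inj.leftInvOn_invFunOn hx
  intro U hU
  rw [hx'] at hU
  obtain ⟨U', hU', hU'o, hxU'⟩ := mem_nhds_iff.1 hU
  have : g '' (U' ∩ V) ∈ 𝓝 (g x) :=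
    (h.opn _ inter_subset_right (hU'o.inter hV)).mem_nhds ⟨x, ⟨hxU', hx⟩, rfl⟩
  refine mem_nhdsWithin_of_mem_nhds (Filter.mem_of_superset this ?_)
  rintro _ ⟨z, ⟨hz, hzV⟩, rfl⟩
  show Function.invFunOn g V (g z) ∈ U
  rw [h.inj.leftInvOn_invFunOn hzV]
  exact hU' hz

open Classical in
/-- the function underlying the transport of `q` by `e`. -/
noncomputable def transFun [Nonempty X] (e : X → Y) (V : Set X) (q : X → X) (y : Y) : Y :=
  if y ∈ e '' V then e (q (Function.invFunOn e V y)) else y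

lemma transFun_apply [Nonempty X] {e : X → Y} {V : Set X} (h : OE e V) (q : X → X) {x : X}
    (hx : x ∈ V) : transFun e V q (e x) = e (q x) := by
  have : e x ∈ e '' V := ⟨x, hx, rfl⟩
  simp only [transFun, this, if_true, h.inj.leftInvOn_invFunOn hx]

lemma transFun_off [Nonempty X] {e : X → Y} {V S : Set X} (h : OE e V)
    (q : X → X) (hq : ∀ x ∉ S, q x = x) {y : Y} (hy : y ∉ e '' S) : transFun e V q y = y := by
  by_cases hyV : y ∈ e '' V
  · obtain ⟨x, hx, rfl⟩ := hyV
    rw [transFun_apply h q hx, hq x (fun hxS => hy ⟨x, hxS, rfl⟩)]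
  · simp [transFun, hyV]

lemma transFun_cont [Nonempty X] [T2Space Y] {e : X → Y} {V S : Set X} (h : OE e V) (hV : IsOpen V)
    (hS : IsCompact S) (hSV : S ⊆ V) (q : X → X) (hqc : Continuous q) (hqV : MapsTo q V V)
    (hq : ∀ x ∉ S, q x = x) : Continuous (transFun e V q) := by
  rw [continuous_iff_continuousAt]
  intro y
  by_cases hyV : y ∈ e '' V
  · have ho : IsOpen (e '' V) := h.opn V subset_rfl hV
    have : ContinuousOn (transFun e V q) (e '' V) := by
      have h1 : ContinuousOn (fun y => e (q (Function.invFunOn e V y))) (e '' V) := by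
        refine h.cont.comp (hqc.comp_continuousOn (h.continuousOn_inv hV)) ?_
        rintro _ ⟨x, hx, rfl⟩
        show q (Function.invFunOn e V (e x)) ∈ V
        rw [h.inj.leftInvOn_invFunOn hx]
        exact hqV hx
      refine h1.congr ?_
      intro y hy
      simp [transFun, hy]
    exact this.continuousAt (ho.mem_nhds hyV)
  · have hc : IsClosed (e '' S) := (hS.image_of_continuousOn (h.cont.mono hSV)).isClosed
    have hy : y ∈ (e '' S)ᶜ := fun hh => hyV (image_mono hSV hh)
    have : (transFun e V q) =ᶠ[𝓝 y] (fun y => y) := by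
      filter_upwards [hc.isOpen_compl.mem_nhds hy] with z hz
      exact transFun_off h q hq hz
    exact continuousAt_id.congr this.symm

/-- transport of a compactly supported homeomorphism by an open embedding. -/
lemma transport [Nonempty X] [T2Space Y] {e : X → Y} {V S : Set X} (h : OE e V) (hV : IsOpen V)
    (hS : IsCompact S) (hSV : S ⊆ V) (q : X ≃ₜ X) (hq : ∀ x ∉ S, q x = x) :
    ∃ H : Y ≃ₜ Y, (∀ x ∈ V, H (e x) = e (q x)) ∧ ∀ y ∉ e '' S, H y = y := by
  have hq' : ∀ x ∉ S, q.symm x = x := fun x hx => by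
    conv_lhs => rw [← hq x hx]
    simp
  have key : ∀ (r : X ≃ₜ X), (∀ x ∉ S, r x = x) → MapsTo r V V := by
    intro r hr x hx
    by_contra hcon
    have h1 : r x ∉ S := fun hh => hcon (hSV hh)
    have h2 := hr _ h1
    have h3 := r.injective h2
    rw [h3] at hcon
    exact hcon hx
  have inv : ∀ (r : X ≃ₜ X), (∀ x ∉ S, r x = x) →
      ∀ y, transFun e V r.symm (transFun e V r y) = y := by
    intro r hr y
    by_cases hyV : y ∈ e '' V
    · obtain ⟨x, hx, rfl⟩ := hyV
      rw [transFun_apply h _ hx, transFun_apply h _ (key r hr hx)]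
      simp
    · have : ∀ p : X → X, transFun e V p y = y := fun p => by simp [transFun, hyV]
      rw [this, this]
  refine ⟨{ toFun := transFun e V q
            invFun := transFun e V q.symm
            left_inv := inv q hq
            right_inv := inv q.symm hq'
            continuous_toFun := transFun_cont h hV hS hSV q q.continuous (key q hq) hq
            continuous_invFun := transFun_cont h hV hS hSV _ q.symm.continuous (key _ hq') hq' },
          ?_, ?_⟩
  · intro x hx
    exact transFun_apply h q hx
  · intro y hy
    exact transFun_off h q hq hy

end basics

section normed
variable {E : Type*} [NormedAddCommGroup E] [NormedSpace ℝ E] [FiniteDimensional ℝ E]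

lemma near_id_cover {g : E → E} {V : Set E} (hg : OE g V) {z : E} {R : ℝ}
    (hR : 0 < R) (hB : closedBall z R ⊆ V)
    (hd : ∀ w ∈ closedBall z R, dist (g w) w < R / 2) :
    ball z (R / 2) ⊆ g '' ball z R := by
  haveI : ProperSpace E := FiniteDimensional.proper ℝ E
  have hc : IsClosed (g '' closedBall z R) :=
    ((isCompact_closedBall z R).image_of_continuousOn (hg.cont.mono hB)).isClosed
  have ho : IsOpen (g '' ball z R) := hg.opn _ (ball_subset_closedBall.trans hB) isOpen_ball
  have hconn : IsPreconnected (ball z (R / 2)) := (convex_ball z (R/2)).isPreconnected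
  have key : ball z (R/2) ∩ g '' closedBall z R ⊆ g '' ball z R := by
    rintro _ ⟨h1, w, hw, rfl⟩
    refine ⟨w, ?_, rfl⟩
    have := hd w hw
    rw [mem_ball] at *
    calc dist w z ≤ dist w (g w) + dist (g w) z := dist_triangle _ _ _
      _ < R := by rw [dist_comm w]; linarith
  have hz : g z ∈ ball z (R/2) := hd z (mem_closedBall_self hR.le)
  by_contra hcon
  rw [not_subset] at hcon
  obtain ⟨p, hp, hp'⟩ := hcon
  have := hconn (g '' ball z R) (g '' closedBall z R)ᶜ ho hc.isOpen_compl
    (by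
      intro w hw
      by_cases hh : w ∈ g '' closedBall z R
      · exact Or.inl (key ⟨hw, hh⟩)
      · exact Or.inr hh)
    ⟨g z, hz, z, mem_ball_self hR, rfl⟩
    ⟨p, hp, fun hh => hp' (key ⟨hp, hh⟩)⟩
  obtain ⟨w, -, hw1, hw2⟩ := this
  exact hw2 (image_mono ball_subset_closedBall hw1)

lemma homeo_of_OE {g : E → E} (hg : OE g univ) {ε : ℝ} (hd : ∀ w, dist (g w) w < ε) :
    ∃ h : E ≃ₜ E, ∀ x, h x = g x := by
  have hε : 0 < ε := lt_of_le_of_lt dist_nonneg (hd 0)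
  have hs : Function.Surjective g := by
    intro z
    have := near_id_cover hg (z := z) (R := 2 * ε) (by linarith) (subset_univ _)
      (fun w _ => by have := hd w; linarith)
    obtain ⟨w, -, hw⟩ := this (mem_ball_self (by linarith))
    exact ⟨w, hw⟩
  have hi : Function.Injective g := injOn_univ.1 hg.inj
  exact ⟨Equiv.toHomeomorphOfContinuousOpen (Equiv.ofBijective g ⟨hi, hs⟩)
    (continuousOn_univ.1 hg.cont) (fun W hW => hg.opn W (subset_univ _) hW), fun x => rfl⟩

end normed

end EK
end

section
open Topology Set Metric

namespace EK

section radial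
variable {E : Type*} [NormedAddCommGroup E] [NormedSpace ℝ E]

/-- radial map with profile `σ`. -/
noncomputable def rad (σ : ℝ → ℝ) (z : E) : E := (σ ‖z‖ / ‖z‖) • z

lemma rad_id {σ : ℝ → ℝ} {z : E} (h : σ ‖z‖ = ‖z‖) : rad σ z = z := by
  unfold rad
  rw [h]
  by_cases hz : z = 0
  · simp [hz]
  · rw [div_self (norm_ne_zero_iff.2 hz), one_smul]

lemma rad_zero_of {σ : ℝ → ℝ} {z : E} (h : σ ‖z‖ = 0) : rad σ z = 0 := by
  unfold rad
  rw [h]; simp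

lemma norm_rad {σ : ℝ → ℝ} (h0 : σ 0 = 0) {z : E} (hz : 0 ≤ σ ‖z‖) : ‖rad σ z‖ = σ ‖z‖ := by
  unfold rad
  by_cases h : z = 0
  · simp [h, h0]
  · have : 0 < ‖z‖ := norm_pos_iff.2 h
    rw [norm_smul, Real.norm_eq_abs, abs_div, abs_norm, abs_of_nonneg hz,
      div_mul_cancel₀ _ this.ne']

lemma rad_continuous {σ : ℝ → ℝ} (hσ : Continuous σ) (h0 : σ 0 = 0) :
    Continuous (rad σ : E → E) := by
  rw [continuous_iff_continuousAt]
  intro z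
  by_cases h : z = 0
  · subst h
    have h1 : rad σ (0 : E) = 0 := by simp [rad]
    rw [ContinuousAt, h1, tendsto_zero_iff_norm_tendsto_zero]
    have h2 : Filter.Tendsto (fun z : E => |σ ‖z‖|) (𝓝 0) (𝓝 0) := by
      have : Continuous (fun z : E => |σ ‖z‖|) := by fun_prop
      have := this.tendsto 0
      simpa [h0] using this
    refine squeeze_zero (fun _ => norm_nonneg _) (fun z => ?_) h2
    unfold rad
    by_cases hz : z = 0
    · simp [hz]
    · rw [norm_smul, Real.norm_eq_abs, abs_div, abs_norm,
        div_mul_cancel₀ _ (norm_pos_iff.2 hz).ne']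
  · unfold rad
    have : ‖z‖ ≠ 0 := norm_ne_zero_iff.2 h
    have h3 : ContinuousAt (fun z : E => σ ‖z‖ / ‖z‖) z :=
      (hσ.comp continuous_norm).continuousAt.div continuous_norm.continuousAt this
    exact h3.smul continuousAt_id

lemma rad_rad {σ τ : ℝ → ℝ} (z : E) (hτ : 0 < ‖z‖ → 0 < τ ‖z‖) :
    rad σ (rad τ z) = rad (σ ∘ τ) z := by
  by_cases h : z = 0
  · simp [rad, h]
  · have h1 : 0 < ‖z‖ := norm_pos_iff.2 h
    have h2 := hτ h1
    have h3 : ‖(τ ‖z‖ / ‖z‖) • z‖ = τ ‖z‖ := by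
      rw [norm_smul, Real.norm_eq_abs, abs_div, abs_norm, abs_of_nonneg h2.le,
        div_mul_cancel₀ _ h1.ne']
    unfold rad
    rw [h3, smul_smul, Function.comp]
    congr 1
    field_simp

/-- radial homeomorphism -/
noncomputable def radHomeo (σ : ℝ ≃o ℝ) (h0 : σ 0 = 0) : E ≃ₜ E where
  toFun := rad σ
  invFun := rad σ.symm
  left_inv z := by
    rw [rad_rad _ (fun h => by rw [← h0]; exact σ.strictMono h)]
    exact rad_id (by simp)
  right_inv z := by
    have h0' : σ.symm 0 = 0 := by rw [OrderIso.symm_apply_eq, h0]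
    rw [rad_rad _ (fun h => by rw [← h0']; exact σ.symm.strictMono h)]
    exact rad_id (by simp)
  continuous_toFun := rad_continuous σ.continuous h0
  continuous_invFun := rad_continuous σ.symm.continuous (by rw [OrderIso.symm_apply_eq, h0])

lemma exists_profile {c0 c1 a b : ℝ} (h1 : c0 < c1) (h2 : c1 ≤ a) (h3 : a < b) :
    ∃ σ : ℝ ≃o ℝ, (∀ r ≤ c0, σ r = r) ∧ σ a = c1 ∧ ∀ r, b ≤ r → σ r = r := by
  set μ := (c1 - c0) / (a - c0) with hμ
  set κ := (b - c1) / (b - a) with hκ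
  have hac : 0 < a - c0 := by linarith
  have hba : 0 < b - a := by linarith
  have hμ0 : 0 < μ := div_pos (by linarith) hac
  have hμ1 : μ ≤ 1 := by rw [hμ, div_le_one hac]; linarith
  have hκ1 : 1 ≤ κ := by rw [hκ, one_le_div hba]; linarith
  have e1 : (a - c0) * μ = c1 - c0 := by rw [hμ]; field_simp
  have e2 : (b - a) * κ = b - c1 := by rw [hκ]; field_simp
  let f : ℝ → ℝ := fun r => min r (max (c0 + (r - c0) * μ) (b + (r - b) * κ))
  have hf : StrictMono f := by
    intro r s hrs
    have i1 : c0 + (r - c0) * μ < c0 + (s - c0) * μ := by nlinarith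
    have i2 : b + (r - b) * κ < b + (s - b) * κ := by nlinarith
    exact min_lt_min hrs (max_lt_max i1 i2)
  have hc : Continuous f := by fun_prop
  have hlow : ∀ r ≤ c0, f r = r := by
    intro r hr
    refine min_eq_left (le_max_of_le_left ?_)
    nlinarith
  have hhigh : ∀ r, b ≤ r → f r = r := by
    intro r hr
    refine min_eq_left (le_max_of_le_right ?_)
    nlinarith
  have hsurj : Function.Surjective f := by
    apply hc.surjective
    · refine Filter.tendsto_atTop_mono' _ ?_ Filter.tendsto_id
      filter_upwards [Filter.eventually_ge_atTop b] with r hr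
      exact (hhigh r hr).ge
    · refine Filter.tendsto_atBot_mono' _ ?_ Filter.tendsto_id
      filter_upwards [Filter.eventually_le_atBot c0] with r hr
      exact (hlow r hr).le
  refine ⟨StrictMono.orderIsoOfSurjective f hf hsurj, hlow, ?_, hhigh⟩
  show min a (max (c0 + (a - c0) * μ) (b + (a - b) * κ)) = c1
  have : b + (a - b) * κ = c1 := by linarith
  rw [e1, this]
  simp [h2]

lemma squeeze {c0 c1 a b : ℝ} (h0 : 0 ≤ c0) (h1 : c0 < c1) (h2 : c1 ≤ a) (h3 : a < b) :
    ∃ q : E ≃ₜ E, (∀ z, ‖z‖ ≤ c0 → q z = z) ∧ (∀ z, ‖z‖ ≤ a → ‖q z‖ ≤ c1) ∧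
      (∀ z, b ≤ ‖z‖ → q z = z) := by
  obtain ⟨σ, ha, hb, hc⟩ := exists_profile h1 h2 h3
  have hσ : σ 0 = 0 := ha 0 h0
  refine ⟨radHomeo σ hσ, fun z hz => rad_id (ha _ hz), fun z hz => ?_, fun z hz => rad_id (hc _ hz)⟩
  show ‖rad σ z‖ ≤ c1
  rw [norm_rad hσ (by rw [← hσ]; exact σ.monotone (norm_nonneg z)), ← hb]
  exact σ.monotone hz

end radial

/-- abstract Bing shrinking by Baire category -/
lemma bing {K Y : Type*} [MetricSpace K] [CompactSpace K] [MetricSpace Y] [CompleteSpace Y]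
    (φ : C(K, Y)) (S : Set (K ≃ₜ K)) (hne : S.Nonempty)
    (hS : ∀ s ∈ S, ∀ ε > 0, ∃ s' ∈ S, (∀ w, dist (φ (s' w)) (φ (s w)) < ε) ∧
      ∀ w w', φ (s' w) = φ (s' w') → dist w w' < ε) :
    ∃ f : C(K, Y), Function.Injective f ∧ ∀ ε > 0, ∃ s ∈ S, ∀ w, dist (f w) (φ (s w)) < ε := by
  let F : (K ≃ₜ K) → C(K, Y) := fun s => ⟨fun w => φ (s w), by fun_prop⟩
  let T : Set C(K, Y) := closure (F '' S)
  have hT : IsClosed T := isClosed_closure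
  haveI : CompleteSpace T := hT.completeSpace_coe
  let O : ℕ → Set C(K, Y) := fun n => {f | ∀ w w', f w = f w' → dist w w' < 1 / ((n : ℝ) + 1)}
  have hO : ∀ n, IsOpen (O n) := by
    intro n
    have hC : IsClosed {p : C(K, Y) × (K × K) |
        p.1 p.2.1 = p.1 p.2.2 ∧ 1 / ((n : ℝ) + 1) ≤ dist p.2.1 p.2.2} := by
      refine IsClosed.and ?_ ?_
      · exact isClosed_eq (by fun_prop) (by fun_prop)
      · exact isClosed_le (by fun_prop) (by fun_prop)
    have := (isClosedMap_fst_of_compactSpace (X := C(K, Y)) (Y := K × K)) _ hC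
    rw [← isClosed_compl_iff]
    convert this using 1
    ext f
    simp only [O, mem_compl_iff, mem_ofPred_eq, mem_image, Prod.exists]
    push Not
    constructor
    · rintro ⟨w, w', h1, h2⟩
      exact ⟨f, w, w', ⟨h1, h2⟩, rfl⟩
    · rintro ⟨f', w, w', ⟨h1, h2⟩, rfl⟩
      exact ⟨w, w', h1, h2⟩
  have hd : Dense (⋂ n, ((↑) : T → C(K, Y)) ⁻¹' (O n)) := by
    refine dense_iInter_of_isOpen (fun n => (hO n).preimage continuous_subtype_val) ?_
    intro n
    rw [Metric.dense_iff]
    rintro ⟨f, hf⟩ ε hε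
    obtain ⟨_, ⟨s, hs, rfl⟩, hfs⟩ := Metric.mem_closure_iff.1 hf (ε / 2) (by linarith)
    obtain ⟨s', hs', h1, h2⟩ := hS s hs (min (ε / 2) (1 / ((n : ℝ) + 1)))
      (lt_min (by linarith) (by positivity))
    refine ⟨⟨F s', subset_closure ⟨s', hs', rfl⟩⟩, ?_, ?_⟩
    · rw [mem_ball, Subtype.dist_eq]
      have : dist (F s') (F s) < ε / 2 := by
        rw [ContinuousMap.dist_lt_iff (by linarith)]
        exact fun w => (h1 w).trans_le (min_le_left _ _)
      calc dist (F s') f ≤ dist (F s') (F s) + dist (F s) f := dist_triangle _ _ _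
        _ < ε := by rw [dist_comm _ f]; linarith
    · intro w w' hw
      exact (h2 w w' hw).trans_le (min_le_right _ _)
  obtain ⟨s0, hs0⟩ := hne
  haveI : Nonempty T := ⟨⟨F s0, subset_closure ⟨s0, hs0, rfl⟩⟩⟩
  obtain ⟨⟨f, hf⟩, hfO⟩ := hd.nonempty
  refine ⟨f, ?_, ?_⟩
  · intro w w' hw
    by_contra hne
    obtain ⟨n, hn⟩ := exists_nat_one_div_lt (dist_pos.2 hne)
    have := mem_iInter.1 hfO n
    have := this w w' hw
    linarith
  · intro ε hε
    obtain ⟨_, ⟨s, hs, rfl⟩, hfs⟩ := Metric.mem_closure_iff.1 hf ε hε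
    exact ⟨s, hs, fun w => (ContinuousMap.dist_lt_iff hε).1 hfs w⟩

end EK
end

section
open Topology Set Metric

namespace EK

lemma exists_collapse {s t : ℝ} (hs : 0 < s) (hst : s < t) :
    ∃ σ : ℝ → ℝ, Continuous σ ∧ (∀ r ≤ s, σ r = 0) ∧ (∀ r, t ≤ r → σ r = r) ∧ (∀ r, 0 ≤ σ r) ∧
      (∀ r r', s < r → s < r' → σ r = σ r' → r = r') ∧ ∀ r, s < r → 0 < σ r := by
  set κ := t / (t - s) with hκ
  have hts : 0 < t - s := by linarith
  have hκ1 : 1 ≤ κ := by rw [hκ, one_le_div hts]; linarith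
  have e1 : κ * (t - s) = t := by rw [hκ]; field_simp
  have hform : ∀ r, s ≤ r → max 0 (min r (t + κ * (r - t))) = min r (t + κ * (r - t)) := by
    intro r hr
    refine max_eq_right (le_min (by linarith) ?_)
    nlinarith
  refine ⟨fun r => max 0 (min r (t + κ * (r - t))), by fun_prop, ?_, ?_, fun r => le_max_left _ _,
    ?_, ?_⟩
  · intro r hr
    refine max_eq_left (min_le_of_right_le ?_)
    nlinarith
  · intro r hr
    simp only
    rw [hform r (by linarith)]
    refine min_eq_left ?_
    nlinarith
  · intro r r' hr hr' h
    simp only at h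
    rw [hform r hr.le, hform r' hr'.le] at h
    have hm : StrictMono (fun r => min r (t + κ * (r - t))) := by
      intro r s hrs
      exact min_lt_min hrs (by nlinarith)
    exact hm.injective h
  · intro r hr
    refine lt_max_of_lt_right (lt_min (by linarith) ?_)
    nlinarith

section
variable {E : Type*} [NormedAddCommGroup E] [NormedSpace ℝ E] 

lemma rad_inj {σ : ℝ → ℝ} {s : ℝ} (hs : 0 < s) (h0 : ∀ r ≤ s, σ r = 0) (hn : ∀ r, 0 ≤ σ r)
    (hi : ∀ r r', s < r → s < r' → σ r = σ r' → r = r') {v v' : E} (h : rad σ v = rad σ v')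
    (hne : rad σ v ≠ 0) : v = v' := by
  have k0 : σ 0 = 0 := h0 0 hs.le
  have hne' : rad σ v' ≠ 0 := h ▸ hne
  have k1 : s < ‖v‖ := by
    by_contra hh
    exact hne (rad_zero_of (h0 _ (not_lt.1 hh)))
  have k2 : s < ‖v'‖ := by
    by_contra hh
    exact hne' (rad_zero_of (h0 _ (not_lt.1 hh)))
  have k3 : σ ‖v‖ = σ ‖v'‖ := by
    rw [← norm_rad k0 (hn _), ← norm_rad k0 (hn _), h]
  have k4 := hi _ _ k1 k2 k3
  unfold rad at h hne
  rw [← k4] at h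
  refine smul_right_injective E ?_ h
  intro hc
  rw [hc, zero_smul] at hne
  exact hne rfl

lemma rad_surj {σ : ℝ → ℝ} {s t : ℝ} (hs : 0 < s) (hst : s < t) (hσ : Continuous σ)
    (h0 : ∀ r ≤ s, σ r = 0) (h1 : ∀ r, t ≤ r → σ r = r) (p : E) (hp : p ≠ 0) :
    ∃ v : E, s < ‖v‖ ∧ ‖v‖ ≤ max t ‖p‖ ∧ rad σ v = p := by
  have hp' : 0 < ‖p‖ := norm_pos_iff.2 hp
  have : ‖p‖ ∈ σ '' Icc s (max t ‖p‖) := by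
    refine intermediate_value_Icc (hst.le.trans (le_max_left _ _)) hσ.continuousOn ⟨?_, ?_⟩
    · rw [h0 s le_rfl]; exact hp'.le
    · rw [h1 _ (le_max_left _ _)]; exact le_max_right _ _
  obtain ⟨r, ⟨hr1, hr2⟩, hr⟩ := this
  have hr1' : s < r := by
    rcases hr1.lt_or_eq with h | h
    · exact h
    · rw [← h, h0 s le_rfl] at hr; linarith
  have hn : ‖(r / ‖p‖) • p‖ = r := by
    rw [norm_smul, Real.norm_eq_abs, abs_div, abs_norm, abs_of_nonneg (by linarith),
        div_mul_cancel₀ _ hp'.ne']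
  refine ⟨(r / ‖p‖) • p, by rw [hn]; exact hr1', by rw [hn]; exact hr2, ?_⟩
  unfold rad
  rw [hn, hr, smul_smul]
  have : r ≠ 0 := by linarith
  have h2 : ‖p‖ / r * (r / ‖p‖) = 1 := by field_simp
  rw [h2, one_smul]

lemma norm_close {g : E → E} {z : E} {δ : ℝ} (h : dist (g z) z < δ) :
    ‖z‖ < ‖g z‖ + δ ∧ ‖g z‖ < ‖z‖ + δ := by
  rw [dist_eq_norm] at h
  have h1 := norm_sub_norm_le (g z) z
  have h2 := norm_sub_norm_le z (g z)
  rw [norm_sub_rev] at h2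
  exact ⟨by linarith, by linarith⟩

end

section
variable {E : Type*} [NormedAddCommGroup E] [NormedSpace ℝ E] [FiniteDimensional ℝ E]

lemma collar_phi {a u δ : ℝ} (ha : 0 < a) (hu : 0 < u) (hδ : δ ≤ u / 8)
    {g : E → E} (hg : OE g {z | a < ‖z‖ ∧ ‖z‖ < a + 10 * u})
    (hd : ∀ z, a < ‖z‖ → ‖z‖ < a + 10 * u → dist (g z) z < δ)
    {σ : ℝ → ℝ} (hσ : Continuous σ) (h0 : ∀ r ≤ a + 2 * u, σ r = 0) :
    ∃ φ : E → E, ContinuousOn φ (closedBall 0 (a + 8 * u)) ∧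
      (∀ v, a < ‖v‖ → ‖v‖ < a + 10 * u → φ (g v) = rad σ v) ∧
      ∀ w, w ∉ g '' {z | a < ‖z‖ ∧ ‖z‖ < a + 10 * u} → φ w = 0 := by
  classical
  have : ProperSpace E := FiniteDimensional.proper ℝ E
  set V : Set E := {z | a < ‖z‖ ∧ ‖z‖ < a + 10 * u} with hV
  have hVo : IsOpen V := (isOpen_lt continuous_const continuous_norm).inter
    (isOpen_lt continuous_norm continuous_const)
  let φ : E → E := fun w => if w ∈ g '' V then rad σ (Function.invFunOn g V w) else 0
  have hφ1 : ∀ v, a < ‖v‖ → ‖v‖ < a + 10 * u → φ (g v) = rad σ v := by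
    intro v h1 h2
    have hv : v ∈ V := ⟨h1, h2⟩
    have : g v ∈ g '' V := ⟨v, hv, rfl⟩
    simp only [φ, this, if_true, hg.inj.leftInvOn_invFunOn hv]
  have hφ2 : ∀ w, w ∉ g '' V → φ w = 0 := by
    intro w hw
    simp only [φ, hw, if_false]
  refine ⟨φ, ?_, hφ1, hφ2⟩
  set A : Set E := {z | a + 2 * u ≤ ‖z‖ ∧ ‖z‖ ≤ a + 9 * u} with hA
  have hAV : A ⊆ V := fun z hz => ⟨by linarith [hz.1], by linarith [hz.2]⟩
  have hAc : IsCompact A := by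
    refine (isCompact_closedBall (0 : E) (a + 9 * u)).of_isClosed_subset ?_ ?_
    · exact (isClosed_le continuous_const continuous_norm).inter
        (isClosed_le continuous_norm continuous_const)
    · intro z hz
      simpa using hz.2
  have hΓ : IsClosed (g '' A) := (hAc.image_of_continuousOn (hg.cont.mono hAV)).isClosed
  intro w hw
  by_cases hwA : w ∈ g '' A
  · have hwV : w ∈ g '' V := image_mono hAV hwA
    have ho : IsOpen (g '' V) := hg.opn V subset_rfl hVo
    have hc : ContinuousOn φ (g '' V) := by
      have : ContinuousOn (fun w => rad σ (Function.invFunOn g V w)) (g '' V) :=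
        (rad_continuous hσ (h0 0 (by linarith))).comp_continuousOn (hg.continuousOn_inv hVo)
      refine this.congr ?_
      intro y hy
      simp only [φ, hy, if_true]
    exact (hc.continuousAt (ho.mem_nhds hwV)).continuousWithinAt
  · have hz : ∀ y ∈ closedBall (0 : E) (a + 8 * u), y ∉ g '' A → φ y = 0 := by
      intro y hy hyA
      by_cases hyV : y ∈ g '' V
      · obtain ⟨v, hv, rfl⟩ := hyV
        rw [hφ1 v hv.1 hv.2]
        refine rad_zero_of (h0 _ ?_)
        by_contra hcon
        refine hyA ⟨v, ⟨by linarith, ?_⟩, rfl⟩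
        have := norm_close (hd v hv.1 hv.2)
        rw [mem_closedBall, dist_zero_right] at hy
        linarith
      · exact hφ2 y hyV
    have : ContinuousWithinAt (fun _ => (0 : E)) (closedBall (0 : E) (a + 8 * u)) w :=
      continuousWithinAt_const
    refine this.congr_of_eventuallyEq ?_ (hz w hw hwA)
    filter_upwards [mem_nhdsWithin_of_mem_nhds (hΓ.isOpen_compl.mem_nhds hwA),
      self_mem_nhdsWithin] with y h1 h2
    exact hz y h2 h1

end

end EK
end

section
open Topology Set Metric

namespace EK
section
variable {E : Type*} [NormedAddCommGroup E] [NormedSpace ℝ E] 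

lemma restrict_ball {r R : ℝ} (hr : r ≤ R) (F : E ≃ₜ E) (hF : ∀ y, r ≤ ‖y‖ → F y = y) :
    ∃ F' : closedBall (0 : E) R ≃ₜ closedBall (0 : E) R, (∀ w, (F' w : E) = F w) ∧
      ∀ w, (F'.symm w : E) = F.symm w := by
  refine ⟨F.subtype ?_, fun w => rfl, fun w => rfl⟩
  intro x
  simp only [mem_closedBall, dist_zero_right]
  by_cases h : r ≤ ‖x‖
  · rw [hF x h]
  · have : ¬ r ≤ ‖F x‖ := by
      intro h2
      have := F.injective (hF _ h2)
      rw [this] at h2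
      exact h h2
    constructor <;> intro <;> linarith
end

section
variable {E : Type*} [NormedAddCommGroup E] [NormedSpace ℝ E] [FiniteDimensional ℝ E]

lemma collar_in {a u δ : ℝ} (hδ : δ ≤ u / 8) (hu : 0 < u)
    {g : E → E} (hg : OE g {z | a < ‖z‖ ∧ ‖z‖ < a + 10 * u})
    (hd : ∀ z, a < ‖z‖ → ‖z‖ < a + 10 * u → dist (g z) z < δ) {y : E} (h1 : a + u < ‖y‖)
    (h2 : ‖y‖ ≤ a + 9 * u) : y ∈ g '' {z | a < ‖z‖ ∧ ‖z‖ < a + 10 * u} := by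
  have hb : closedBall y (u / 4) ⊆ {z | a < ‖z‖ ∧ ‖z‖ < a + 10 * u} := by
    intro z hz
    rw [mem_closedBall, dist_eq_norm] at hz
    have h3 := norm_sub_norm_le z y
    have h4 := norm_sub_norm_le y z
    rw [norm_sub_rev] at h4
    exact ⟨by linarith, by linarith⟩
  have := near_id_cover hg (z := y) (R := u / 4) (by linarith) hb (fun w hw => by
    have := hd w (hb hw).1 (hb hw).2
    linarith)
  exact image_mono (ball_subset_closedBall.trans hb) (this (mem_ball_self (by linarith)))

lemma collar_f {a u δ : ℝ} (ha : 0 < a) (hu : 0 < u) (hδ : δ ≤ u / 8)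
    {g : E → E} (hg : OE g {z | a < ‖z‖ ∧ ‖z‖ < a + 10 * u})
    (hd : ∀ z, a < ‖z‖ → ‖z‖ < a + 10 * u → dist (g z) z < δ)
    {σ : ℝ → ℝ} (hσ : Continuous σ) (h0 : ∀ r ≤ a + 2 * u, σ r = 0) (hn : ∀ r, 0 ≤ σ r)
    (hi : ∀ r r', a + 2 * u < r → a + 2 * u < r' → σ r = σ r' → r = r')
    (hp : ∀ r, a + 2 * u < r → 0 < σ r)
    {φ : E → E} (hφc : ContinuousOn φ (closedBall 0 (a + 8 * u)))
    (hφ1 : ∀ v, a < ‖v‖ → ‖v‖ < a + 10 * u → φ (g v) = rad σ v)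
    (hφ2 : ∀ w, w ∉ g '' {z | a < ‖z‖ ∧ ‖z‖ < a + 10 * u} → φ w = 0) :
    ∃ f : closedBall (0 : E) (a + 8 * u) → E, Continuous f ∧ Function.Injective f ∧
      ∀ ε > 0, ∃ s : closedBall (0 : E) (a + 8 * u) ≃ₜ closedBall (0 : E) (a + 8 * u),
        (∀ w : closedBall (0 : E) (a + 8 * u), a + 7 * u ≤ ‖(w : E)‖ → s w = w) ∧ ∀ w, dist (f w) (φ (s w)) < ε := by
  have : ProperSpace E := FiniteDimensional.proper ℝ E
  set V : Set E := {z | a < ‖z‖ ∧ ‖z‖ < a + 10 * u} with hV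
  have hVo : IsOpen V := (isOpen_lt continuous_const continuous_norm).inter
    (isOpen_lt continuous_norm continuous_const)
  have hσ0 : σ 0 = 0 := h0 0 (by linarith)
  haveI : CompactSpace (closedBall (0 : E) (a + 8 * u)) :=
    isCompact_iff_compactSpace.1 (isCompact_closedBall (0 : E) (a + 8 * u))
  let φK : C(closedBall (0 : E) (a + 8 * u), E) :=
    ⟨fun w => φ w, continuousOn_iff_continuous_domRestrict.1 hφc⟩
  suffices hmain : _ by
    obtain ⟨f, hf1, hf2⟩ := bing φK
      {s | ∀ w : closedBall (0 : E) (a + 8 * u), a + 7 * u ≤ ‖(w : E)‖ → s w = w} ⟨Homeomorph.refl _, fun w _ => rfl⟩ hmain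
    exact ⟨f, f.continuous, hf1, hf2⟩
  intro s hs ε hε
  -- profile close to zero
  obtain ⟨η, hη, hη1⟩ : ∃ η > 0, η ≤ u ∧ ∀ r ≤ a + 2 * u + η, σ r < ε / 2 := by
    obtain ⟨η, hη, hh⟩ := Metric.continuousAt_iff.1 (hσ.continuousAt (x := a + 2 * u)) (ε / 2)
      (by linarith)
    refine ⟨min (η / 2) u, lt_min (by linarith) hu, min_le_right _ _, fun r hr => ?_⟩
    by_cases hr2 : r ≤ a + 2 * u
    · rw [h0 r hr2]; linarith
    · push Not at hr2
      have h1 : dist r (a + 2 * u) < η := by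
        rw [Real.dist_eq, abs_of_pos (by linarith)]
        have := min_le_left (η / 2) u
        linarith
      have h2 := hh h1
      rw [h0 _ le_rfl, Real.dist_eq, sub_zero] at h2
      exact (le_abs_self _).trans_lt h2
  obtain ⟨hηu, hησ⟩ := hη1
  obtain ⟨q, hq0, hq1, hq2⟩ := squeeze (E := E) (c0 := a + 2 * u + η / 2) (c1 := a + 2 * u + η)
    (a := a + 5 * u) (b := a + 6 * u) (by linarith) (by linarith) (by linarith) (by linarith)
  set S0 : Set E := {z | a + 2 * u ≤ ‖z‖ ∧ ‖z‖ ≤ a + 6 * u} with hS0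
  have hS0V : S0 ⊆ V := fun z hz => ⟨by linarith [hz.1], by linarith [hz.2]⟩
  have hS0c : IsCompact S0 := by
    refine (isCompact_closedBall (0 : E) (a + 9 * u)).of_isClosed_subset ?_ ?_
    · exact (isClosed_le continuous_const continuous_norm).inter
        (isClosed_le continuous_norm continuous_const)
    · intro z hz
      have := hz.2
      rw [mem_closedBall, dist_zero_right]
      linarith
  obtain ⟨F, hF1, hF2⟩ := transport hg hVo hS0c hS0V q (fun x hx => by
    by_cases h1 : ‖x‖ ≤ a + 2 * u
    · exact hq0 x (by linarith)
    · refine hq2 x ?_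
      by_contra h2
      exact hx ⟨by linarith, by linarith⟩)
  have hFbig : ∀ y, a + 7 * u ≤ ‖y‖ → F y = y := by
    intro y hy
    refine hF2 y ?_
    rintro ⟨v, hv, rfl⟩
    have := norm_close (hd v (hS0V hv).1 (hS0V hv).2)
    linarith [hv.2]
  obtain ⟨F', hF'1, hF'2⟩ := restrict_ball (r := a + 7 * u) (R := a + 8 * u) (by linarith) F hFbig
  -- the shrinking
  have h0mem : (0 : E) ∈ closedBall (0 : E) (a + 8 * u) := mem_closedBall_self (by linarith)
  obtain ⟨τ0, hτ0, hτ⟩ := Metric.continuousAt_iff.1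
    ((s.symm.continuous.comp F'.continuous).continuousAt (x := ⟨0, h0mem⟩)) (ε / 2) (by linarith)
  obtain ⟨p, hp0, hp1, hp2⟩ := squeeze (E := E) (c0 := 0) (c1 := min (τ0 / 2) (a + 3 * u))
    (a := a + 3 * u) (b := a + 4 * u) le_rfl (lt_min (by linarith) (by linarith))
    (min_le_right _ _) (by linarith)
  have hp2' : ∀ z, a + 4 * u ≤ ‖z‖ → p.symm z = z := fun z hz => by
    rw [Homeomorph.symm_apply_eq, hp2 z hz]
  obtain ⟨P, hP1, hP2⟩ := restrict_ball (r := a + 7 * u) (R := a + 8 * u) (by linarith) p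
    (fun y hy => hp2 y (by linarith))
  have hA : ∀ y, ‖y‖ ≤ a + 8 * u → φ y = 0 → F y = y ∧ ‖y‖ ≤ a + 3 * u := by
    intro y hy hφy
    by_cases hyV : y ∈ g '' V
    · obtain ⟨v, hv, rfl⟩ := hyV
      rw [hφ1 v hv.1 hv.2] at hφy
      have hv2 : ‖v‖ ≤ a + 2 * u := by
        by_contra hcon
        have h1 := hp _ (not_le.1 hcon)
        have h2 := norm_rad hσ0 (hn ‖v‖)
        rw [hφy, norm_zero] at h2
        linarith
      refine ⟨by rw [hF1 v hv, hq0 v (by linarith)], ?_⟩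
      have := norm_close (hd v hv.1 hv.2)
      linarith
    · refine ⟨hF2 y fun hh => hyV (image_mono hS0V hh), ?_⟩
      by_contra hcon
      exact hyV (collar_in hδ hu hg hd (by linarith) (by linarith))
  have hsmall : ∀ x, ‖x‖ ≤ a + 4 * u → ‖φ (F x)‖ < ε / 2 := by
    intro x hx
    by_cases hxV : x ∈ g '' V
    · obtain ⟨v, hv, rfl⟩ := hxV
      have h1 := norm_close (hd v hv.1 hv.2)
      have h2 := hq1 v (by linarith)
      have h3 : a < ‖q v‖ := by
        by_cases h4 : ‖v‖ ≤ a + 2 * u + η / 2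
        · rw [hq0 v h4]; exact hv.1
        · by_contra h5
          have h6 := q.injective (hq0 (q v) (by linarith))
          rw [h6] at h5
          exact h5 hv.1
      rw [hF1 v hv, hφ1 _ h3 (by linarith), norm_rad hσ0 (hn _)]
      exact hησ _ h2
    · rw [hF2 x fun hh => hxV (image_mono hS0V hh), hφ2 x hxV, norm_zero]
      linarith
  have hs'val : ∀ w, (((s.trans (F'.symm.trans (P.symm.trans F'))) w : closedBall (0 : E) _) : E)
      = F (p.symm (F.symm (s w))) := by
    intro w
    simp only [Homeomorph.trans_apply, hF'1, hP2, hF'2]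
  refine ⟨s.trans (F'.symm.trans (P.symm.trans F')), ?_, ?_, ?_⟩
  · intro w hw
    apply Subtype.ext
    rw [hs'val, hs w hw]
    have h1 : F.symm w = w := by rw [Homeomorph.symm_apply_eq, hFbig _ hw]
    rw [h1, hp2' _ (by linarith), hFbig _ hw]
  · intro w
    show dist (φ _) (φ _) < ε
    rw [hs'val]
    set x := F.symm (s w : E) with hx
    have hsw : (s w : E) = F x := by simp [hx]
    rw [hsw]
    by_cases h4 : a + 4 * u ≤ ‖x‖
    · rw [hp2' x h4, dist_self]; exact hε
    · have h5 : ‖p.symm x‖ ≤ a + 4 * u := by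
        by_contra h6
        have h7 := p.symm.injective (hp2' _ (not_le.1 h6).le)
        rw [h7] at h6
        exact h6 (not_le.1 h4).le
      have := hsmall x (not_le.1 h4).le
      have := hsmall _ h5
      calc dist _ _ ≤ _ := dist_le_norm_add_norm _ _
        _ < ε := by linarith
  · have key : ∀ w : closedBall (0 : E) (a + 8 * u),
        φ ((s.trans (F'.symm.trans (P.symm.trans F'))) w : closedBall (0 : E) _) = 0 →
        dist w ((s.symm ∘ F') ⟨0, h0mem⟩) < ε / 2 := by
      intro w hw
      set y := (s.trans (F'.symm.trans (P.symm.trans F'))) w with hy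
      obtain ⟨hA1, hA2⟩ := hA y (mem_closedBall_zero_iff.1 y.2) hw
      have e1 : F' y = y := Subtype.ext (by rw [hF'1, hA1])
      have e2 : w = (s.symm ∘ F') (P y) := by
        have e3 : P (F'.symm y) = F'.symm (s w) := by
          rw [hy]
          simp only [Homeomorph.trans_apply, Homeomorph.symm_apply_apply,
            Homeomorph.apply_symm_apply]
        have e4 : F'.symm y = y := by rw [Homeomorph.symm_apply_eq, e1]
        rw [e4] at e3
        simp only [Function.comp_apply, e3, Homeomorph.apply_symm_apply,
          Homeomorph.symm_apply_apply]
      rw [e2]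
      apply hτ
      rw [Subtype.dist_eq, hP1, dist_zero_right]
      have := hp1 y hA2
      have := min_le_left (τ0 / 2) (a + 3 * u)
      linarith
    intro w w' hww
    have hww' : φ ((s.trans (F'.symm.trans (P.symm.trans F'))) w : closedBall (0 : E) _) =
      φ ((s.trans (F'.symm.trans (P.symm.trans F'))) w' : closedBall (0 : E) _) := hww
    by_cases hz : φ ((s.trans (F'.symm.trans (P.symm.trans F'))) w : closedBall (0 : E) _) = 0
    · have k1 := key w hz
      have k2 := key w' (hww' ▸ hz)
      calc dist w w' ≤ _ := dist_triangle_right _ _ ((s.symm ∘ F') ⟨0, h0mem⟩)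
        _ < ε := by linarith
    · have hz' := hz
      rw [hww'] at hz'
      have m1 : (((s.trans (F'.symm.trans (P.symm.trans F'))) w : closedBall (0 : E) _) : E) ∈
          g '' V := by
        by_contra hh; exact hz (hφ2 _ hh)
      have m2 : (((s.trans (F'.symm.trans (P.symm.trans F'))) w' : closedBall (0 : E) _) : E) ∈
          g '' V := by
        by_contra hh; exact hz' (hφ2 _ hh)
      obtain ⟨v, hv, hve⟩ := m1
      obtain ⟨v', hv', hve'⟩ := m2
      rw [← hve, ← hve', hφ1 v hv.1 hv.2, hφ1 v' hv'.1 hv'.2] at hww'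
      rw [← hve, hφ1 v hv.1 hv.2] at hz
      have := rad_inj (s := a + 2 * u) (by linarith) h0 hn hi hww' hz
      rw [this, hve'] at hve
      have := (s.trans (F'.symm.trans (P.symm.trans F'))).injective (Subtype.ext hve)
      rw [this, dist_self]; exact hε

end
end EK
end

section
open Topology Set Metric

namespace EK
section
variable {E : Type*} [NormedAddCommGroup E] [NormedSpace ℝ E] [FiniteDimensional ℝ E]

lemma collar0 {a u δ : ℝ} (ha : 0 < a) (hu : 0 < u) (hδ : δ ≤ u / 8) (hδa : δ ≤ a)
    {g : E → E} (hg : OE g {z | a < ‖z‖ ∧ ‖z‖ < a + 10 * u})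
    (hd : ∀ z, a < ‖z‖ → ‖z‖ < a + 10 * u → dist (g z) z < δ) :
    ∃ G : E → E, OE G (ball 0 (a + 10 * u)) ∧
      (∀ z, a + 8 * u ≤ ‖z‖ → ‖z‖ < a + 10 * u → G z = g z) ∧
      ∀ z, ‖z‖ ≤ a + 8 * u → ‖G z‖ ≤ a + 9 * u := by
  classical
  have : ProperSpace E := FiniteDimensional.proper ℝ E
  obtain ⟨σ, hσ, h0, h1, hn, hi, hp⟩ := exists_collapse (s := a + 2 * u) (t := a + 6 * u)
    (by linarith) (by linarith)
  obtain ⟨φ, hφc, hφ1, hφ2⟩ := collar_phi ha hu hδ hg hd hσ h0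
  obtain ⟨f, hfc, hfi, hf⟩ := collar_f ha hu hδ hg hd hσ h0 hn hi hp hφc hφ1 hφ2
  set V : Set E := {z | a < ‖z‖ ∧ ‖z‖ < a + 10 * u} with hV
  have : CompactSpace (closedBall (0 : E) (a + 8 * u)) :=
    isCompact_iff_compactSpace.1 (isCompact_closedBall (0 : E) (a + 8 * u))
  have h0mem : (0 : E) ∈ closedBall (0 : E) (a + 8 * u) := mem_closedBall_self (by linarith)
  haveI : Nonempty (closedBall (0 : E) (a + 8 * u)) := ⟨⟨0, h0mem⟩⟩
  have hfbig : ∀ w : closedBall (0 : E) (a + 8 * u), a + 7 * u ≤ ‖(w : E)‖ → f w = φ w := by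
    intro w hw
    refine eq_of_forall_dist_le fun ε hε => ?_
    obtain ⟨s, hs1, hs2⟩ := hf ε hε
    have := hs2 w
    rw [hs1 w hw] at this
    exact this.le
  -- value on points g z, z in the outer collar
  have hout : ∀ z, a + 7 * u + u / 4 ≤ ‖z‖ → ‖z‖ < a + 10 * u →
      ∀ w : closedBall (0 : E) (a + 8 * u), (w : E) = g z → f w = z := by
    intro z hz1 hz2 w hw
    have := norm_close (hd z (by linarith) hz2)
    rw [hfbig w (by rw [hw]; linarith), hw, hφ1 z (by linarith) hz2]
    exact rad_id (h1 _ (by linarith))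
  have hfs : ∀ p : E, ‖p‖ ≤ a + 7 * u + 3 * u / 4 → ∃ w, f w = p := by
    intro p hp'
    have h2 : ∃ w : closedBall (0 : E) (a + 8 * u), φ w = p := by
      by_cases hp0 : p = 0
      · refine ⟨⟨0, h0mem⟩, ?_⟩
        rw [hp0]
        refine hφ2 _ ?_
        rintro ⟨v, hv, hv0⟩
        have := norm_close (hd v hv.1 hv.2)
        rw [hv0] at this
        simp only [norm_zero] at this
        linarith [hv.1]
      · obtain ⟨v, hv1, hv2, hv3⟩ := rad_surj (s := a + 2 * u) (t := a + 6 * u) (by linarith)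
          (by linarith) hσ h0 h1 p hp0
        have hv4 : ‖v‖ ≤ a + 7 * u + 3 * u / 4 := hv2.trans (max_le (by linarith) hp')
        have := norm_close (hd v (by linarith) (by linarith))
        refine ⟨⟨g v, mem_closedBall_zero_iff.2 (by linarith)⟩, ?_⟩
        show φ (g v) = p
        rw [hφ1 v (by linarith) (by linarith), hv3]
    obtain ⟨w, hw⟩ := h2
    have hcl : IsClosed (range f) := (isCompact_range hfc).isClosed
    have : p ∈ closure (range f) := by
      rw [Metric.mem_closure_iff]
      intro ε hε
      obtain ⟨s, hs1, hs2⟩ := hf ε hε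
      refine ⟨f (s.symm w), ⟨_, rfl⟩, ?_⟩
      have := hs2 (s.symm w)
      rw [Homeomorph.apply_symm_apply, hw] at this
      rwa [dist_comm]
    rw [hcl.closure_eq] at this
    exact this
  let k : E → E := fun z => (Function.invFun f z : closedBall (0 : E) (a + 8 * u))
  have hfk : ∀ z, ‖z‖ ≤ a + 7 * u + 3 * u / 4 → f (Function.invFun f z) = z := fun z hz =>
    Function.invFun_eq (hfs z hz)
  have hkf : ∀ w, k (f w) = w := fun w => by
    simp only [k, Function.leftInverse_invFun hfi w]
  have hkout : ∀ z, a + 7 * u + u / 4 ≤ ‖z‖ → ‖z‖ ≤ a + 7 * u + 3 * u / 4 → k z = g z := by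
    intro z hz1 hz2
    have h3 := norm_close (hd z (by linarith) (by linarith))
    have h4 := hout z hz1 (by linarith) ⟨g z, mem_closedBall_zero_iff.2 (by linarith)⟩ rfl
    conv_lhs => rw [← h4]
    exact hkf _
  have hkn : ∀ z, ‖k z‖ ≤ a + 8 * u := fun z =>
    mem_closedBall_zero_iff.1 (Function.invFun f z).2
  have hkOE : OE k (ball 0 (a + 7 * u + 3 * u / 4)) := by
    have hemb : IsClosedEmbedding f := hfc.isClosedEmbedding hfi
    refine ⟨?_, ?_, ?_⟩
    · have hr : ContinuousOn k (range f) := by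
        rw [continuousOn_iff_continuous_domRestrict]
        have : (range f).domRestrict k = fun y => ((hemb.isEmbedding.toHomeomorph.symm y :
            closedBall (0 : E) (a + 8 * u)) : E) := by
          funext ⟨y, w, hw⟩
          subst hw
          have e : hemb.isEmbedding.toHomeomorph.symm ⟨f w, ⟨w, rfl⟩⟩ = w := by
            rw [Homeomorph.symm_apply_eq]; rfl
          rw [e]
          exact hkf w
        rw [this]
        fun_prop
      refine hr.mono ?_
      intro z hz
      exact hfs z (mem_ball_zero_iff.1 hz).le
    · intro z hz z' hz' hzz
      have := Subtype.ext hzz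
      rw [← hfk z (mem_ball_zero_iff.1 hz).le, ← hfk z' (mem_ball_zero_iff.1 hz').le, this]
    · intro W hW hWo
      obtain ⟨O, hO, hOe⟩ := isOpen_induced_iff.1 (hWo.preimage hfc)
      have : k '' W = O ∩ ball 0 (a + 8 * u) := by
        ext y
        constructor
        · rintro ⟨z, hz, rfl⟩
          have hz' := mem_ball_zero_iff.1 (hW hz)
          have hm : Function.invFun f z ∈ f ⁻¹' W := by
            show f (Function.invFun f z) ∈ W
            rw [hfk z hz'.le]; exact hz
          refine ⟨by rw [← hOe] at hm; exact hm, ?_⟩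
          rw [mem_ball_zero_iff]
          by_contra hcon
          have hkz : ‖k z‖ = a + 8 * u := le_antisymm (hkn z) (not_lt.1 hcon)
          obtain ⟨v, hv, hvk⟩ := collar_in hδ hu hg hd (y := k z) (by rw [hkz]; linarith)
            (by rw [hkz]; linarith)
          have h5 := norm_close (hd v hv.1 hv.2)
          rw [hvk] at h5
          have h6 := hout v (by linarith) (by linarith [hv.2]) (Function.invFun f z) hvk.symm
          rw [hfk z hz'.le] at h6
          rw [h6] at hz'
          linarith
        · rintro ⟨hy1, hy2⟩
          have hy3 : y ∈ closedBall (0 : E) (a + 8 * u) := ball_subset_closedBall hy2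
          have hm : (⟨y, hy3⟩ : closedBall (0 : E) (a + 8 * u)) ∈ f ⁻¹' W := by
            rw [← hOe]; exact hy1
          exact ⟨f ⟨y, hy3⟩, hm, hkf _⟩
      rw [this]
      exact hO.inter isOpen_ball
  let G : E → E := fun z => if ‖z‖ < a + 7 * u + u / 2 then k z else g z
  have hG1 : ∀ z, ‖z‖ < a + 7 * u + 3 * u / 4 → G z = k z := by
    intro z hz
    by_cases h : ‖z‖ < a + 7 * u + u / 2
    · simp [G, h]
    · simp only [G, h, if_false]
      exact (hkout z (by linarith) hz.le).symm
  have hG2 : ∀ z, a + 7 * u + u / 4 ≤ ‖z‖ → G z = g z := by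
    intro z hz
    by_cases h : ‖z‖ < a + 7 * u + u / 2
    · simp only [G, h, if_true]
      exact (hkout z (by linarith) (by linarith))
    · simp [G, h]
  have hmix : ∀ z z', ‖z‖ < a + 7 * u + u / 2 → a + 7 * u + u / 2 ≤ ‖z'‖ → ‖z'‖ < a + 10 * u →
      G z = G z' → z = z' := by
    intro z z' h2 h3 h4 h5
    rw [hG1 z (by linarith), hG2 z' (by linarith)] at h5
    have := hout z' (by linarith) h4 (Function.invFun f z) h5
    rwa [hfk z (by linarith)] at this
  refine ⟨G, ?_, ?_, ?_⟩
  · refine OE.of_two (W1 := ball 0 (a + 7 * u + 3 * u / 4))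
      (W2 := {z | a + 7 * u + u / 4 < ‖z‖ ∧ ‖z‖ < a + 10 * u}) isOpen_ball
      ((isOpen_lt continuous_const continuous_norm).inter
        (isOpen_lt continuous_norm continuous_const))
      (hkOE.congr fun x hx => hG1 x (mem_ball_zero_iff.1 hx))
      ((hg.mono fun z hz => ⟨by linarith [hz.1], hz.2⟩).congr fun x hx => hG2 x hx.1.le) ?_ ?_
    · intro z hz
      by_cases h : ‖z‖ < a + 7 * u + 3 * u / 4
      · exact Or.inl (mem_ball_zero_iff.2 h)
      · exact Or.inr ⟨by linarith, mem_ball_zero_iff.1 hz⟩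
    · intro z hz z' hz' hzz
      rw [mem_ball_zero_iff] at hz hz'
      by_cases h : ‖z‖ < a + 7 * u + u / 2
      · by_cases h' : ‖z'‖ < a + 7 * u + u / 2
        · rw [hG1 z (by linarith), hG1 z' (by linarith)] at hzz
          exact hkOE.inj (mem_ball_zero_iff.2 (by linarith)) (mem_ball_zero_iff.2 (by linarith)) hzz
        · exact hmix z z' h (not_lt.1 h') hz' hzz
      · by_cases h' : ‖z'‖ < a + 7 * u + u / 2
        · exact (hmix z' z h' (not_lt.1 h) hz hzz.symm).symm
        · rw [hG2 z (by linarith), hG2 z' (by linarith)] at hzz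
          exact hg.inj ⟨by linarith, hz⟩ ⟨by linarith, hz'⟩ hzz
  · intro z hz1 hz2
    exact hG2 z (by linarith)
  · intro z hz
    by_cases h : ‖z‖ < a + 7 * u + u / 2
    · rw [hG1 z (by linarith)]
      linarith [hkn z]
    · rw [hG2 z (by linarith)]
      have := norm_close (hd z (by linarith) (by linarith))
      linarith

/-- controlled Schoenflies lemma -/
lemma collar {a b : ℝ} (ha : 0 < a) (hab : a < b) :
    ∃ c, a < c ∧ c < b ∧ ∀ ε > 0, ∃ δ > 0, ∀ g : E → E, OE g {z | a < ‖z‖ ∧ ‖z‖ < b} →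
      (∀ z, a < ‖z‖ → ‖z‖ < b → dist (g z) z < δ) →
      ∃ G : E → E, OE G (ball 0 b) ∧ (∀ z, c ≤ ‖z‖ → ‖z‖ < b → G z = g z) ∧
        ∀ z, ‖z‖ < b → dist (G z) z < ε := by
  have : ProperSpace E := FiniteDimensional.proper ℝ E
  obtain ⟨u, hu, rfl⟩ : ∃ u > 0, b = a + 10 * u := ⟨(b - a) / 10, by linarith, by ring⟩
  refine ⟨a + 9 * u + 3 * u / 4, by linarith, by linarith, fun ε hε => ?_⟩
  obtain ⟨S, hS0, hS1, hS2⟩ := squeeze (E := E) (c0 := 0) (c1 := min (ε / 4) (a + 9 * u))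
    (a := a + 9 * u) (b := a + 9 * u + u / 2) le_rfl (lt_min (by linarith) (by linarith))
    (min_le_right _ _) (by linarith)
  have hS2' : ∀ z, a + 9 * u + u / 2 ≤ ‖z‖ → S.symm z = z := fun z hz => by
    rw [Homeomorph.symm_apply_eq, hS2 z hz]
  obtain ⟨δ0, hδ0, hu0⟩ := Metric.uniformContinuousOn_iff.1
    ((isCompact_closedBall (0 : E) (a + 12 * u)).uniformContinuousOn_of_continuous
      S.continuous.continuousOn) ε hε
  refine ⟨min δ0 (min (u / 8) a), lt_min hδ0 (lt_min (by linarith) ha), fun g hg hd => ?_⟩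
  have hδ1 : min δ0 (min (u / 8) a) ≤ δ0 := min_le_left _ _
  have hδ2 : min δ0 (min (u / 8) a) ≤ u / 8 := (min_le_right _ _).trans (min_le_left _ _)
  have hδ3 : min δ0 (min (u / 8) a) ≤ a := (min_le_right _ _).trans (min_le_right _ _)
  obtain ⟨G, hG, hG1, hG2⟩ := collar0 ha hu hδ2 hδ3 hg hd
  have hSb : ∀ z, ‖z‖ < a + 10 * u → ‖S.symm z‖ < a + 10 * u := by
    intro z hz
    by_contra h6
    have h7 := S.symm.injective (hS2' (S.symm z) (by linarith))
    rw [h7] at h6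
    exact h6 hz
  refine ⟨fun z => S (G (S.symm z)), ?_, ?_, ?_⟩
  · have h1 : OE (G ∘ S.symm) (ball 0 (a + 10 * u)) := hG.comp (OE.of_homeo S.symm _)
      (fun z hz => mem_ball_zero_iff.2 (hSb z (mem_ball_zero_iff.1 hz)))
    exact (OE.of_homeo S univ).comp h1 (mapsTo_univ _ _)
  · intro z hz1 hz2
    simp only
    rw [hS2' z (by linarith), hG1 z (by linarith) hz2]
    have := norm_close (hd z (by linarith) hz2)
    exact hS2 _ (by linarith)
  · intro z hz
    have hz' := hSb z hz
    set w := S.symm z with hw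
    have hzw : z = S w := by simp [hw]
    show dist (S (G w)) z < ε
    clear_value w
    by_cases h : ‖w‖ ≤ a + 8 * u
    · have k1 := hS1 _ (hG2 w h)
      have k2 := hS1 w (by linarith)
      rw [hzw]
      have := min_le_left (ε / 4) (a + 9 * u)
      calc dist _ _ ≤ _ := dist_le_norm_add_norm _ _
        _ < ε := by linarith
    · push Not at h
      rw [hG1 w h.le hz', hzw]
      have k1 := hd w (by linarith) hz'
      have k2 := norm_close k1
      exact hu0 _ (mem_closedBall_zero_iff.2 (by linarith)) _
        (mem_closedBall_zero_iff.2 (by linarith)) (k1.trans_le hδ1)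

end
end EK
end

section
open Topology Set Metric

namespace EK
section
variable {E : Type*} [NormedAddCommGroup E] [NormedSpace ℝ E]

/-- radial compression of the space onto the ball of radius `l`. -/
noncomputable def cp (ρ l : ℝ) (q : E) : E := (l / (max ‖q‖ ρ + (l - ρ))) • q

/-- inverse of `cp` -/
noncomputable def ck (ρ l : ℝ) (p : E) : E := ((l - ρ) / (l - max ‖p‖ ρ)) • p

lemma cp_ck {ρ l : ℝ} (hρ : 0 < ρ) (hl : ρ < l) (p : E) (hp : ‖p‖ < l) :
    cp ρ l (ck ρ l p) = p := by
  by_cases h : ‖p‖ ≤ ρ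
  · have h1 : ck ρ l p = p := by
      unfold ck
      rw [max_eq_right h, div_self (by linarith), one_smul]
    rw [h1]
    unfold cp
    rw [max_eq_right h]
    have : ρ + (l - ρ) = l := by ring
    rw [this, div_self (by linarith), one_smul]
  · push Not at h
    have h1 : ‖ck ρ l p‖ = (l - ρ) * ‖p‖ / (l - ‖p‖) := by
      unfold ck
      rw [max_eq_left h.le, norm_smul, Real.norm_eq_abs, abs_of_pos
        (div_pos (by linarith) (by linarith))]
      ring
    have hlp : 0 < l - ‖p‖ := by linarith
    have hlr : 0 < l - ρ := by linarith
    have h2 : ρ ≤ (l - ρ) * ‖p‖ / (l - ‖p‖) := by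
      rw [le_div_iff₀ hlp]; nlinarith
    unfold cp
    rw [h1, max_eq_left h2]
    unfold ck
    rw [max_eq_left h.le, smul_smul]
    have h3 : (l - ρ) * ‖p‖ / (l - ‖p‖) + (l - ρ) = (l - ρ) * l / (l - ‖p‖) := by
      field_simp
      ring
    rw [h3]
    have hl0 : l ≠ 0 := by linarith
    have : l / ((l - ρ) * l / (l - ‖p‖)) * ((l - ρ) / (l - ‖p‖)) = 1 := by
      field_simp
    rw [this, one_smul]

lemma norm_cp_lt {ρ l : ℝ} (hρ : 0 < ρ) (hl : ρ < l) (q : E) : ‖cp ρ l q‖ < l := by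
  unfold cp
  have h1 := le_max_left ‖q‖ ρ
  have h2 := norm_nonneg q
  have h3 : 0 < max ‖q‖ ρ + (l - ρ) := by linarith
  rw [norm_smul, Real.norm_eq_abs, abs_of_pos (div_pos (by linarith) h3),
    div_mul_eq_mul_div, div_lt_iff₀ h3]
  have : 0 < l := by linarith
  nlinarith

lemma ck_cp {ρ l : ℝ} (hρ : 0 < ρ) (hl : ρ < l) (q : E) : ck ρ l (cp ρ l q) = q := by
  by_cases h : ‖q‖ ≤ ρ
  · have h1 : cp ρ l q = q := by
      unfold cp
      rw [max_eq_right h]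
      have : ρ + (l - ρ) = l := by ring
      rw [this, div_self (by linarith), one_smul]
    rw [h1]
    unfold ck
    rw [max_eq_right h, div_self (by linarith), one_smul]
  · push Not at h
    have hq : 0 < ‖q‖ + (l - ρ) := by linarith
    have hl0 : 0 < l := by linarith
    have h1 : ‖cp ρ l q‖ = l * ‖q‖ / (‖q‖ + (l - ρ)) := by
      unfold cp
      rw [max_eq_left h.le, norm_smul, Real.norm_eq_abs, abs_of_pos (div_pos (by linarith) hq)]
      ring
    have h2 : ρ ≤ l * ‖q‖ / (‖q‖ + (l - ρ)) := by
      rw [le_div_iff₀ hq]; nlinarith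
    unfold ck
    rw [h1, max_eq_left h2]
    unfold cp
    rw [max_eq_left h.le, smul_smul]
    have h3 : l - l * ‖q‖ / (‖q‖ + (l - ρ)) = l * (l - ρ) / (‖q‖ + (l - ρ)) := by
      field_simp
      ring
    rw [h3]
    have hlr : l - ρ ≠ 0 := by linarith
    have : (l - ρ) / (l * (l - ρ) / (‖q‖ + (l - ρ))) * (l / (‖q‖ + (l - ρ))) = 1 := by
      field_simp
    rw [this, one_smul]

lemma cp_lip {ρ l : ℝ} (hρ : 0 < ρ) (hl : ρ < l) (q q' : E) :
    ‖cp ρ l q' - cp ρ l q‖ ≤ 2 * l / (max ‖q‖ ρ + (l - ρ)) * ‖q' - q‖ := by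
  unfold cp
  set m := max ‖q‖ ρ + (l - ρ) with hm
  set m' := max ‖q'‖ ρ + (l - ρ) with hm'
  have i1 : l ≤ m := by have := le_max_right ‖q‖ ρ; linarith
  have i2 : l ≤ m' := by have := le_max_right ‖q'‖ ρ; linarith
  have i3 : ‖q'‖ ≤ m' := by have := le_max_left ‖q'‖ ρ; linarith
  have hl0 : 0 < l := by linarith
  have i4 : |m - m'| ≤ ‖q' - q‖ := by
    have e : m - m' = max ‖q‖ ρ - max ‖q'‖ ρ := by rw [hm, hm']; ring
    rw [e]
    calc _ ≤ |‖q‖ - ‖q'‖| := abs_max_sub_max_le_abs _ _ _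
      _ ≤ ‖q - q'‖ := abs_norm_sub_norm_le _ _
      _ = _ := norm_sub_rev _ _
  have hm0 : m ≠ 0 := by linarith
  have hm0' : m' ≠ 0 := by linarith
  have e1 : (l / m') • q' - (l / m) • q = (l / m) • (q' - q) + (l / m * ((m - m') / m')) • q' := by
    rw [smul_sub]
    have : l / m' = l / m + l / m * ((m - m') / m') := by
      field_simp
      ring
    rw [this, add_smul]
    abel
  rw [e1]
  calc _ ≤ ‖(l / m) • (q' - q)‖ + ‖(l / m * ((m - m') / m')) • q'‖ := norm_add_le _ _
    _ ≤ l / m * ‖q' - q‖ + l / m * ‖q' - q‖ := by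
      have hlm : 0 < l / m := div_pos hl0 (by linarith)
      rw [norm_smul, norm_smul, Real.norm_eq_abs, Real.norm_eq_abs, abs_of_pos hlm, abs_mul,
        abs_of_pos hlm, abs_div, abs_of_pos (show 0 < m' by linarith), mul_assoc]
      gcongr
      rw [div_mul_eq_mul_div, div_le_iff₀ (by linarith)]
      have := abs_nonneg (m - m')
      have := norm_nonneg (q' - q)
      nlinarith
    _ = _ := by ring

open Classical in
/-- conjugation by the compression -/
noncomputable def cmpr (ρ l : ℝ) (f : E → E) (p : E) : E :=
  if ‖p‖ < l then cp ρ l (f (ck ρ l p)) else p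

lemma cmpr_bound {ρ l ε : ℝ} (hρ : 0 < ρ) (hl : ρ < l) {f : E → E} (hf : ∀ p, ‖f p - p‖ ≤ ε)
    (p : E) : ‖cmpr ρ l f p - p‖ ≤ 2 * ε ∧
      ‖cmpr ρ l f p - p‖ ≤ 2 * ε / (l - ρ) * max 0 (l - ‖p‖) := by
  have hε : 0 ≤ ε := (norm_nonneg _).trans (hf 0)
  have hlr : 0 < l - ρ := by linarith
  unfold cmpr
  split_ifs with h
  · have h1 := cp_lip hρ hl (ck ρ l p) (f (ck ρ l p))
    rw [cp_ck hρ hl p h] at h1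
    have h2 := hf (ck ρ l p)
    have hm : l ≤ max ‖ck ρ l p‖ ρ + (l - ρ) := by
      have := le_max_right ‖ck ρ l p‖ ρ; linarith
    have hl0 : 0 < l := by linarith
    constructor
    · refine h1.trans ?_
      have : 2 * l / (max ‖ck ρ l p‖ ρ + (l - ρ)) ≤ 2 := by
        rw [div_le_iff₀ (by linarith)]; linarith
      have h3 := norm_nonneg (f (ck ρ l p) - ck ρ l p)
      nlinarith
    · have hmax : max 0 (l - ‖p‖) = l - ‖p‖ := max_eq_right (by linarith)
      rw [hmax]
      refine h1.trans ?_
      have : 2 * l / (max ‖ck ρ l p‖ ρ + (l - ρ)) ≤ 2 * (l - ‖p‖) / (l - ρ) := by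
        rw [div_le_div_iff₀ (by linarith) hlr]
        by_cases hp : ‖p‖ ≤ ρ
        · nlinarith
        · push Not at hp
          have hlp : 0 < l - ‖p‖ := by linarith
          have h1 : ‖ck ρ l p‖ = (l - ρ) * ‖p‖ / (l - ‖p‖) := by
            unfold ck
            rw [max_eq_left hp.le, norm_smul, Real.norm_eq_abs, abs_of_pos
              (div_pos (by linarith) (by linarith))]
            ring
          have h4 : (l - ‖p‖) * ((l - ρ) * ‖p‖ / (l - ‖p‖)) = (l - ρ) * ‖p‖ := by
            field_simp
          have h5 := le_max_left ‖ck ρ l p‖ ρ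
          rw [h1] at h5 ⊢
          nlinarith
      calc _ ≤ 2 * (l - ‖p‖) / (l - ρ) * ε := by
            refine mul_le_mul this h2 (norm_nonneg _) ?_
            exact div_nonneg (by linarith) hlr.le
        _ = _ := by ring
  · rw [sub_self, norm_zero]
    exact ⟨by linarith, by positivity⟩

lemma cmpr_cont {ρ l ε : ℝ} (hρ : 0 < ρ) (hl : ρ < l) {f : E → E} (hfc : Continuous f)
    (hf : ∀ p, ‖f p - p‖ ≤ ε) : Continuous (cmpr ρ l f) := by
  rw [continuous_iff_continuousAt]
  intro p
  by_cases h : ‖p‖ < l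
  · have h1 : ContinuousAt (ck ρ l) p := by
      unfold ck
      refine ContinuousAt.smul (ContinuousAt.div (by fun_prop) (by fun_prop) ?_) continuousAt_id
      have : max ‖p‖ ρ < l := max_lt h hl
      linarith
    have h2 : Continuous (cp ρ l : E → E) := by
      unfold cp
      refine Continuous.smul (Continuous.div (by fun_prop) (by fun_prop) ?_) continuous_id
      intro x
      have := le_max_right ‖x‖ ρ
      linarith
    have h3 : ContinuousAt (fun p => cp ρ l (f (ck ρ l p))) p :=
      (h2.comp hfc).continuousAt.comp h1
    refine h3.congr ?_
    filter_upwards [(isOpen_lt continuous_norm continuous_const).mem_nhds h] with y hy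
    simp only [cmpr]
    rw [if_pos hy]
  · have h0 : cmpr ρ l f p - p = 0 := by simp [cmpr, h]
    have h1 : ContinuousAt (fun p => cmpr ρ l f p - p) p := by
      rw [ContinuousAt, h0, tendsto_zero_iff_norm_tendsto_zero]
      have h2 : Filter.Tendsto (fun p : E => 2 * ε / (l - ρ) * max 0 (l - ‖p‖)) (𝓝 p) (𝓝 0) := by
        have hc : Continuous (fun p : E => 2 * ε / (l - ρ) * max 0 (l - ‖p‖)) := by fun_prop
        have := hc.tendsto p
        rwa [max_eq_left (by linarith), mul_zero] at this
      exact squeeze_zero (fun _ => norm_nonneg _) (fun y => (cmpr_bound hρ hl hf y).2) h2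
    have := h1.add (continuousAt_id (x := p))
    refine this.congr (Filter.Eventually.of_forall fun y => ?_)
    simp

lemma compress {ρ l ε : ℝ} (hρ : 0 < ρ) (hl : ρ < l) (f : E ≃ₜ E) (hf : ∀ p, ‖f p - p‖ ≤ ε) :
    ∃ h : E ≃ₜ E, (∀ p, l ≤ ‖p‖ → h p = p) ∧ (∀ p, ‖p‖ ≤ ρ → ‖f p‖ ≤ ρ → h p = f p) ∧
      (∀ p, (∀ t : ℝ, 1 ≤ t → f (t • p) = t • p) → h p = p) ∧ ∀ p, ‖h p - p‖ ≤ 2 * ε := by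
  have hf' : ∀ p, ‖f.symm p - p‖ ≤ ε := fun p => by
    have := hf (f.symm p)
    rw [Homeomorph.apply_symm_apply] at this
    rwa [norm_sub_rev]
  have inv : ∀ (f : E ≃ₜ E) p, cmpr ρ l f.symm (cmpr ρ l f p) = p := by
    intro f p
    by_cases h : ‖p‖ < l
    · have h1 : cmpr ρ l f p = cp ρ l (f (ck ρ l p)) := by simp [cmpr, h]
      rw [h1]
      simp only [cmpr]
      rw [if_pos (norm_cp_lt hρ hl _), ck_cp hρ hl, Homeomorph.symm_apply_apply, cp_ck hρ hl p h]
    · have h1 : ∀ f : E → E, cmpr ρ l f p = p := fun f => by simp [cmpr, h]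
      rw [h1, h1]
  refine ⟨{ toFun := cmpr ρ l f
            invFun := cmpr ρ l f.symm
            left_inv := inv f
            right_inv := inv f.symm
            continuous_toFun := cmpr_cont hρ hl f.continuous hf
            continuous_invFun := cmpr_cont hρ hl f.symm.continuous hf' }, ?_, ?_, ?_, ?_⟩
  · intro p hp
    show cmpr ρ l f p = p
    simp [cmpr, not_lt.2 hp]
  · intro p hp hfp
    show cmpr ρ l f p = f p
    have h1 : ck ρ l p = p := by
      unfold ck
      rw [max_eq_right hp, div_self (by linarith), one_smul]
    have h2 : cp ρ l (f p) = f p := by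
      unfold cp
      rw [max_eq_right hfp]
      have : ρ + (l - ρ) = l := by ring
      rw [this, div_self (by linarith), one_smul]
    simp only [cmpr]
    rw [if_pos (by linarith), h1, h2]
  · intro p hp
    show cmpr ρ l f p = p
    by_cases h : ‖p‖ < l
    · have h1 : f (ck ρ l p) = ck ρ l p := by
        refine hp _ ?_
        have : max ‖p‖ ρ < l := max_lt h hl
        rw [le_div_iff₀ (by linarith)]
        have := le_max_right ‖p‖ ρ
        linarith
      simp only [cmpr]
      rw [if_pos h, h1, cp_ck hρ hl p h]
    · simp [cmpr, h]
  · intro p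
    exact (cmpr_bound hρ hl hf p).1

end
end EK
end

section
open Topology Set Metric

namespace EK

/-- `f` is a local homeomorphism on `U` -/
def LH {X Y : Type*} [TopologicalSpace X] [TopologicalSpace Y] (f : X → Y) (U : Set X) : Prop :=
  ∀ x ∈ U, ∃ W, IsOpen W ∧ x ∈ W ∧ W ⊆ U ∧ OE f W

section
variable {X Y Z W : Type*} [TopologicalSpace X] [TopologicalSpace Y] [TopologicalSpace Z]
  [TopologicalSpace W]

lemma LH.contAt {f : X → Y} {U : Set X} (h : LH f U) {x : X} (hx : x ∈ U) : ContinuousAt f x := by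
  obtain ⟨W, hW, hxW, -, hO⟩ := h x hx
  exact hO.cont.continuousAt (hW.mem_nhds hxW)

lemma LH.contOn {f : X → Y} {U : Set X} (h : LH f U) : ContinuousOn f U :=
  fun _ hx => (h.contAt hx).continuousWithinAt

lemma LH.isOpen {f : X → Y} {U : Set X} (h : LH f U) : IsOpen U := by
  rw [isOpen_iff_mem_nhds]
  intro x hx
  obtain ⟨W, hW, hxW, hWU, -⟩ := h x hx
  exact Filter.mem_of_superset (hW.mem_nhds hxW) hWU

lemma LH.comp {f : X → Y} {g : Y → Z} {U : Set X} {V : Set Y} (hg : LH g V) (hf : LH f U)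
    (hm : MapsTo f U V) : LH (g ∘ f) U := by
  intro x hx
  obtain ⟨A, hA, hxA, hAU, hfA⟩ := hf x hx
  obtain ⟨B, hB, hxB, hBV, hgB⟩ := hg (f x) (hm hx)
  refine ⟨A ∩ f ⁻¹' B, hfA.cont.isOpen_inter_preimage hA hB, ⟨hxA, hxB⟩,
    inter_subset_left.trans hAU, hgB.comp (hfA.mono inter_subset_left) fun y hy => hy.2⟩

lemma LH.of_homeo (h : X ≃ₜ Y) {U : Set X} (hU : IsOpen U) : LH h U :=
  fun x hx => ⟨U, hU, hx, subset_rfl, OE.of_homeo h U⟩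

lemma OE.prodMap {f : X → Y} {g : Z → W} {U : Set X} {V : Set Z} (hf : OE f U) (hg : OE g V) :
    OE (Prod.map f g) (U ×ˢ V) := by
  refine ⟨hf.cont.prodMap hg.cont, ?_, ?_⟩
  · rintro ⟨a, b⟩ ⟨ha, hb⟩ ⟨a', b'⟩ ⟨ha', hb'⟩ h
    simp only [Prod.map_apply, Prod.mk.injEq] at h
    exact Prod.ext (hf.inj ha ha' h.1) (hg.inj hb hb' h.2)
  · intro O hO hOo
    rw [isOpen_iff_mem_nhds]
    rintro _ ⟨⟨a, b⟩, hab, rfl⟩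
    obtain ⟨A, B, hA, hB, haA, hbB, hAB⟩ := isOpen_prod_iff.1 hOo a b hab
    have hne : ∀ x ∈ A, x ∈ U := fun x hx => (hO (hAB (show (x, b) ∈ A ×ˢ B from ⟨hx, hbB⟩))).1
    have hne' : ∀ x ∈ B, x ∈ V := fun x hx => (hO (hAB (show (a, x) ∈ A ×ˢ B from ⟨haA, hx⟩))).2
    refine Filter.mem_of_superset (((hf.opn A hne hA).prod (hg.opn B hne' hB)).mem_nhds
      ⟨⟨a, haA, rfl⟩, ⟨b, hbB, rfl⟩⟩) ?_
    rintro ⟨_, _⟩ ⟨⟨x, hx, rfl⟩, ⟨y, hy, rfl⟩⟩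
    exact ⟨(x, y), hAB ⟨hx, hy⟩, rfl⟩

lemma LH.prodMap {f : X → Y} {g : Z → W} {U : Set X} {V : Set Z} (hf : LH f U) (hg : LH g V) :
    LH (Prod.map f g) (U ×ˢ V) := by
  rintro ⟨a, b⟩ ⟨ha, hb⟩
  obtain ⟨A, hA, hxA, hAU, hfA⟩ := hf a ha
  obtain ⟨B, hB, hxB, hBV, hgB⟩ := hg b hb
  exact ⟨A ×ˢ B, hA.prod hB, ⟨hxA, hxB⟩, prod_mono hAU hBV, hfA.prodMap hgB⟩

lemma LH.id {U : Set X} (hU : IsOpen U) : LH (id : X → X) U := LH.of_homeo (Homeomorph.refl X) hU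
end

/-- exponential polar coordinates -/
noncomputable def polar (p : ℝ × ℝ) : ℝ × ℝ :=
  (Real.exp p.1 * Real.cos (2 * Real.pi * p.2), Real.exp p.1 * Real.sin (2 * Real.pi * p.2))

lemma polar_eq (p : ℝ × ℝ) :
    polar p = ((Complex.exp ⟨p.1, 2 * Real.pi * p.2⟩).re, (Complex.exp ⟨p.1, 2 * Real.pi * p.2⟩).im) := by
  rw [Complex.exp_re, Complex.exp_im]; rfl

lemma polar_periodic (r u : ℝ) (j : ℤ) : polar (r, u + j) = polar (r, u) := by
  unfold polar
  have : 2 * Real.pi * (u + j) = 2 * Real.pi * u + j * (2 * Real.pi) := by ring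
  simp only [this, Real.cos_add_int_mul_two_pi, Real.sin_add_int_mul_two_pi]

/-- scaling identification of the plane with `ℂ` -/
noncomputable def toC : ℝ × ℝ ≃ₜ ℂ where
  toFun p := ⟨p.1, 2 * Real.pi * p.2⟩
  invFun z := (z.re, z.im / (2 * Real.pi))
  left_inv p := by
    have := Real.pi_pos
    ext <;> simp
  right_inv z := by
    have := Real.pi_pos
    apply Complex.ext <;> simp
    field_simp
  continuous_toFun := by
    have : (fun p : ℝ × ℝ => (⟨p.1, 2 * Real.pi * p.2⟩ : ℂ)) =
        fun p => (p.1 : ℂ) + ((2 * Real.pi * p.2 : ℝ) : ℂ) * Complex.I := by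
      funext p
      apply Complex.ext <;> simp
    rw [this]
    fun_prop
  continuous_invFun := by fun_prop

lemma polar_LH : LH polar univ := by
  rintro ⟨r0, u0⟩ -
  have hU : IsOpen {p : ℝ × ℝ | |p.2 - u0| < 1 / 2} :=
    isOpen_lt (by fun_prop) (by fun_prop)
  refine ⟨{p | |p.2 - u0| < 1 / 2}, hU, by simp, subset_univ _, ?_, ?_, ?_⟩
  · apply Continuous.continuousOn
    unfold polar
    fun_prop
  · rintro ⟨r, u⟩ hu ⟨r', u'⟩ hu' h
    rw [polar_eq, polar_eq] at h
    simp only [Prod.mk.injEq] at h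
    have h2 := Complex.ext h.1 h.2
    rw [Complex.exp_eq_exp_iff_exists_int] at h2
    obtain ⟨n, hn⟩ := h2
    have hre := congrArg Complex.re hn
    have him := congrArg Complex.im hn
    simp at hre him
    have hpi := Real.pi_pos
    have h3 : u = u' + n := by
      have : 2 * Real.pi * u = 2 * Real.pi * (u' + n) := by linarith
      exact mul_left_cancel₀ (by positivity) this
    have hu2 : |u - u0| < 1 / 2 := hu
    have hu2' : |u' - u0| < 1 / 2 := hu'
    rw [abs_lt] at hu2 hu2'
    have hn1 : (n : ℝ) < 1 := by linarith
    have hn2 : (-1 : ℝ) < n := by linarith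
    have hn0 : n = 0 := by
      have : n < 1 := by exact_mod_cast hn1
      have : -1 < n := by exact_mod_cast hn2
      omega
    rw [hn0] at h3
    simp at h3
    rw [hre, h3]
  · intro W _ hW
    have h1 : polar = Complex.equivRealProdCLM.toHomeomorph ∘ Complex.exp ∘ toC := by
      funext p
      rw [polar_eq]
      rfl
    rw [h1, image_comp, image_comp]
    exact Complex.equivRealProdCLM.toHomeomorph.isOpenMap _
      (Complex.isOpenMap_exp _ (toC.isOpenMap _ hW))

end EK
end

section
open Topology Set Metric

namespace EK

lemma exists_saw {δ : ℝ} (hδ : 0 < δ) (hδ2 : δ ≤ 1 / 8) :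
    ∃ γ : ℝ → ℝ, Continuous γ ∧ (∀ w, |γ w| ≤ 2 * δ) ∧ (∀ w : ℝ, ∀ j : ℤ, γ (w + j) = γ w) ∧
      ∀ w : ℝ, ∀ j : ℤ, |w - j| ≤ 2 * δ → γ w = w - j := by
  have hpi := Real.pi_pos
  let f : ℝ → ℝ := fun w => Real.arcsin (Real.sin (2 * Real.pi * w)) / (2 * Real.pi)
  have hper : ∀ w, ∀ j : ℤ, f (w + j) = f w := by
    intro w j
    have : 2 * Real.pi * (w + j) = 2 * Real.pi * w + j * (2 * Real.pi) := by ring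
    simp only [f, this, Real.sin_add_int_mul_two_pi]
  have hlin : ∀ w, |w| ≤ 1 / 4 → f w = w := by
    intro w hw
    rw [abs_le] at hw
    simp only [f]
    rw [Real.arcsin_sin (by nlinarith) (by nlinarith)]
    field_simp
  refine ⟨fun w => max (-(2 * δ)) (min (2 * δ) (f w)), ?_, ?_, ?_, ?_⟩
  · have : Continuous f := by
      have := Real.continuous_arcsin
      simp only [f]
      fun_prop
    fun_prop
  · intro w
    rw [abs_le]
    exact ⟨le_max_left _ _, max_le (by linarith) (min_le_left _ _)⟩
  · intro w j
    simp only [hper]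
  · intro w j hw
    have h1 : f w = w - j := by
      rw [← hlin (w - j) (by linarith), ← hper (w - j) j]
      congr 1
      ring
    simp only [h1]
    rw [abs_le] at hw
    rw [min_eq_right hw.2, max_eq_right hw.1]

/-- inductive data for the immersion of the punctured torus -/
def Imm (T Y : Type*) [TopologicalSpace T] [TopologicalSpace Y] (R : T → T → Prop) (N : Set T) :
    Prop :=
  ∃ l > 0, ∃ F : T × ℝ → (ℝ × Y) × ℝ, LH F {p | |p.2| < l} ∧
    (∀ x x' θ, R x x' → F (x', θ) = F (x, θ)) ∧
    ∀ x ∈ N, ∀ θ, |θ| < l → F (x, θ) = ((F (x, 0)).1, (F (x, 0)).2 + θ)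

lemma Imm.transport {T Y T' Y' : Type*} [TopologicalSpace T] [TopologicalSpace Y]
    [TopologicalSpace T'] [TopologicalSpace Y'] {R : T → T → Prop} {N : Set T}
    {R' : T' → T' → Prop} {N' : Set T'} (h : Imm T Y R N) (e : T' ≃ₜ T) (f : Y ≃ₜ Y')
    (hR : ∀ x x', R' x x' → R (e x) (e x')) (hN : ∀ x ∈ N', e x ∈ N) : Imm T' Y' R' N' := by
  obtain ⟨l, hl, F, h1, h2, h3⟩ := h
  let e2 : T' × ℝ ≃ₜ T × ℝ := e.prodCongr (Homeomorph.refl ℝ)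
  let f2 : (ℝ × Y) × ℝ ≃ₜ (ℝ × Y') × ℝ :=
    ((Homeomorph.refl ℝ).prodCongr f).prodCongr (Homeomorph.refl ℝ)
  have hcomp : LH (f2 ∘ F ∘ e2) {p | |p.2| < l} := by
    refine (LH.of_homeo f2 isOpen_univ).comp (h1.comp (LH.of_homeo e2 ?_) ?_) (mapsTo_univ _ _)
    · exact isOpen_lt (by fun_prop) (by fun_prop)
    · intro p hp; exact hp
  refine ⟨l, hl, f2 ∘ F ∘ e2, hcomp, ?_, ?_⟩
  · intro x x' θ hx
    show f2 (F (e x', θ)) = f2 (F (e x, θ))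
    rw [h2 _ _ _ (hR _ _ hx)]
  · intro x hx θ hθ
    show f2 (F (e x, θ)) = ((f2 (F (e x, 0))).1, (f2 (F (e x, 0))).2 + θ)
    rw [h3 _ (hN x hx) θ hθ]
    rfl

lemma Imm.step {T Y : Type*} [TopologicalSpace T] [TopologicalSpace Y] {R : T → T → Prop}
    {N : Set T} (h : Imm T Y R N) :
    ∃ δ > 0, Imm (T × ℝ) (ℝ × Y) (fun p q => R p.1 q.1 ∧ ∃ j : ℤ, q.2 = p.2 + j)
      {p | p.1 ∈ N ∨ ∃ j : ℤ, |p.2 - j| < δ} := by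
  obtain ⟨l, hl, F, h1, h2, h3⟩ := h
  set δ := min (l / 3) (1 / 8) with hδ
  have hδ0 : 0 < δ := lt_min (by linarith) (by norm_num)
  have hδl : δ ≤ l / 3 := min_le_left _ _
  obtain ⟨γ, hγc, hγb, hγp, hγl⟩ := exists_saw hδ0 (min_le_right _ _)
  refine ⟨δ, hδ0, δ, hδ0, ?_⟩
  -- first homeomorphism
  let Φ1 : (T × ℝ) × ℝ ≃ₜ (T × ℝ) × ℝ :=
    { toFun := fun p => ((p.1.1, γ (p.1.2 - p.2) + p.2), p.1.2 - p.2)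
      invFun := fun p => ((p.1.1, p.2 + (p.1.2 - γ p.2)), p.1.2 - γ p.2)
      left_inv := fun p => by ext <;> simp
      right_inv := fun p => by ext <;> simp
      continuous_toFun := by fun_prop
      continuous_invFun := by fun_prop }
  let Φ2 : ((ℝ × Y) × ℝ) × ℝ ≃ₜ ((ℝ × Y) × ℝ) × ℝ :=
    { toFun := fun p => ((p.1.1, p.1.2 + p.2 - γ p.2), p.1.2 - γ p.2)
      invFun := fun p => ((p.1.1, p.2 + γ (p.1.2 - p.2)), p.1.2 - p.2)
      left_inv := fun p => by
        have e : p.1.2 + p.2 - γ p.2 - (p.1.2 - γ p.2) = p.2 := by ring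
        ext <;> simp [e]
      right_inv := fun p => by
        ext <;> simp
        ring
      continuous_toFun := by fun_prop
      continuous_invFun := by fun_prop }
  let A1 : (ℝ × Y) × ℝ ≃ₜ (ℝ × ℝ) × Y :=
    { toFun := fun p => ((p.1.1, p.2), p.1.2)
      invFun := fun p => ((p.1.1, p.2), p.1.2)
      left_inv := fun p => rfl
      right_inv := fun p => rfl
      continuous_toFun := by fun_prop
      continuous_invFun := by fun_prop }
  let P : (ℝ × Y) × ℝ → ℝ × (ℝ × Y) :=
    Homeomorph.prodAssoc ℝ ℝ Y ∘ Prod.map polar (id : Y → Y) ∘ A1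
  have hP : LH P univ := by
    refine (LH.of_homeo _ isOpen_univ).comp
      ((polar_LH.prodMap (LH.id isOpen_univ)).comp (LH.of_homeo A1 isOpen_univ) ?_)
      (mapsTo_univ _ _)
    intro p _
    simp
  have hPper : ∀ y u, ∀ j : ℤ, P (y, u + j) = P (y, u) := by
    intro y u j
    simp only [P, Function.comp_apply, A1, Homeomorph.homeomorph_mk_coe, Equiv.coe_fn_mk,
      Prod.map_apply, polar_periodic]
  let F' : (T × ℝ) × ℝ → (ℝ × (ℝ × Y)) × ℝ :=
    Prod.map P (id : ℝ → ℝ) ∘ Φ2 ∘ Prod.map F (id : ℝ → ℝ) ∘ Φ1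
  have hF' : ∀ x θ s, F' ((x, θ), s) = (P ((F (x, γ (θ - s) + s)).1,
      (F (x, γ (θ - s) + s)).2 + (θ - s) - γ (θ - s)), (F (x, γ (θ - s) + s)).2 - γ (θ - s)) :=
    fun x θ s => rfl
  refine ⟨F', ?_, ?_, ?_⟩
  · refine (hP.prodMap (LH.id isOpen_univ)).comp ((LH.of_homeo Φ2 isOpen_univ).comp
      ((h1.prodMap (LH.id isOpen_univ)).comp (LH.of_homeo Φ1 ?_) ?_) (mapsTo_univ _ _)) ?_
    · exact isOpen_lt (by fun_prop) (by fun_prop)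
    · rintro ⟨⟨x, θ⟩, s⟩ hs
      refine ⟨?_, mem_univ _⟩
      show |γ (θ - s) + s| < l
      have hs' : |s| < δ := hs
      have := hγb (θ - s)
      have := abs_add_le (γ (θ - s)) s
      linarith
    · intro p _
      simp
  · rintro ⟨x, θ⟩ ⟨x', θ'⟩ s ⟨hx, j, hj⟩
    simp only at hx hj
    subst hj
    have e : θ + j - s = θ - s + j := by ring
    rw [hF', hF', e, hγp, h2 _ _ _ hx]
    have e2 : (F (x, γ (θ - s) + s)).2 + (θ - s + j) - γ (θ - s) =
      (F (x, γ (θ - s) + s)).2 + (θ - s) - γ (θ - s) + j := by ring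
    rw [e2, hPper]
  · rintro ⟨x, θ⟩ (hx | ⟨j, hj⟩) s hs
    · simp only at hx
      have ha : ∀ s, |s| < δ → |γ (θ - s) + s| < l := by
        intro s hs
        have := hγb (θ - s)
        have := abs_add_le (γ (θ - s)) s
        linarith
      rw [hF', hF', h3 x hx _ (ha s hs), h3 x hx _ (ha 0 (by simpa using hδ0))]
      simp only [sub_zero, add_zero]
      ext1
      · simp only
        congr 2
        ring
      · simp only
        ring
    · simp only at hj
      have hg : γ (θ - s) = θ - s - j := by
        apply hγl
        have := abs_sub (θ - j) s
        have e : θ - s - j = θ - j - s := by ring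
        rw [e]
        linarith
      have hg0 : γ (θ - 0) = θ - 0 - j := by
        apply hγl
        rw [sub_zero]
        linarith
      have e1 : θ - s - j + s = θ - j := by ring
      have e2 : θ - 0 - j + 0 = θ - j := by ring
      rw [hF', hF', hg, hg0, e1, e2]
      ext1
      · simp only
        congr 2
        ring
      · simp only
        ring

end EK
end

section
open Topology Set Metric

namespace EK

noncomputable def clampR (a b x : ℝ) : ℝ := max a (min b x)

lemma clampR_cont (a b : ℝ) : Continuous (clampR a b) := by
  unfold clampR; fun_prop

lemma clampR_of_mem {a b x : ℝ} (h1 : a ≤ x) (h2 : x ≤ b) : clampR a b x = x := by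
  unfold clampR; rw [min_eq_right h2, max_eq_right h1]

lemma clampR_of_le {a b x : ℝ} (hab : a ≤ b) (h1 : x ≤ a) : clampR a b x = a := by
  unfold clampR; rw [min_eq_right (h1.trans hab), max_eq_left h1]

lemma clampR_of_ge {a b x : ℝ} (hab : a ≤ b) (h1 : b ≤ x) : clampR a b x = b := by
  unfold clampR; rw [min_eq_left h1, max_eq_right hab]

noncomputable def LF (a : ℝ) : ℝ :=
  Real.log (clampR (1 / 2) 2 a) + a - clampR (1 / 2) 2 a

noncomputable def LFinv (q : ℝ) : ℝ :=
  Real.exp (clampR (-Real.log 2) (Real.log 2) q) + q - clampR (-Real.log 2) (Real.log 2) q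

lemma clamp_pos (a : ℝ) : 0 < clampR (1 / 2) 2 a := by
  unfold clampR
  exact lt_max_of_lt_left (by norm_num)

lemma log_half : Real.log (1 / 2) = -Real.log 2 := by
  rw [one_div, Real.log_inv]

lemma LF_left (a : ℝ) : LFinv (LF a) = a := by
  have hl : 0 < Real.log 2 := Real.log_pos (by norm_num)
  unfold LFinv LF
  rcases le_total a (1 / 2) with h | h
  · rw [clampR_of_le (by norm_num) h, log_half, clampR_of_le (by linarith) (by linarith),
      Real.exp_neg, Real.exp_log (by norm_num)]
    ring
  · rcases le_total a 2 with h2 | h2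
    · have e1 : Real.log (1 / 2) ≤ Real.log a := Real.log_le_log (by norm_num) h
      have e2 : Real.log a ≤ Real.log 2 := Real.log_le_log (by linarith) h2
      rw [log_half] at e1
      rw [clampR_of_mem h h2, clampR_of_mem (by linarith) (by linarith)]
      simp only [add_sub_cancel_right]
      rw [Real.exp_log (by linarith)]
    · rw [clampR_of_ge (by norm_num) h2, clampR_of_ge (by linarith) (by linarith),
        Real.exp_log (by norm_num)]
      ring

lemma LF_right (a : ℝ) : LF (LFinv a) = a := by
  have hl : 0 < Real.log 2 := Real.log_pos (by norm_num)
  unfold LFinv LF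
  rcases le_total a (-Real.log 2) with h | h
  · rw [clampR_of_le (by linarith) h, Real.exp_neg, Real.exp_log (by norm_num),
      clampR_of_le (by norm_num) (by linarith), log_half]
    ring
  · rcases le_total a (Real.log 2) with h2 | h2
    · have e1 : Real.exp (-Real.log 2) ≤ Real.exp a := Real.exp_le_exp.2 h
      have e2 : Real.exp a ≤ Real.exp (Real.log 2) := Real.exp_le_exp.2 h2
      rw [Real.exp_neg] at e1
      rw [Real.exp_log (by norm_num)] at e1 e2
      rw [clampR_of_mem h h2, add_sub_cancel_right,
        clampR_of_mem (by linarith) (by linarith), Real.log_exp]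
      ring
    · rw [clampR_of_ge (by linarith) h2, Real.exp_log (by norm_num),
        clampR_of_ge (by norm_num) (by linarith)]
      ring

lemma LF_cont : Continuous LF := by
  have h := clampR_cont (1 / 2) 2
  unfold LF
  exact ((h.log fun x => (clamp_pos x).ne').add continuous_id).sub h

lemma LFinv_cont : Continuous LFinv := by
  have h := clampR_cont (-Real.log 2) (Real.log 2)
  unfold LFinv
  fun_prop

lemma Imm.base : ∃ η > 0, Imm ℝ Unit (fun x x' => ∃ j : ℤ, x' = x + j)
    {x | ∃ j : ℤ, |x - j| < η} := by
  have hc := clampR_cont (1 / 2) 2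
  have hL := LF_cont
  have hLi := LFinv_cont
  let H : ℝ × ℝ ≃ₜ (ℝ × Unit) × ℝ :=
    { toFun := fun p => ((p.2 / clampR (1 / 2) 2 p.1, ()), LF p.1)
      invFun := fun p => (LFinv p.2, p.1.1 * clampR (1 / 2) 2 (LFinv p.2))
      left_inv := fun p => by
        have := (clamp_pos p.1).ne'
        ext <;> simp only [LF_left]
        field_simp
      right_inv := fun p => by
        have := (clamp_pos (LFinv p.2)).ne'
        ext
        · simp only
          field_simp
        · simp only [LF_right]
      continuous_toFun := by
        refine Continuous.prodMk (Continuous.prodMk ?_ continuous_const) (by fun_prop)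
        exact Continuous.div (by fun_prop) (by fun_prop) fun p => (clamp_pos p.1).ne'
      continuous_invFun := by fun_prop }
  let sw : ℝ × ℝ ≃ₜ ℝ × ℝ := Homeomorph.prodComm ℝ ℝ
  refine ⟨1 / 16, by norm_num, 1 / 4, by norm_num, H ∘ polar ∘ sw, ?_, ?_, ?_⟩
  · refine (LH.of_homeo H isOpen_univ).comp (polar_LH.comp (LH.of_homeo sw ?_)
      (mapsTo_univ _ _)) (mapsTo_univ _ _)
    exact isOpen_lt (by fun_prop) (by fun_prop)
  · rintro x x' θ ⟨j, rfl⟩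
    show H (polar (θ, x + j)) = H (polar (θ, x))
    rw [polar_periodic]
  · rintro x ⟨j, hj⟩ θ hθ
    have hpi := Real.pi_pos
    have hcos : 0.9 ≤ Real.cos (2 * Real.pi * x) := by
      have e : 2 * Real.pi * x = 2 * Real.pi * (x - j) + j * (2 * Real.pi) := by ring
      rw [e, Real.cos_add_int_mul_two_pi]
      refine le_trans ?_ (Real.one_sub_sq_div_two_le_cos)
      have h4 : |2 * Real.pi * (x - j)| ≤ 0.4 := by
        rw [abs_mul, abs_of_pos (by positivity)]
        have := Real.pi_lt_d2
        nlinarith [abs_nonneg (x - j)]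
      have := sq_le_sq' (by linarith [neg_abs_le (2 * Real.pi * (x - j))]) ((le_abs_self _).trans h4)
      linarith
    have hcos1 := Real.cos_le_one (2 * Real.pi * x)
    have key : ∀ θ : ℝ, |θ| < 1 / 4 → H (polar (θ, x)) =
        ((Real.sin (2 * Real.pi * x) / Real.cos (2 * Real.pi * x), ()),
          θ + Real.log (Real.cos (2 * Real.pi * x))) := by
      intro θ hθ
      rw [abs_lt] at hθ
      have h1 : 3 / 4 ≤ Real.exp θ := by linarith [Real.add_one_le_exp θ]
      have h2 : Real.exp θ ≤ 2 := by
        rw [← Real.exp_log (show (0 : ℝ) < 2 by norm_num)]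
        apply Real.exp_le_exp.2
        linarith [Real.log_two_gt_d9]
      have h3 : clampR (1 / 2) 2 (Real.exp θ * Real.cos (2 * Real.pi * x)) =
          Real.exp θ * Real.cos (2 * Real.pi * x) :=
        clampR_of_mem (by nlinarith) (by nlinarith)
      have hne : Real.exp θ ≠ 0 := (Real.exp_pos θ).ne'
      have hne2 : Real.cos (2 * Real.pi * x) ≠ 0 := by linarith
      show ((_ / clampR (1 / 2) 2 (polar (θ, x)).1, ()), LF (polar (θ, x)).1) = _
      simp only [polar, LF, h3]
      rw [Real.log_mul hne hne2, Real.log_exp, mul_div_mul_left _ _ hne, add_sub_cancel_right]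
    show H (polar (θ, x)) = ((H (polar (0, x))).1, (H (polar (0, x))).2 + θ)
    rw [key θ hθ, key 0 (by norm_num)]
    ext1
    · rfl
    · simp only; ring

end EK
end

section
open Topology Set Metric

namespace EK

/-- neighbourhood of the codimension one skeleton of the torus, lifted -/
def NN (κ : Type*) (η : ℝ) : Set (κ → ℝ) := {y | ∃ i, ∃ z : ℤ, |y i - z| < η}

lemma NN_mono {κ : Type*} {a b : ℝ} (h : a ≤ b) : NN κ a ⊆ NN κ b :=
  fun _ ⟨i, z, hz⟩ => ⟨i, z, hz.trans_le h⟩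

lemma NN_open (κ : Type*) (η : ℝ) : IsOpen (NN κ η) := by
  have : NN κ η = ⋃ i, ⋃ z : ℤ, {y : κ → ℝ | |y i - z| < η} := by
    ext y; simp [NN]
  rw [this]
  refine isOpen_iUnion fun i => isOpen_iUnion fun z => isOpen_lt (by fun_prop) (by fun_prop)

def tailHomeo (n : ℕ) : (Fin (n + 1) → ℝ) ≃ₜ (Fin n → ℝ) × ℝ where
  toFun p := (fun i => p i.succ, p 0)
  invFun q := Fin.cons q.2 q.1
  left_inv p := by
    refine funext fun i => ?_
    refine Fin.cases ?_ (fun j => ?_) i <;> simp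
  right_inv q := by ext <;> simp
  continuous_toFun := by fun_prop
  continuous_invFun := Continuous.finCons (by fun_prop) (by fun_prop)

lemma Imm.all (n : ℕ) : ∃ η > 0, Imm (Fin (n + 1) → ℝ) (Fin n → ℝ)
    (fun x x' => ∃ z : Fin (n + 1) → ℤ, ∀ i, x' i = x i + z i) (NN (Fin (n + 1)) η) := by
  induction n with
  | zero =>
    obtain ⟨η, hη, h⟩ := Imm.base
    refine ⟨η, hη, h.transport (Homeomorph.funUnique (Fin 1) ℝ)
      ⟨⟨fun _ => default, fun _ => (), fun _ => rfl, fun _ => Subsingleton.elim _ _⟩,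
        continuous_const, continuous_const⟩ ?_ ?_⟩
    · rintro x x' ⟨z, hz⟩
      exact ⟨z 0, hz 0⟩
    · rintro x ⟨i, z, hz⟩
      refine ⟨z, ?_⟩
      have : i = 0 := Fin.fin_one_eq_zero i
      subst this
      exact hz
  | succ n ih =>
    obtain ⟨η, hη, h⟩ := ih
    obtain ⟨δ, hδ, h'⟩ := h.step
    refine ⟨min η δ, lt_min hη hδ, h'.transport (tailHomeo (n + 1))
      ((Homeomorph.prodComm _ _).trans (tailHomeo n).symm) ?_ ?_⟩
    · rintro x x' ⟨z, hz⟩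
      exact ⟨⟨fun i => z i.succ, fun i => hz _⟩, z 0, hz 0⟩
    · rintro x ⟨i, z, hz⟩
      rcases Fin.eq_zero_or_eq_succ i with rfl | ⟨j, rfl⟩
      · exact Or.inr ⟨z, hz.trans_le (min_le_right _ _)⟩
      · exact Or.inl ⟨j, z, hz.trans_le (min_le_left _ _)⟩

lemma Imm.proj {T Y : Type*} [TopologicalSpace T] [TopologicalSpace Y] {R : T → T → Prop}
    {N : Set T} (hN : IsOpen N) (h : Imm T Y R N) :
    ∃ α : T → ℝ × Y, LH α N ∧ ∀ x x', R x x' → α x' = α x := by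
  obtain ⟨l, hl, F, h1, h2, h3⟩ := h
  refine ⟨fun x => (F (x, 0)).1, ?_, fun x x' hx => by simp only [h2 x x' 0 hx]⟩
  intro x hx
  have hx0 : (x, (0 : ℝ)) ∈ {p : T × ℝ | |p.2| < l} := by simpa using hl
  obtain ⟨O, hO, hxO, hOl, hOE⟩ := h1 _ hx0
  obtain ⟨A, B, hA, hB, hxA, h0B, hAB⟩ := isOpen_prod_iff.1 hO x 0 hxO
  obtain ⟨τ, hτ, hτB⟩ := Metric.isOpen_iff.1 hB 0 h0B
  have hcF : ContinuousOn (fun y => F (y, 0)) A := by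
    refine hOE.cont.comp (by fun_prop) ?_
    intro y hy
    exact hAB ⟨hy, h0B⟩
  have hcont : ContinuousOn (fun y => (F (y, 0)).2) A := continuous_snd.comp_continuousOn hcF
  have hU : IsOpen (A ∩ (fun y => (F (y, 0)).2) ⁻¹' ball (F (x, 0)).2 (τ / 2)) :=
    hcont.isOpen_inter_preimage hA isOpen_ball
  set U := A ∩ (fun y => (F (y, 0)).2) ⁻¹' ball (F (x, 0)).2 (τ / 2) with hUdef
  refine ⟨U ∩ N, hU.inter hN, ⟨⟨hxA, by simpa using hτ⟩, hx⟩, inter_subset_right, ?_, ?_, ?_⟩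
  · exact (continuous_fst.comp_continuousOn hcF).mono fun y hy => hy.1.1
  · rintro y ⟨⟨hyA, hyU⟩, hyN⟩ y' ⟨⟨hyA', hyU'⟩, hyN'⟩ hyy
    simp only at hyy
    set θ := (F (y', 0)).2 - (F (y, 0)).2 with hθ
    have hθ1 : |θ| < τ := by
      have := dist_triangle_right (F (y', 0)).2 (F (y, 0)).2 (F (x, 0)).2
      rw [mem_preimage, mem_ball] at hyU hyU'
      rw [hθ, ← Real.dist_eq]
      linarith
    have hm : (y, θ) ∈ O := hAB ⟨hyA, hτB (by simpa using hθ1)⟩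
    have hθl : |θ| < l := hOl hm
    have he := h3 y hyN θ hθl
    have : F (y, θ) = F (y', 0) := by
      rw [he]
      ext1
      · exact hyy
      · simp [hθ]
    have := hOE.inj hm (hAB ⟨hyA', h0B⟩) this
    exact (Prod.mk.inj this).1
  · intro W hW hWo
    have hop : IsOpen (Prod.fst '' (F '' (W ×ˢ ball (0 : ℝ) τ))) := by
      apply isOpenMap_fst
      apply hOE.opn
      · rintro ⟨a, b⟩ ⟨ha, hb⟩
        exact hAB ⟨(hW ha).1.1, hτB hb⟩
      · exact hWo.prod isOpen_ball
    convert hop using 1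
    ext q
    constructor
    · rintro ⟨w, hw, rfl⟩
      exact ⟨_, ⟨(w, 0), ⟨hw, by simpa using hτ⟩, rfl⟩, rfl⟩
    · rintro ⟨_, ⟨⟨w, θ⟩, ⟨hw, hθ⟩, rfl⟩, rfl⟩
      refine ⟨w, hw, ?_⟩
      have hθl : |θ| < l := hOl (show (w, θ) ∈ O from hAB ⟨(hW hw).1.1, hτB hθ⟩)
      rw [h3 w (hW hw).2 θ hθl]

/-- periodic immersion of a neighbourhood of the skeleton of the cubical lattice -/
theorem immersion (κ : Type*) [Fintype κ] [Nonempty κ] : ∃ η > 0, η ≤ 1 / 4 ∧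
    ∃ α : (κ → ℝ) → (κ → ℝ), LH α (NN κ η) ∧ α 0 = 0 ∧
      ∀ (y : κ → ℝ) (z : κ → ℤ), α (fun i => y i + z i) = α y := by
  obtain ⟨n, hn⟩ : ∃ n, Fintype.card κ = n + 1 :=
    Nat.exists_eq_succ_of_ne_zero Fintype.card_ne_zero
  obtain ⟨η, hη, h⟩ := Imm.all n
  obtain ⟨α, h1, h2⟩ := h.proj (NN_open _ _)
  let s : Fin (n + 1) ≃ κ := (Fintype.equivFinOfCardEq hn).symm
  let S : (κ → ℝ) ≃ₜ (Fin (n + 1) → ℝ) :=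
    { toFun := fun y i => y (s i)
      invFun := fun y i => y (s.symm i)
      left_inv := fun y => by simp
      right_inv := fun y => by simp
      continuous_toFun := by fun_prop
      continuous_invFun := by fun_prop }
  let Q : ℝ × (Fin n → ℝ) ≃ₜ (κ → ℝ) :=
    (Homeomorph.prodComm _ _).trans ((tailHomeo n).symm.trans S.symm)
  let Q2 := Q.trans (Homeomorph.addRight (-(Q (α (S 0)))))
  refine ⟨min η (1 / 4), lt_min hη (by norm_num), min_le_right _ _, Q2 ∘ α ∘ S, ?_, ?_, ?_⟩
  · refine (LH.of_homeo Q2 isOpen_univ).comp (h1.comp (LH.of_homeo S (NN_open _ _)) ?_)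
      (mapsTo_univ _ _)
    rintro y ⟨i, z, hz⟩
    refine ⟨s.symm i, z, ?_⟩
    show |y (s (s.symm i)) - z| < η
    rw [Equiv.apply_symm_apply]
    exact hz.trans_le (min_le_left _ _)
  · show Q (α (S 0)) + -(Q (α (S 0))) = 0
    exact add_neg_cancel _
  · intro y z
    show Q2 (α _) = Q2 (α _)
    congr 1
    exact h2 _ _ ⟨fun i => z (s i), fun i => rfl⟩

end EK
end

section
open Topology Set Metric

namespace EK

section unif
variable {κ : Type*} [Fintype κ]

lemma NN_fract {η : ℝ} {y : κ → ℝ} (hy : y ∈ NN κ η) :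
    (fun i => Int.fract (y i)) ∈ NN κ η := by
  obtain ⟨i, z, hz⟩ := hy
  refine ⟨i, z - ⌊y i⌋, ?_⟩
  have e : Int.fract (y i) - ((z - ⌊y i⌋ : ℤ) : ℝ) = y i - z := by
    rw [Int.fract]; push_cast; ring
  rw [e]; exact hz

/-- compact fundamental domain -/
def KK (κ : Type*) (η : ℝ) : Set (κ → ℝ) :=
  {y | (∀ i, y i ∈ Icc (0 : ℝ) 1) ∧ ∃ i, ∃ z ∈ Finset.Icc (-1 : ℤ) 2, |y i - z| ≤ η}

lemma KK_compact (η : ℝ) : IsCompact (KK κ η) := by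
  have h1 : IsCompact (Set.pi univ fun _ : κ => Icc (0 : ℝ) 1) := isCompact_univ_pi fun _ => isCompact_Icc
  have h2 : IsClosed (⋃ i : κ, ⋃ z ∈ Finset.Icc (-1 : ℤ) 2, {y : κ → ℝ | |y i - z| ≤ η}) := by
    refine isClosed_iUnion_of_finite fun i => ?_
    refine (Finset.finite_toSet _).isClosed_biUnion fun z _ => ?_
    exact isClosed_le (by fun_prop) (by fun_prop)
  convert h1.inter_right h2 using 1
  ext y
  simp only [KK, mem_ofPred_eq, mem_inter_iff, mem_univ_pi, mem_iUnion, exists_prop]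

lemma fract_KK {η : ℝ} (hη : η ≤ 1) {y : κ → ℝ} (hy : y ∈ NN κ η) :
    (fun i => Int.fract (y i)) ∈ KK κ η := by
  refine ⟨fun i => ⟨Int.fract_nonneg _, (Int.fract_lt_one _).le⟩, ?_⟩
  obtain ⟨i, z, hz⟩ := NN_fract hy
  refine ⟨i, z, ?_, hz.le⟩
  have h0 := Int.fract_nonneg (y i)
  have h1 := Int.fract_lt_one (y i)
  simp only at hz
  rw [abs_lt] at hz
  rw [Finset.mem_Icc]
  have h2 : (-2 : ℝ) < z := by linarith
  have h3 : (z : ℝ) < 3 := by linarith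
  have h2' : (-2 : ℤ) < z := by exact_mod_cast h2
  have h3' : z < (3 : ℤ) := by exact_mod_cast h3
  constructor <;> omega

lemma KK_sub {a b : ℝ} (h : a < b) : KK κ a ⊆ NN κ b :=
  fun _ hy => by
    obtain ⟨i, z, -, hz⟩ := hy.2
    exact ⟨i, z, hz.trans_lt h⟩

/-- translation by an integer vector taking the fractional part of `y` to `y` -/
def trH (z : κ → ℤ) : (κ → ℝ) ≃ₜ (κ → ℝ) := Homeomorph.addRight (fun i => (z i : ℝ))

lemma trH_apply (z : κ → ℤ) (y : κ → ℝ) : trH z y = fun i => y i + z i := rfl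

lemma trH_dist (z : κ → ℤ) (y y' : κ → ℝ) : dist (trH z y) (trH z y') = dist y y' :=
  dist_add_right y y' _

lemma trH_fract (y : κ → ℝ) : trH (fun i => ⌊y i⌋) (fun i => Int.fract (y i)) = y := by
  rw [trH_apply]; funext i; simp

lemma trH_ball (z : κ → ℤ) (y : κ → ℝ) (r : ℝ) : trH z '' ball y r = ball (trH z y) r := by
  ext w
  constructor
  · rintro ⟨v, hv, rfl⟩
    rw [mem_ball, trH_dist]; exact hv
  · intro hw
    refine ⟨(trH z).symm w, ?_, by simp⟩
    rw [mem_ball, ← trH_dist z]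
    simpa using hw

variable {η η2 : ℝ} {α : (κ → ℝ) → (κ → ℝ)}

lemma unif_inj (hη : η2 < η) (hη1 : η2 ≤ 1) (hα : LH α (NN κ η))
    (hper : ∀ (y : κ → ℝ) (z : κ → ℤ), α (fun i => y i + z i) = α y) :
    ∃ l > 0, ∀ y ∈ NN κ η2, OE α (ball y l) := by
  have hK := KK_compact (κ := κ) η2
  choose W hWo hxW hWs hWE using hα
  obtain ⟨l, hl, hL⟩ := lebesgue_number_lemma_of_metric hK
    (c := fun x : KK κ η2 => W x (KK_sub hη x.2)) (fun x => hWo _ _)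
    (fun x hx => mem_iUnion.2 ⟨⟨x, hx⟩, hxW _ _⟩)
  refine ⟨l, hl, fun y hy => ?_⟩
  obtain ⟨i, hi⟩ := hL _ (fract_KK hη1 hy)
  have h0 := (hWE i (KK_sub hη i.2)).mono hi
  have hz := trH_fract y
  set z : κ → ℤ := fun i => ⌊y i⌋ with hzdef
  have h1 : OE (α ∘ (trH z).symm) (ball y l) := by
    refine h0.comp (OE.of_homeo (trH z).symm _) ?_
    intro w hw
    rw [← hz, ← trH_ball] at hw
    obtain ⟨v, hv, rfl⟩ := hw
    simpa using hv
  refine h1.congr fun w _ => ?_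
  have := hper ((trH z).symm w) z
  rw [← trH_apply, Homeomorph.apply_symm_apply] at this
  exact this

lemma unif_open (hη : η2 < η) (hη1 : η2 ≤ 1) (hα : LH α (NN κ η))
    (hper : ∀ (y : κ → ℝ) (z : κ → ℤ), α (fun i => y i + z i) = α y) {μ : ℝ} (hμ : 0 < μ) :
    ∃ μ' > 0, ∀ y ∈ NN κ η2, ball (α y) μ' ⊆ α '' ball y μ := by
  have hK := KK_compact (κ := κ) η2
  have key : ∃ μ' > 0, ∀ y ∈ KK κ η2, ball (α y) μ' ⊆ α '' ball y μ := by
    refine hK.induction_on (p := fun S => ∃ μ' > 0, ∀ y ∈ S, ball (α y) μ' ⊆ α '' ball y μ)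
      ⟨1, one_pos, by simp⟩ ?_ ?_ ?_
    · rintro s t hst ⟨m, hm, h⟩
      exact ⟨m, hm, fun y hy => h y (hst hy)⟩
    · rintro s t ⟨m, hm, h⟩ ⟨m', hm', h'⟩
      refine ⟨min m m', lt_min hm hm', ?_⟩
      rintro y (hy | hy)
      · exact (ball_subset_ball (min_le_left _ _)).trans (h y hy)
      · exact (ball_subset_ball (min_le_right _ _)).trans (h' y hy)
    · intro x hx
      obtain ⟨W, hW, hxW, hWN, hE⟩ := hα x (KK_sub hη hx)
      have ho : IsOpen (α '' (ball x (μ / 2) ∩ W)) :=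
        hE.opn _ inter_subset_right (isOpen_ball.inter hW)
      obtain ⟨t, ht, htb⟩ := Metric.isOpen_iff.1 ho (α x)
        ⟨x, ⟨mem_ball_self (by linarith), hxW⟩, rfl⟩
      have hc := hα.contAt (KK_sub hη hx)
      refine ⟨ball x (μ / 2) ∩ α ⁻¹' ball (α x) (t / 2), mem_nhdsWithin_of_mem_nhds
        (Filter.inter_mem (ball_mem_nhds _ (by linarith))
          (hc (ball_mem_nhds _ (by linarith)))), t / 2, by linarith, ?_⟩
      rintro y ⟨hy, hy'⟩ q hq
      rw [mem_preimage, mem_ball] at hy'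
      rw [mem_ball] at hy hq
      obtain ⟨w, ⟨hw, -⟩, rfl⟩ := htb (show q ∈ ball (α x) t by
        rw [mem_ball]; linarith [dist_triangle q (α y) (α x)])
      refine ⟨w, ?_, rfl⟩
      rw [mem_ball] at hw ⊢
      linarith [dist_triangle_right w y x]
  obtain ⟨m, hm, h⟩ := key
  refine ⟨m, hm, fun y hy q hq => ?_⟩
  have hz := trH_fract y
  set z : κ → ℤ := fun i => ⌊y i⌋ with hzdef
  have e : α y = α (fun i => Int.fract (y i)) := by
    conv_lhs => rw [← hz]
    exact hper _ _
  rw [e] at hq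
  obtain ⟨w, hw, rfl⟩ := h _ (fract_KK hη1 hy) hq
  refine ⟨trH z w, ?_, hper _ _⟩
  rw [mem_ball, ← hz, trH_dist]
  exact hw

lemma unif_bdd (hη : η2 < η) (hη1 : η2 ≤ 1) (hα : LH α (NN κ η))
    (hper : ∀ (y : κ → ℝ) (z : κ → ℤ), α (fun i => y i + z i) = α y) :
    ∃ r > 0, ∀ y ∈ NN κ η2, ‖α y‖ < r := by
  have hK := KK_compact (κ := κ) η2
  obtain ⟨C, hC⟩ := hK.exists_bound_of_continuousOn (hα.contOn.mono (KK_sub hη))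
  refine ⟨|C| + 1, by positivity, fun y hy => ?_⟩
  have e : α y = α (fun i => Int.fract (y i)) := by
    conv_lhs => rw [← trH_fract y]
    exact hper _ _
  rw [e]
  linarith [hC _ (fract_KK hη1 hy), le_abs_self C]

end unif

lemma OE.lift {A B C : Type*} [TopologicalSpace A] [TopologicalSpace B] [TopologicalSpace C]
    [Nonempty B] {β : B → C} {U : Set B} (hβ : OE β U) (hU : IsOpen U) {k : A → C} {W : Set A}
    (hk : OE k W) {s : A → B} (hs : MapsTo s W U) (hsk : ∀ a ∈ W, β (s a) = k a) : OE s W := by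
  have hinv : ∀ b ∈ U, Function.invFunOn β U (β b) = b := fun b hb =>
    hβ.inj.leftInvOn_invFunOn hb
  refine ⟨?_, ?_, ?_⟩
  · have := (hβ.continuousOn_inv hU).comp hk.cont (fun a ha => by
      rw [← hsk a ha]; exact ⟨_, hs ha, rfl⟩)
    refine this.congr fun a ha => ?_
    simp only [Function.comp_apply]
    rw [← hsk a ha, hinv _ (hs ha)]
  · intro a ha a' ha' h
    apply hk.inj ha ha'
    rw [← hsk a ha, ← hsk a' ha', h]
  · intro O hO hOo
    have : s '' O = U ∩ β ⁻¹' (k '' O) := by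
      ext b
      constructor
      · rintro ⟨a, ha, rfl⟩
        exact ⟨hs (hO ha), a, ha, (hsk a (hO ha)).symm⟩
      · rintro ⟨hb, a, ha, hab⟩
        refine ⟨a, ha, ?_⟩
        apply hβ.inj (hs (hO ha)) hb
        rw [hsk a (hO ha), hab]
    rw [this]
    exact hβ.cont.isOpen_inter_preimage hU (hk.opn O hO hOo)

end EK
end

section
open Topology Set Metric

namespace EK

section lift
variable {ι κ : Type*} [Fintype ι] [Fintype κ]
variable {η η2 r a0 : ℝ} {α : (κ → ℝ) → (κ → ℝ)}

/-- the product immersion -/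
def bet (ι : Type*) {κ : Type*} (α : (κ → ℝ) → (κ → ℝ)) (p : (ι → ℝ) × (κ → ℝ)) :
    (ι → ℝ) × (κ → ℝ) := (p.1, α p.2)

lemma bet_OE {B : Set (κ → ℝ)} (h : OE α B) : OE (bet ι α) {p | p.2 ∈ B} := by
  have := (OE.id (univ : Set (ι → ℝ))).prodMap h
  exact this.mono fun p hp => ⟨mem_univ _, hp⟩

lemma liftg (hη : η2 < η) (hη1 : η2 ≤ 1) (hα : LH α (NN κ η))
    (hper : ∀ (y : κ → ℝ) (z : κ → ℤ), α (fun i => y i + z i) = α y)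
    (hr : ∀ y ∈ NN κ η2, ‖α y‖ < r) {μ : ℝ} (hμ : 0 < μ) :
    ∃ δ > 0, ∀ g : (ι → ℝ) × (κ → ℝ) → (ι → ℝ) × (κ → ℝ), OE g {p | ‖p.2‖ < r} →
      (∀ p, ‖p.2‖ < r → a0 < ‖p.1‖ → g p = p) → (∀ p, ‖p.2‖ < r → dist (g p) p < δ) →
      ∃ s : (ι → ℝ) × (κ → ℝ) → (ι → ℝ) × (κ → ℝ), OE s {p | p.2 ∈ NN κ η2} ∧
        (∀ p, p.2 ∈ NN κ η2 → bet ι α (s p) = g (bet ι α p)) ∧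
        (∀ p, p.2 ∈ NN κ η2 → dist (s p) p < μ) ∧
        (∀ p, p.2 ∈ NN κ η2 → a0 < ‖p.1‖ → s p = p) := by
  obtain ⟨l, hl, hinj⟩ := unif_inj hη hη1 hα hper
  set ν := min μ (l / 2) with hν
  have hν0 : 0 < ν := lt_min hμ (by linarith)
  have hνl : ν ≤ l / 2 := min_le_right _ _
  obtain ⟨m, hm, hopen⟩ := unif_open hη hη1 hα hper hν0
  refine ⟨min m ν, lt_min hm hν0, fun g hg hid hd => ?_⟩
  have ex : ∀ p : (ι → ℝ) × (κ → ℝ), ∃ q, p.2 ∈ NN κ η2 →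
      bet ι α q = g (bet ι α p) ∧ dist q p < ν := by
    intro p
    by_cases hp : p.2 ∈ NN κ η2
    · have h1 := hd (bet ι α p) (hr _ hp)
      rw [Prod.dist_eq, max_lt_iff] at h1
      obtain ⟨y, hy, hye⟩ := hopen p.2 hp (show (g (bet ι α p)).2 ∈ _ from
        mem_ball.2 (h1.2.trans_le (min_le_left _ _)))
      refine ⟨((g (bet ι α p)).1, y), fun _ => ⟨?_, ?_⟩⟩
      · ext1
        · rfl
        · exact hye
      · rw [Prod.dist_eq, max_lt_iff]
        exact ⟨h1.1.trans_le (min_le_right _ _), hy⟩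
    · exact ⟨p, fun h => absurd h hp⟩
  choose s hs using ex
  have hbE : ∀ p : (ι → ℝ) × (κ → ℝ), p.2 ∈ NN κ η2 → OE (bet ι α) {q | q.2 ∈ ball p.2 l} :=
    fun p hp => bet_OE (hinj _ hp)
  have hdist2 : ∀ p q : (ι → ℝ) × (κ → ℝ), dist p.2 q.2 ≤ dist p q := fun p q => by
    rw [Prod.dist_eq]; exact le_max_right _ _
  have hNo : IsOpen {p : (ι → ℝ) × (κ → ℝ) | p.2 ∈ NN κ η2} :=
    (NN_open κ η2).preimage continuous_snd
  have hsinj : InjOn s {p | p.2 ∈ NN κ η2} := by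
    intro p hp q hq hpq
    obtain ⟨h1, h2⟩ := hs p hp
    obtain ⟨h3, h4⟩ := hs q hq
    have h5 : bet ι α p = bet ι α q :=
      hg.inj (hr _ hp) (hr _ hq) (by rw [← h1, ← h3, hpq])
    refine (hbE p hp).inj ?_ ?_ h5
    · show p.2 ∈ ball p.2 l
      exact mem_ball_self hl
    · show q.2 ∈ ball p.2 l
      rw [mem_ball]
      have := dist_triangle_left q p (s q)
      rw [hpq] at h2
      linarith [hdist2 q p]
  refine ⟨s, ?_, fun p hp => (hs p hp).1, fun p hp => (hs p hp).2.trans_le (min_le_left _ _), ?_⟩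
  · refine OE.of_cover (fun p : {p : (ι → ℝ) × (κ → ℝ) // p.2 ∈ NN κ η2} =>
      {q | q.2 ∈ NN κ η2} ∩ ball p.1 (l / 2)) (fun p => hNo.inter isOpen_ball) ?_ ?_ hsinj
    · rintro ⟨p, hp⟩
      refine (hbE p hp).lift (isOpen_ball.preimage continuous_snd) (k := g ∘ bet ι α) ?_ ?_ ?_
      · refine hg.comp ((hbE p hp).mono ?_) ?_
        · rintro q ⟨hq, hqb⟩
          show q.2 ∈ ball p.2 l
          simp only [mem_ball] at hqb ⊢
          linarith [hdist2 q p]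
        · rintro q ⟨hq, -⟩
          exact hr _ hq
      · rintro q ⟨hq, hqb⟩
        show (s q).2 ∈ ball p.2 l
        simp only [mem_ball] at hqb ⊢
        linarith [hdist2 (s q) p, dist_triangle (s q) q p, (hs q hq).2]
      · rintro q ⟨hq, hqb⟩
        exact (hs q hq).1
    · intro p hp
      exact mem_iUnion.2 ⟨⟨p, hp⟩, hp, mem_ball_self (by linarith)⟩
  · intro p hp hpa
    obtain ⟨h1, h2⟩ := hs p hp
    rw [hid (bet ι α p) (hr _ hp) hpa] at h1
    refine (hbE p hp).inj ?_ ?_ h1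
    · show (s p).2 ∈ ball p.2 l
      rw [mem_ball]
      linarith [hdist2 (s p) p]
    · show p.2 ∈ ball p.2 l
      exact mem_ball_self hl

end lift

/-- the collar lemma with a centre -/
lemma collar_at {E : Type*} [NormedAddCommGroup E] [NormedSpace ℝ E] [FiniteDimensional ℝ E]
    {a b : ℝ} (ha : 0 < a) (hab : a < b) : ∃ c, a < c ∧ c < b ∧ ∀ ε > 0, ∃ δ > 0,
    ∀ (C : E) (g : E → E), OE g {z | a < dist z C ∧ dist z C < b} →
      (∀ z, a < dist z C → dist z C < b → dist (g z) z < δ) →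
      ∃ G, OE G (ball C b) ∧ (∀ z, c ≤ dist z C → dist z C < b → G z = g z) ∧
        ∀ z, dist z C < b → dist (G z) z < ε := by
  obtain ⟨c, h1, h2, h⟩ := collar (E := E) ha hab
  refine ⟨c, h1, h2, fun ε hε => ?_⟩
  obtain ⟨δ, hδ, h⟩ := h ε hε
  refine ⟨δ, hδ, fun C g hg hd => ?_⟩
  let τ := Homeomorph.addRight C
  let τ' := Homeomorph.addRight (-C)
  have e1 : ∀ z, τ z = z + C := fun _ => rfl
  have e2 : ∀ z, τ' z = z + -C := fun _ => rfl
  have e3 : ∀ z, dist (τ z) C = ‖z‖ := fun z => by rw [e1, dist_eq_norm]; simp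
  have e4 : ∀ z, ‖τ' z‖ = dist z C := fun z => by
    rw [e2, dist_eq_norm, sub_eq_add_neg]
  have e5 : ∀ z, τ (τ' z) = z := fun z => by rw [e1, e2]; simp
  have e6 : ∀ z w, dist (τ z) (τ w) = dist z w := fun z w => dist_add_right _ _ _
  have e7 : ∀ z w, dist (τ' z) (τ' w) = dist z w := fun z w => dist_add_right _ _ _
  have e8 : ∀ z, τ' (τ z) = z := fun z => by rw [e1, e2]; simp
  obtain ⟨G, hG1, hG2, hG3⟩ := h (τ' ∘ g ∘ τ) (by
    refine (OE.of_homeo τ' univ).comp (hg.comp (OE.of_homeo τ _) ?_) (mapsTo_univ _ _)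
    rintro z ⟨hz1, hz2⟩
    exact ⟨by rw [e3]; exact hz1, by rw [e3]; exact hz2⟩) (by
    intro z h1 h2
    have := hd (τ z) (by rw [e3]; exact h1) (by rw [e3]; exact h2)
    rw [← e7, e8] at this
    exact this)
  refine ⟨τ ∘ G ∘ τ', ?_, ?_, ?_⟩
  · refine (OE.of_homeo τ univ).comp (hG1.comp (OE.of_homeo τ' _) ?_) (mapsTo_univ _ _)
    intro z hz
    rw [mem_ball_zero_iff, e4]
    exact hz
  · intro z h1 h2
    show τ (G (τ' z)) = g z
    rw [hG2 _ (by rw [e4]; exact h1) (by rw [e4]; exact h2)]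
    simp only [Function.comp_apply, e5]
  · intro z h1
    have := hG3 (τ' z) (by rw [e4]; exact h1)
    rw [← e6, e5] at this
    exact this

end EK
end

section
open Topology Set Metric

namespace EK

section fill
variable {ι κ : Type*} [Fintype ι] [Fintype κ]

/-- centre of a cell -/
noncomputable def cen (ι : Type*) {κ : Type*} (z : κ → ℤ) : (ι → ℝ) × (κ → ℝ) :=
  (0, fun i => z i + 1 / 2)

lemma dist_cen (p : (ι → ℝ) × (κ → ℝ)) (z : κ → ℤ) :
    dist p (cen ι z) = max ‖p.1‖ (dist p.2 (fun i => (z i : ℝ) + 1 / 2)) := by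
  rw [Prod.dist_eq]; simp [cen]

lemma floor_of_cell {t : ℝ} {n : ℤ} (h : |t - (n + 1 / 2)| < 1 / 2) : ⌊t⌋ = n := by
  rw [abs_lt] at h
  rw [Int.floor_eq_iff]
  constructor <;> linarith

lemma near_int {t : ℝ} {n : ℤ} {a : ℝ} (h : |t - (n + 1 / 2)| < 1 / 2)
    (ha : 1 / 2 - a < |t - (n + 1 / 2)|) : ∃ m : ℤ, |t - m| < a := by
  rw [abs_lt] at h
  rcases lt_abs.1 ha with h1 | h1
  · refine ⟨n + 1, ?_⟩
    push_cast
    rw [abs_lt]; constructor <;> linarith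
  · refine ⟨n, ?_⟩
    rw [abs_lt]; constructor <;> linarith

lemma far_of_near {t : ℝ} {n m : ℤ} {a : ℝ} (h : |t - (n + 1 / 2)| < 1 / 2)
    (ha : |t - m| < a) : 1 / 2 - a ≤ |t - (n + 1 / 2)| := by
  rw [abs_lt] at h ha
  rcases le_or_gt m n with h1 | h1
  · have : (m : ℝ) ≤ n := by exact_mod_cast h1
    refine le_trans ?_ (neg_le_abs _)
    linarith
  · have : (n : ℝ) + 1 ≤ m := by exact_mod_cast h1
    refine le_trans ?_ (le_abs_self _)
    linarith

lemma far_int {t : ℝ} {a : ℝ} (h : ∀ m : ℤ, a ≤ |t - m|) : |t - (⌊t⌋ + 1 / 2)| ≤ 1 / 2 - a := by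
  have h0 := Int.floor_le t
  have h1 := Int.lt_floor_add_one t
  have h2 := h ⌊t⌋
  have h3 := h (⌊t⌋ + 1)
  push_cast at h3
  rw [abs_of_nonneg (by linarith)] at h2
  rw [abs_of_nonpos (by linarith)] at h3
  rw [abs_le]; constructor <;> linarith

theorem fill {η1 η2 a0 : ℝ} (ha0 : 0 < a0) (ha02 : a0 < 1 / 2) (hη1 : 0 < η1)
    (hη14 : η1 ≤ 1 / 4) (hη : η1 < η2) :
    ∃ c' > 0, c' ≤ η1 ∧ ∀ ε > 0, ∃ μ > 0,
      ∀ s : (ι → ℝ) × (κ → ℝ) → (ι → ℝ) × (κ → ℝ), OE s {p | p.2 ∈ NN κ η2} →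
        (∀ p, p.2 ∈ NN κ η2 → dist (s p) p < μ) →
        (∀ p, p.2 ∈ NN κ η2 → a0 < ‖p.1‖ → s p = p) →
        ∃ f : (ι → ℝ) × (κ → ℝ) ≃ₜ (ι → ℝ) × (κ → ℝ), (∀ p, 1 / 2 ≤ ‖p.1‖ → f p = p) ∧
          (∀ p : (ι → ℝ) × (κ → ℝ), (∃ i, |p.2 i| < c') → f p = s p) ∧
          ∀ p, dist (f p) p < ε := by
  classical
  set a := max a0 (1 / 2 - η1) with ha
  have haa0 : a0 ≤ a := le_max_left _ _
  have haη : 1 / 2 - η1 ≤ a := le_max_right _ _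
  have ha12 : a < 1 / 2 := max_lt ha02 (by linarith)
  obtain ⟨c, hac, hc12, hcol⟩ := collar_at (E := (ι → ℝ) × (κ → ℝ)) (ha0.trans_le haa0) ha12
  refine ⟨1 / 2 - c, by linarith, by linarith, fun ε hε => ?_⟩
  set ε1 := min ε ((1 / 2 - c) / 2) with hε1
  have hε10 : 0 < ε1 := lt_min hε (by linarith)
  have hε1c : ε1 ≤ (1 / 2 - c) / 2 := min_le_right _ _
  obtain ⟨δ, hδ, hcol⟩ := hcol ε1 hε10
  set μ := min (min δ ε1) (η2 - η1) with hμ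
  have hμ0 : 0 < μ := lt_min (lt_min hδ hε10) (by linarith)
  have hμδ : μ ≤ δ := (min_le_left _ _).trans (min_le_left _ _)
  have hμε : μ ≤ ε1 := (min_le_left _ _).trans (min_le_right _ _)
  have hμη : μ ≤ η2 - η1 := min_le_right _ _
  refine ⟨μ, hμ0, fun s hs hsd hsid => ?_⟩
  -- the extended map
  set g1 : (ι → ℝ) × (κ → ℝ) → (ι → ℝ) × (κ → ℝ) := fun p => if a0 < ‖p.1‖ then p else s p with hg1
  have hg1s : ∀ p : (ι → ℝ) × (κ → ℝ), p.2 ∈ NN κ η2 → g1 p = s p := by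
    intro p hp
    simp only [hg1]
    split_ifs with h
    · exact (hsid p hp h).symm
    · rfl
  have hg1id : ∀ p : (ι → ℝ) × (κ → ℝ), a0 < ‖p.1‖ → g1 p = p := fun p hp => by
    simp only [hg1, if_pos hp]
  set O1 : Set ((ι → ℝ) × (κ → ℝ)) := {p | p.2 ∈ NN κ η1 ∨ a0 < ‖p.1‖} with hO1
  have hg1d : ∀ p ∈ O1, dist (g1 p) p < μ := by
    rintro p (hp | hp)
    · rw [hg1s p (NN_mono hη.le hp)]
      exact hsd p (NN_mono hη.le hp)
    · rw [hg1id p hp, dist_self]; exact hμ0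
  have hoN : IsOpen {p : (ι → ℝ) × (κ → ℝ) | p.2 ∈ NN κ η1} :=
    (NN_open κ η1).preimage continuous_snd
  have hoA : IsOpen {p : (ι → ℝ) × (κ → ℝ) | a0 < ‖p.1‖} :=
    isOpen_lt continuous_const (by fun_prop)
  have hmix : ∀ p q : (ι → ℝ) × (κ → ℝ), p.2 ∈ NN κ η1 → a0 < ‖q.1‖ → g1 p = g1 q → p = q := by
    intro p q hp hq hpq
    have h1 := hg1d p (Or.inl hp)
    rw [hpq, hg1id q hq] at h1
    have hq2 : q.2 ∈ NN κ η2 := by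
      obtain ⟨i, z, hz⟩ := hp
      refine ⟨i, z, ?_⟩
      have h2 : |q.2 i - p.2 i| < μ := by
        rw [← Real.dist_eq]
        refine lt_of_le_of_lt (dist_le_pi_dist q.2 p.2 i) (lt_of_le_of_lt ?_ h1)
        rw [Prod.dist_eq]; exact le_max_right _ _
      have := abs_sub_le (q.2 i) (p.2 i) z
      linarith
    refine hs.inj (NN_mono hη.le hp) hq2 ?_
    rw [← hg1s p (NN_mono hη.le hp), ← hg1s q hq2, hpq]
  have hg1E : OE g1 O1 := by
    refine OE.of_two hoN hoA ?_ ?_ (fun p hp => hp) ?_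
    · exact (hs.mono fun p hp => NN_mono hη.le hp).congr fun p hp => hg1s p (NN_mono hη.le hp)
    · exact (OE.id _).congr hg1id
    · rintro p (hp | hp) q (hq | hq) hpq
      · refine hs.inj (NN_mono hη.le hp) (NN_mono hη.le hq) ?_
        rw [← hg1s p (NN_mono hη.le hp), ← hg1s q (NN_mono hη.le hq), hpq]
      · exact hmix p q hp hq hpq
      · exact (hmix q p hq hp hpq.symm).symm
      · rw [hg1id p hp, hg1id q hq] at hpq
        exact hpq
  have hann : ∀ z : κ → ℤ, ∀ p : (ι → ℝ) × (κ → ℝ), a < dist p (cen ι z) →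
      dist p (cen ι z) < 1 / 2 → p ∈ O1 := by
    intro z p h1 h2
    rw [dist_cen] at h1 h2
    rcases lt_max_iff.1 h1 with h | h
    · exact Or.inr (haa0.trans_lt h)
    · left
      by_contra hn
      refine absurd h (not_lt.2 ?_)
      refine (dist_pi_le_iff (ha0.le.trans haa0)).2 fun i => ?_
      by_contra hi
      push Not at hi
      apply hn
      rw [Real.dist_eq] at hi
      have h3 : |p.2 i - (z i + 1 / 2)| < 1 / 2 := by
        rw [← Real.dist_eq]
        exact lt_of_le_of_lt (dist_le_pi_dist p.2 (fun i => (z i : ℝ) + 1 / 2) i)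
          (lt_of_le_of_lt (le_max_right _ _) h2)
      obtain ⟨m, hm⟩ := near_int (a := η1) h3 (by linarith)
      exact ⟨i, m, hm⟩
  have exG := fun z : κ → ℤ => hcol (cen ι z) g1 (hg1E.mono fun p hp => hann z p hp.1 hp.2)
    (fun p h1 h2 => (hg1d p (hann z p h1 h2)).trans_le hμδ)
  choose G hG1 hG2 hG3 using exG
  set Vi : Set ((ι → ℝ) × (κ → ℝ)) := {p | p.2 ∈ NN κ (1 / 2 - c) ∨ c < ‖p.1‖} with hVi
  have hViO : Vi ⊆ O1 := by
    rintro p (hp | hp)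
    · exact Or.inl (NN_mono (by linarith) hp)
    · exact Or.inr (by show a0 < ‖p.1‖; linarith)
  have hVio : IsOpen Vi := by
    have h1 : IsOpen {p : (ι → ℝ) × (κ → ℝ) | p.2 ∈ NN κ (1 / 2 - c)} :=
      (NN_open κ _).preimage continuous_snd
    have h2 : IsOpen {p : (ι → ℝ) × (κ → ℝ) | c < ‖p.1‖} :=
      isOpen_lt continuous_const (by fun_prop)
    exact h1.union h2
  have hcell : ∀ (z : κ → ℤ) (p : (ι → ℝ) × (κ → ℝ)), dist p (cen ι z) < 1 / 2 → ∀ i,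
      |p.2 i - (z i + 1 / 2)| < 1 / 2 := by
    intro z p hp i
    rw [dist_cen] at hp
    rw [← Real.dist_eq]
    exact lt_of_le_of_lt (dist_le_pi_dist p.2 (fun i => (z i : ℝ) + 1 / 2) i)
      (lt_of_le_of_lt (le_max_right _ _) hp)
  have hVicell : ∀ (z : κ → ℤ) (p : (ι → ℝ) × (κ → ℝ)), dist p (cen ι z) < 1 / 2 → p ∈ Vi →
      c ≤ dist p (cen ι z) := by
    rintro z p hp (⟨i, m, hm⟩ | hpV)
    · have h1 := far_of_near (hcell z p hp i) hm
      have h2 : |p.2 i - (z i + 1 / 2)| ≤ dist p (cen ι z) := by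
        rw [dist_cen, ← Real.dist_eq]
        exact (dist_le_pi_dist p.2 (fun i => (z i : ℝ) + 1 / 2) i).trans (le_max_right _ _)
      linarith
    · rw [dist_cen]
      exact hpV.le.trans (le_max_left _ _)
  have hcompl : ∀ p : (ι → ℝ) × (κ → ℝ), p ∉ Vi → dist p (cen ι fun i => ⌊p.2 i⌋) ≤ c := by
    intro p hp
    have h1 : ¬ (p.2 ∈ NN κ (1 / 2 - c)) := fun h => hp (Or.inl h)
    have h2 : ¬ (c < ‖p.1‖) := fun h => hp (Or.inr h)
    rw [dist_cen]
    refine max_le (not_lt.1 h2) ((dist_pi_le_iff (by linarith)).2 fun i => ?_)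
    rw [Real.dist_eq]
    have := far_int (t := p.2 i) (a := 1 / 2 - c) (fun m => by
      by_contra hm
      exact h1 ⟨i, m, not_le.1 hm⟩)
    linarith
  set F : (ι → ℝ) × (κ → ℝ) → (ι → ℝ) × (κ → ℝ) := fun p =>
    if p ∈ Vi then g1 p else G (fun i => ⌊p.2 i⌋) p with hF
  have hFV : ∀ p ∈ Vi, F p = g1 p := fun p hp => by simp only [hF, if_pos hp]
  have hFc : ∀ (z : κ → ℤ) (p : (ι → ℝ) × (κ → ℝ)), dist p (cen ι z) < 1 / 2 → F p = G z p := by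
    intro z p hp
    by_cases h : p ∈ Vi
    · rw [hFV p h, hG2 z p (hVicell z p hp h) hp]
    · have : (fun i => ⌊p.2 i⌋) = z := funext fun i => floor_of_cell (hcell z p hp i)
      simp only [hF, if_neg h, this]
  have hFd : ∀ p, dist (F p) p < ε1 := by
    intro p
    by_cases h : p ∈ Vi
    · rw [hFV p h]
      exact (hg1d p (hViO h)).trans_le hμε
    · have h1 := (hcompl p h).trans_lt hc12
      rw [hFc _ p h1]
      exact hG3 _ p h1
  have hnear : ∀ p q, p ∉ Vi → F p = F q → p = q := by
    intro p q hp hpq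
    have h1 := hcompl p hp
    have h2 := hFd p
    have h3 := hFd q
    rw [← hpq] at h3
    have h4 := dist_triangle_left q p (F p)
    have h5 := dist_triangle q p (cen ι fun i => ⌊p.2 i⌋)
    have h6 : dist q (cen ι fun i => ⌊p.2 i⌋) < 1 / 2 := by linarith
    have h7 : dist p (cen ι fun i => ⌊p.2 i⌋) < 1 / 2 := by linarith
    rw [hFc _ p h7, hFc _ q h6] at hpq
    exact (hG1 _).inj h7 h6 hpq
  have hFE : OE F univ := by
    refine OE.of_cover (fun o : Option (κ → ℤ) => o.elim Vi fun z => ball (cen ι z) (1 / 2))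
      ?_ ?_ ?_ ?_
    · rintro (_ | z)
      · exact hVio
      · exact isOpen_ball
    · rintro (_ | z)
      · exact (hg1E.mono hViO).congr hFV
      · exact (hG1 z).congr fun p hp => hFc z p hp
    · intro p _
      by_cases h : p ∈ Vi
      · exact mem_iUnion.2 ⟨none, h⟩
      · exact mem_iUnion.2 ⟨some _, (hcompl p h).trans_lt hc12⟩
    · intro p _ q _ hpq
      by_cases h : p ∈ Vi
      · by_cases h' : q ∈ Vi
        · rw [hFV p h, hFV q h'] at hpq
          exact hg1E.inj (hViO h) (hViO h') hpq
        · exact (hnear q p h' hpq.symm).symm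
      · exact hnear p q h hpq
  obtain ⟨f, hf⟩ := homeo_of_OE hFE hFd
  refine ⟨f, ?_, ?_, ?_⟩
  · intro p hp
    rw [hf, hFV p (Or.inr (by show c < ‖p.1‖; linarith)), hg1id p (by linarith)]
  · rintro p ⟨i, hi⟩
    have h1 : p.2 ∈ NN κ (1 / 2 - c) := ⟨i, 0, by simpa using hi⟩
    rw [hf, hFV p (Or.inl h1), hg1s p (NN_mono (by linarith) h1)]
  · intro p
    rw [hf]
    exact (hFd p).trans_le (min_le_left _ _)

end fill

end EK
end

section
open Topology Set Metric

namespace EK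

section
variable {ι κ : Type*} [Fintype ι] [Fintype κ]

lemma compress_aniso {ρ l ε : ℝ} (hρ : 0 < ρ) (hρ1 : ρ ≤ 1) (hl : ρ < l) (hε : ε ≤ ρ / 2)
    (f : (ι → ℝ) × (κ → ℝ) ≃ₜ (ι → ℝ) × (κ → ℝ)) (hf : ∀ p, dist (f p) p ≤ ε)
    (hid : ∀ p, 1 / 2 ≤ ‖p.1‖ → f p = p) :
    ∃ h : (ι → ℝ) × (κ → ℝ) ≃ₜ (ι → ℝ) × (κ → ℝ), (∀ p, l ≤ ‖p.2‖ → h p = p) ∧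
      (∀ p, 1 / 2 ≤ ‖p.1‖ → h p = p) ∧ (∀ p, ‖p.2‖ ≤ ρ / 2 → h p = f p) ∧
      ∀ p, dist (h p) p ≤ 4 * ε / ρ := by
  set k := ρ / 2 with hk
  have hk0 : 0 < k := by positivity
  have hε0 : 0 ≤ ε := dist_nonneg.trans (hf 0)
  let D : (ι → ℝ) × (κ → ℝ) ≃ₜ (ι → ℝ) × (κ → ℝ) :=
    (Homeomorph.smulOfNeZero k hk0.ne').prodCongr (Homeomorph.refl _)
  have eD : ∀ p, D p = (k • p.1, p.2) := fun p => rfl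
  have eDs : ∀ p, D.symm p = (k⁻¹ • p.1, p.2) := by
    intro p
    rw [Homeomorph.symm_apply_eq, eD]
    ext1
    · simp [smul_smul, hk0.ne']
    · rfl
  have hDd : ∀ p q, dist (D p) (D q) ≤ dist p q := by
    intro p q
    rw [eD, eD, Prod.dist_eq, Prod.dist_eq]
    refine max_le_max ?_ le_rfl
    simp only
    rw [dist_smul₀, Real.norm_of_nonneg hk0.le]
    exact mul_le_of_le_one_left dist_nonneg (by linarith)
  have hDd' : ∀ p q, dist p q ≤ k⁻¹ * dist (D p) (D q) := by
    intro p q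
    rw [eD, eD, Prod.dist_eq, Prod.dist_eq]
    simp only
    rw [dist_smul₀, Real.norm_of_nonneg hk0.le]
    have h1 : (1 : ℝ) ≤ k⁻¹ := by rw [one_le_inv₀ hk0]; linarith
    have hk' := inv_pos.2 hk0
    refine max_le ?_ ?_
    · have : dist p.1 q.1 = k⁻¹ * (k * dist p.1 q.1) := by
        rw [← mul_assoc, inv_mul_cancel₀ hk0.ne', one_mul]
      rw [this]
      gcongr
      rw [← this]
      exact le_max_left _ _
    · calc dist p.2 q.2 ≤ k⁻¹ * dist p.2 q.2 := le_mul_of_one_le_left dist_nonneg h1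
        _ ≤ _ := by gcongr; exact le_max_right _ _
  let f' := (D.symm.trans f).trans D
  have ef' : ∀ p, f' (D p) = D (f p) := fun p => by
    show D (f (D.symm (D p))) = _
    rw [Homeomorph.symm_apply_apply]
  obtain ⟨h, h1, h2, h3, h4⟩ := compress hρ hl f' (ε := ε) (by
    intro p
    obtain ⟨q, rfl⟩ := D.surjective p
    rw [ef', ← dist_eq_norm]
    exact (hDd _ _).trans (hf q))
  have key : ∀ p, ((D.trans h).trans D.symm) p = D.symm (h (D p)) := fun p => rfl
  have hid' : ∀ p : (ι → ℝ) × (κ → ℝ), 1 / 2 ≤ ‖p.1‖ → D.symm (h (D p)) = p := by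
    intro p hp
    rw [h3, Homeomorph.symm_apply_apply]
    intro t ht
    have e : t • D p = D (t • p) := by
      rw [eD, eD]
      ext1
      · simp only [Prod.smul_fst, Prod.smul_mk, smul_comm t k]
      · rfl
    rw [e, ef', hid]
    rw [Prod.smul_fst, norm_smul, Real.norm_of_nonneg (by linarith)]
    nlinarith
  refine ⟨(D.trans h).trans D.symm, ?_, ?_, ?_, ?_⟩
  · intro p hp
    rw [key, h1, Homeomorph.symm_apply_apply]
    rw [eD, Prod.norm_def]
    exact hp.trans (le_max_right _ _)
  · intro p hp
    rw [key]
    exact hid' p hp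
  · intro p hp
    rw [key]
    rcases le_or_gt (1 / 2) ‖p.1‖ with hx | hx
    · rw [hid' p hx, hid p hx]
    · have hDp : ‖D p‖ ≤ ρ / 2 := by
        rw [eD, Prod.norm_def]
        refine max_le ?_ hp
        simp only
        rw [norm_smul, Real.norm_of_nonneg hk0.le]
        nlinarith [norm_nonneg p.1]
      have hDf : ‖D (f p)‖ ≤ ρ := by
        have := (hDd (f p) p).trans (hf p)
        have h5 := norm_le_norm_add_norm_sub (D p) (D (f p))
        rw [← dist_eq_norm, dist_comm] at h5
        linarith
      rw [h2 _ (by linarith) (by rw [ef']; exact hDf), ef', Homeomorph.symm_apply_apply]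
  · intro p
    rw [key]
    refine (hDd' _ _).trans ?_
    rw [Homeomorph.apply_symm_apply, dist_eq_norm]
    have := h4 (D p)
    have e : 4 * ε / ρ = k⁻¹ * (2 * ε) := by rw [hk]; field_simp; ring
    rw [e]
    gcongr

theorem handle (ι κ : Type*) [Fintype ι] [Fintype κ] {a0 : ℝ} (ha : 0 < a0) (ha2 : a0 < 1 / 2) :
    ∃ r > 0, ∃ y1 > 0, y1 < r ∧ ∀ ε > 0, ∃ δ > 0,
      ∀ g : (ι → ℝ) × (κ → ℝ) → (ι → ℝ) × (κ → ℝ), OE g {p | ‖p.2‖ < r} →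
      (∀ p, ‖p.2‖ < r → a0 < ‖p.1‖ → g p = p) → (∀ p, ‖p.2‖ < r → dist (g p) p < δ) →
      ∃ h : (ι → ℝ) × (κ → ℝ) ≃ₜ (ι → ℝ) × (κ → ℝ), (∀ p, ‖p.2‖ ≤ y1 → h p = g p) ∧
        (∀ p, 1 / 2 ≤ ‖p.1‖ ∨ r ≤ ‖p.2‖ → h p = p) ∧ ∀ p, dist (h p) p < ε := by
  rcases isEmpty_or_nonempty κ with hκ | hκ
  · have hz : ∀ y : κ → ℝ, ‖y‖ = 0 := fun y => by
      rw [Subsingleton.elim y 0, norm_zero]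
    refine ⟨1, one_pos, 1 / 2, by norm_num, by norm_num, fun ε hε => ⟨ε, hε, fun g hg hid hd => ?_⟩⟩
    have hall : ∀ p : (ι → ℝ) × (κ → ℝ), ‖p.2‖ < 1 := fun p => by rw [hz]; exact one_pos
    obtain ⟨h, hh⟩ := homeo_of_OE (hg.mono (fun p _ => hall p)) (fun p => hd p (hall p))
    refine ⟨h, fun p _ => hh p, ?_, fun p => by rw [hh]; exact hd p (hall p)⟩
    rintro p (hp | hp)
    · rw [hh, hid p (hall p) (by linarith)]
    · rw [hz] at hp; linarith
  obtain ⟨i0⟩ := id hκ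
  obtain ⟨η, hη, hη4, α, hα, hα0, hper⟩ := immersion κ
  have h21 : η / 2 < η := by linarith
  obtain ⟨lam, hlam, hinj⟩ := unif_inj h21 (by linarith) hα hper
  obtain ⟨r, hr, hbd⟩ := unif_bdd h21 (by linarith) hα hper
  obtain ⟨c', hc', hc'η, hfill⟩ := fill (ι := ι) (κ := κ) (η1 := η / 4) (η2 := η / 2) ha ha2
    (by linarith) (by linarith) (by linarith)
  have h0N : (0 : κ → ℝ) ∈ NN κ (η / 2) := ⟨i0, 0, by simpa using hη⟩
  -- radii
  set l := min (lam / 2) (η / 4) with hl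
  have hl0 : 0 < l := lt_min (by linarith) (by linarith)
  have hllam : l ≤ lam / 2 := min_le_left _ _
  have hlη : l ≤ η / 4 := min_le_right _ _
  set ρ := l / 2 with hρ
  have hρ0 : 0 < ρ := by positivity
  set y0 := min (ρ / 2) (c' / 2) with hy0
  have hy00 : 0 < y0 := lt_min (by linarith) (by linarith)
  obtain ⟨m, hm, hopen⟩ := unif_open h21 (by linarith) hα hper hy00
  have hopen0 := hopen 0 h0N
  rw [hα0] at hopen0
  refine ⟨r, hr, min (m / 2) (r / 2), lt_min (by linarith) (by linarith),
    (min_le_right _ _).trans_lt (by linarith), fun ε hε => ?_⟩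
  -- uniform continuity
  have hKc : IsCompact (closedBall (0 : κ → ℝ) (lam * (3 / 4))) := isCompact_closedBall _ _
  have huc := hKc.uniformContinuousOn_of_continuous ((hinj 0 h0N).cont.mono
    (closedBall_subset_ball (by linarith)))
  obtain ⟨ω, hω, huc⟩ := Metric.uniformContinuousOn_iff.1 huc ε hε
  set ε2 := min (min ω ε) (lam / 4) with hε2
  have hε20 : 0 < ε2 := lt_min (lt_min hω hε) (by linarith)
  have hε2ω : ε2 ≤ ω := (min_le_left _ _).trans (min_le_left _ _)
  have hε2ε : ε2 ≤ ε := (min_le_left _ _).trans (min_le_right _ _)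
  have hε2l : ε2 ≤ lam / 4 := min_le_right _ _
  set ε1 := min (ρ / 2) (ε2 * ρ / 8) with hε1
  have hε10 : 0 < ε1 := lt_min (by linarith) (by positivity)
  have hε1ρ : ε1 ≤ ρ / 2 := min_le_left _ _
  have hε1b : 4 * ε1 / ρ < ε2 := by
    have : ε1 ≤ ε2 * ρ / 8 := min_le_right _ _
    rw [div_lt_iff₀ hρ0]
    nlinarith [mul_pos hε20 hρ0]
  obtain ⟨μ, hμ, hfill⟩ := hfill ε1 hε10
  obtain ⟨δ, hδ, hlift⟩ := liftg (ι := ι) (a0 := a0) h21 (by linarith) hα hper hbd hμ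
  refine ⟨δ, hδ, fun g hg hid hd => ?_⟩
  obtain ⟨s, hs1, hs2, hs3, hs4⟩ := hlift g hg hid hd
  obtain ⟨f, hf1, hf2, hf3⟩ := hfill s hs1 hs3 hs4
  obtain ⟨h, hh1, hh2, hh3, hh4⟩ := compress_aniso hρ0 (by linarith) (show ρ < l by linarith) hε1ρ f
    (fun p => (hf3 p).le) hf1
  set S : Set ((ι → ℝ) × (κ → ℝ)) := {p | ‖p.1‖ ≤ 1 / 2 ∧ ‖p.2‖ ≤ l} with hS
  have hSc : IsCompact S := by
    have := (isCompact_closedBall (0 : ι → ℝ) (1 / 2)).prod (isCompact_closedBall (0 : κ → ℝ) l)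
    convert this using 1
    ext p
    simp [hS]
  have hVo : IsOpen {p : (ι → ℝ) × (κ → ℝ) | p.2 ∈ ball (0 : κ → ℝ) lam} :=
    isOpen_ball.preimage continuous_snd
  have hbE : OE (bet ι α) {p | p.2 ∈ ball (0 : κ → ℝ) lam} := bet_OE (hinj 0 h0N)
  have hSV : S ⊆ {p | p.2 ∈ ball (0 : κ → ℝ) lam} := by
    rintro p ⟨-, hp⟩
    show p.2 ∈ ball (0 : κ → ℝ) lam
    rw [mem_ball_zero_iff]; linarith
  obtain ⟨H, hH1, hH2⟩ := transport hbE hVo hSc hSV h (by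
    intro p hp
    by_cases h1 : ‖p.1‖ ≤ 1 / 2
    · exact hh1 p (not_lt.1 fun h2 => hp ⟨h1, h2.le⟩)
    · exact hh2 p (not_le.1 h1).le)
  have hHd : ∀ q, dist (H q) q < ε := by
    intro q
    by_cases hq : q ∈ bet ι α '' S
    · obtain ⟨p, hp, rfl⟩ := hq
      rw [hH1 p (hSV hp)]
      have h5 : dist (h p) p < ε2 := (hh4 p).trans_lt hε1b
      rw [Prod.dist_eq, max_lt_iff] at h5 ⊢
      refine ⟨h5.1.trans_le hε2ε, ?_⟩
      refine huc _ ?_ _ ?_ (h5.2.trans_le hε2ω)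
      · rw [mem_closedBall, dist_zero_right]
        have := norm_le_norm_add_norm_sub p.2 (h p).2
        rw [← dist_eq_norm, dist_comm] at this
        linarith [hp.2, h5.2]
      · rw [mem_closedBall, dist_zero_right]
        linarith [hp.2]
    · rw [hH2 q hq, dist_self]; exact hε
  refine ⟨H, ?_, ?_, hHd⟩
  · intro q hq
    have hq1 : q.2 ∈ ball (0 : κ → ℝ) m := by
      rw [mem_ball_zero_iff]
      linarith [hq.trans (min_le_left _ _)]
    obtain ⟨y, hy, hyq⟩ := hopen0 hq1
    rw [mem_ball_zero_iff] at hy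
    have eq : q = bet ι α (q.1, y) := by
      ext1
      · rfl
      · exact hyq.symm
    have hyρ : ‖y‖ < ρ / 2 := hy.trans_le (min_le_left _ _)
    have hyc : ‖y‖ < c' / 2 := hy.trans_le (min_le_right _ _)
    have hyi : |y i0| < c' := by
      have := norm_le_pi_norm y i0
      rw [Real.norm_eq_abs] at this
      linarith
    rw [eq, hH1 _ (by show y ∈ ball (0 : κ → ℝ) lam; rw [mem_ball_zero_iff]; linarith),
      hh3 _ hyρ.le, hf2 _ ⟨i0, hyi⟩, hs2]
    exact ⟨i0, 0, by simp only [Int.cast_zero, sub_zero]; linarith⟩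
  · intro q hq
    by_cases hqS : q ∈ bet ι α '' S
    · obtain ⟨p, hp, rfl⟩ := hqS
      rw [hH1 p (hSV hp)]
      rcases hq with hq | hq
      · rw [hh2 p hq]
      · exfalso
        have : p.2 ∈ NN κ (η / 2) := by
          refine ⟨i0, 0, ?_⟩
          have h5 := norm_le_pi_norm p.2 i0
          rw [Real.norm_eq_abs] at h5
          simp only [Int.cast_zero, sub_zero]
          linarith [hp.2]
        exact absurd hq (not_le.2 (hbd _ this))
    · exact hH2 q hqS

end

end EK
end

section
open Topology Set Metric

namespace EK

lemma disjoint_prod {X σ : Type*} [TopologicalSpace X] [DecidableEq σ] (B : σ → Set X)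
    (h : σ → (X ≃ₜ X))
    (hid : ∀ i, ∀ p ∉ B i, h i p = p) (s : Finset σ)
    (hd : ∀ i ∈ s, ∀ j ∈ s, ∀ p ∈ B i, p ∈ B j → i = j) :
    ∃ H : X ≃ₜ X, (∀ i ∈ s, ∀ p ∈ B i, H p = h i p) ∧ ∀ p, (∀ i ∈ s, p ∉ B i) → H p = p := by
  induction s using Finset.induction_on with
  | empty => exact ⟨Homeomorph.refl X, by simp, fun p _ => rfl⟩
  | insert a s ha ih =>
    obtain ⟨H, h1, h2⟩ := ih fun i hi j hj =>
      hd i (Finset.mem_insert_of_mem hi) j (Finset.mem_insert_of_mem hj)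
    have hmaps : ∀ p ∈ B a, h a p ∈ B a := by
      intro p hp
      by_contra hn
      have := hid a _ hn
      have := (h a).injective this
      rw [this] at hn
      exact hn hp
    refine ⟨(h a).trans H, ?_, ?_⟩
    · intro i hi p hp
      show H (h a p) = h i p
      rcases Finset.mem_insert.1 hi with rfl | hi'
      · apply h2
        intro j hj hj'
        have := hd i (Finset.mem_insert_self _ _) j (Finset.mem_insert_of_mem hj) _ (hmaps p hp) hj'
        subst this
        exact ha hj
      · rw [hid a p, h1 i hi' p hp]
        intro hpa
        have := hd i hi a (Finset.mem_insert_self _ _) p hp hpa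
        subst this
        exact ha hi'
    · intro p hp
      show H (h a p) = p
      rw [hid a p (hp a (Finset.mem_insert_self _ _))]
      exact h2 p fun i hi => hp i (Finset.mem_insert_of_mem hi)

section faces
variable {ι : Type*} [Fintype ι] [DecidableEq ι]

/-- neighbourhood of a closed lattice face -/
def Pf (ρ : ℝ) (w : ι → ℤ) (J : Finset ι) : Set (ι → ℝ) :=
  {p | (∀ i ∈ J, w i - ρ < p i ∧ p i < w i + 1 + ρ) ∧ ∀ j ∉ J, |p j - w j| < ρ}

/-- a handle -/
def Df (ρ : ℝ) (v : ι → ℤ) (I : Finset ι) : Set (ι → ℝ) :=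
  {p | (∀ i ∈ I, |p i - v i - 1 / 2| < 1 / 2) ∧ ∀ j ∉ I, |p j - v j| < ρ / 4}

/-- a smaller handle -/
def Bf (ρ : ℝ) (v : ι → ℤ) (I : Finset ι) : Set (ι → ℝ) :=
  {p | (∀ i ∈ I, |p i - v i - 1 / 2| < 1 / 2 - ρ / 4) ∧ ∀ j ∉ I, |p j - v j| < ρ / 4}

lemma Bf_sub_Df {ρ : ℝ} (hρ : 0 < ρ) (v : ι → ℤ) (I : Finset ι) : Bf ρ v I ⊆ Df ρ v I :=
  fun _ hp => ⟨fun i hi => (hp.1 i hi).trans (by linarith), hp.2⟩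

lemma Bf_sub_Pf {ρ : ℝ} (hρ : 0 < ρ) (v : ι → ℤ) (I : Finset ι) : Bf ρ v I ⊆ Pf (ρ / 4) v I := by
  intro p hp
  refine ⟨fun i hi => ?_, hp.2⟩
  have := abs_lt.1 (hp.1 i hi)
  constructor <;> linarith

lemma Pf_Bf_disj {ρ ρ' : ℝ} (hρ : 0 < ρ) (hρ1 : ρ ≤ 1 / 4) (hρ' : ρ' ≤ ρ / 4) {v w : ι → ℤ}
    {I J : Finset ι} (hc : J.card ≤ I.card) {p : ι → ℝ} (h1 : p ∈ Pf ρ' w J)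
    (h2 : p ∈ Bf ρ v I) : w = v ∧ J = I := by
  have hsub : I ⊆ J := by
    intro i hi
    by_contra hj
    have a1 := abs_lt.1 (h2.1 i hi)
    have a2 := abs_lt.1 (h1.2 i hj)
    have b1 : (v i : ℝ) < w i := by linarith
    have b2 : (w i : ℝ) < v i + 1 := by linarith
    have c1 : v i < w i := by exact_mod_cast b1
    have c2 : w i < v i + 1 := by exact_mod_cast b2
    omega
  have hIJ : I = J := Finset.eq_of_subset_of_card_le hsub hc
  refine ⟨funext fun i => ?_, hIJ.symm⟩
  by_cases hi : i ∈ I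
  · have a1 := abs_lt.1 (h2.1 i hi)
    have a2 := h1.1 i (hsub hi)
    have b1 : (w i : ℝ) < v i + 1 := by linarith
    have b2 : (v i : ℝ) < w i + 1 := by linarith
    have c1 : w i < v i + 1 := by exact_mod_cast b1
    have c2 : v i < w i + 1 := by exact_mod_cast b2
    omega
  · have a1 := abs_lt.1 (h2.2 i hi)
    have a2 := abs_lt.1 (h1.2 i (by rw [← hIJ]; exact hi))
    have b1 : (w i : ℝ) < v i + 1 := by linarith
    have b2 : (v i : ℝ) < w i + 1 := by linarith
    have c1 : w i < v i + 1 := by exact_mod_cast b1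
    have c2 : v i < w i + 1 := by exact_mod_cast b2
    omega

/-- coordinates adapted to a handle -/
noncomputable def hcoord (v : ι → ℤ) (I : Finset ι) {s t : ℝ} (hs : s ≠ 0) (ht : t ≠ 0) :
    (ι → ℝ) ≃ₜ ({i // i ∈ I} → ℝ) × ({i // i ∉ I} → ℝ) where
  toFun p := (fun i => s * (p i - v i - 1 / 2), fun j => t * (p j - v j))
  invFun q := fun i => if h : i ∈ I then s⁻¹ * q.1 ⟨i, h⟩ + v i + 1 / 2 else t⁻¹ * q.2 ⟨i, h⟩ + v i
  left_inv p := by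
    funext i
    by_cases h : i ∈ I
    · simp only [h, dif_pos]; field_simp; ring
    · simp only [h, dif_neg, not_false_eq_true]; field_simp; ring
  right_inv q := by
    ext i
    · simp only [i.2, dif_pos]; field_simp; ring
    · simp only [i.2, dif_neg, not_false_eq_true]; field_simp; ring
  continuous_toFun := by fun_prop
  continuous_invFun := by
    refine continuous_pi fun i => ?_
    by_cases h : i ∈ I
    · simp only [h, dif_pos]; fun_prop
    · simp only [h, dif_neg, not_false_eq_true]; fun_prop

lemma hcoord_dist (v : ι → ℤ) (I : Finset ι) {s t : ℝ} (hs : 0 < s) (ht : 0 < t) (p q : ι → ℝ) :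
    dist (hcoord v I hs.ne' ht.ne' p) (hcoord v I hs.ne' ht.ne' q) ≤ (s + t) * dist p q := by
  have hb : ∀ (a : ℝ) (i : ι) (u : ℝ), 0 < a → a ≤ s + t →
      dist (a * (p i - u)) (a * (q i - u)) ≤ (s + t) * dist p q := by
    intro a i u ha hat
    rw [Real.dist_eq, ← mul_sub, abs_mul, abs_of_pos ha]
    have e : p i - u - (q i - u) = p i - q i := by ring
    rw [e, ← Real.dist_eq]
    have := dist_le_pi_dist p q i
    have := dist_nonneg (x := p i) (y := q i)
    nlinarith
  have hnn : 0 ≤ (s + t) * dist p q := by positivity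
  rw [Prod.dist_eq]
  refine max_le ((dist_pi_le_iff hnn).2 fun i => ?_) ((dist_pi_le_iff hnn).2 fun i => ?_)
  · have := hb s i (v i + 1 / 2) hs (by linarith)
    rw [← sub_sub, ← sub_sub] at this
    exact this
  · exact hb t i (v i) ht (by linarith)

lemma hcoord_dist_inv (v : ι → ℤ) (I : Finset ι) {s t : ℝ} (hs : 0 < s) (ht : 0 < t)
    (p q : ι → ℝ) : dist p q ≤
      (s⁻¹ + t⁻¹) * dist (hcoord v I hs.ne' ht.ne' p) (hcoord v I hs.ne' ht.ne' q) := by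
  have hs' := inv_pos.2 hs
  have ht' := inv_pos.2 ht
  set d := dist (hcoord v I hs.ne' ht.ne' p) (hcoord v I hs.ne' ht.ne' q) with hd
  have hd0 : 0 ≤ d := dist_nonneg
  refine (dist_pi_le_iff (by positivity)).2 fun i => ?_
  by_cases h : i ∈ I
  · have h1 : dist (s * (p i - v i - 1 / 2)) (s * (q i - v i - 1 / 2)) ≤ d := by
      rw [hd, Prod.dist_eq]
      exact (dist_le_pi_dist (hcoord v I hs.ne' ht.ne' p).1 (hcoord v I hs.ne' ht.ne' q).1
        ⟨i, h⟩).trans (le_max_left _ _)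
    rw [Real.dist_eq, ← mul_sub, abs_mul, abs_of_pos hs] at h1
    have e : p i - v i - 1 / 2 - (q i - v i - 1 / 2) = p i - q i := by ring
    rw [e, ← Real.dist_eq] at h1
    have : dist (p i) (q i) ≤ s⁻¹ * d := by
      rw [← div_eq_inv_mul, le_div_iff₀ hs]; linarith
    nlinarith
  · have h1 : dist (t * (p i - v i)) (t * (q i - v i)) ≤ d := by
      rw [hd, Prod.dist_eq]
      exact (dist_le_pi_dist (hcoord v I hs.ne' ht.ne' p).2 (hcoord v I hs.ne' ht.ne' q).2
        ⟨i, h⟩).trans (le_max_right _ _)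
    rw [Real.dist_eq, ← mul_sub, abs_mul, abs_of_pos ht] at h1
    have e : p i - v i - (q i - v i) = p i - q i := by ring
    rw [e, ← Real.dist_eq] at h1
    have : dist (p i) (q i) ≤ t⁻¹ * d := by
      rw [← div_eq_inv_mul, le_div_iff₀ ht]; linarith
    nlinarith

lemma hcoord_fst (v : ι → ℤ) (I : Finset ι) {s t : ℝ} (hs : 0 < s) (ht : 0 < t) (p : ι → ℝ)
    {c : ℝ} (hc : 0 < c) : ‖(hcoord v I hs.ne' ht.ne' p).1‖ < s * c ↔
      ∀ i ∈ I, |p i - v i - 1 / 2| < c := by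
  rw [pi_norm_lt_iff (by positivity)]
  constructor
  · intro h i hi
    have := h ⟨i, hi⟩
    change ‖s * (p i - v i - 1 / 2)‖ < _ at this
    rw [norm_mul, Real.norm_of_nonneg hs.le, Real.norm_eq_abs] at this
    exact lt_of_mul_lt_mul_left this hs.le
  · rintro h ⟨i, hi⟩
    change ‖s * (p i - v i - 1 / 2)‖ < _
    rw [norm_mul, Real.norm_of_nonneg hs.le, Real.norm_eq_abs]
    exact mul_lt_mul_of_pos_left (h i hi) hs

lemma hcoord_snd (v : ι → ℤ) (I : Finset ι) {s t : ℝ} (hs : 0 < s) (ht : 0 < t) (p : ι → ℝ)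
    {c : ℝ} (hc : 0 < c) : ‖(hcoord v I hs.ne' ht.ne' p).2‖ < t * c ↔
      ∀ i ∉ I, |p i - v i| < c := by
  rw [pi_norm_lt_iff (by positivity)]
  constructor
  · intro h i hi
    have := h ⟨i, hi⟩
    change ‖t * (p i - v i)‖ < _ at this
    rw [norm_mul, Real.norm_of_nonneg ht.le, Real.norm_eq_abs] at this
    exact lt_of_mul_lt_mul_left this ht.le
  · rintro h ⟨i, hi⟩
    change ‖t * (p i - v i)‖ < _
    rw [norm_mul, Real.norm_of_nonneg ht.le, Real.norm_eq_abs]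
    exact mul_lt_mul_of_pos_left (h i hi) ht

end faces

end EK
end

section
open Topology Set Metric

namespace EK

section faces
variable {ι : Type*} [Fintype ι] [DecidableEq ι]

lemma handle_cell (I : Finset ι) {ρ : ℝ} (hρ : 0 < ρ) (hρ1 : ρ ≤ 1 / 4) :
    ∃ y1 > 0, y1 ≤ ρ / 4 ∧ ∀ ε > 0, ∃ δ > 0, ∀ (v : ι → ℤ) (g : (ι → ℝ) → (ι → ℝ)),
      OE g (Df ρ v I) → (∀ p ∈ Df ρ v I, dist (g p) p < δ) →
      (∀ p ∈ Df ρ v I, (∃ i ∈ I, 1 / 2 - ρ / 2 ≤ |p i - v i - 1 / 2|) → g p = p) →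
      ∃ h : (ι → ℝ) ≃ₜ (ι → ℝ), (∀ p, dist (h p) p < ε) ∧ (∀ p ∉ Bf ρ v I, h p = p) ∧
        ∀ p ∈ Df ρ v I, (∀ j ∉ I, |p j - v j| < y1) → h p = g p := by
  set s : ℝ := (1 - ρ / 2)⁻¹ with hs
  have hs1 : 0 < 1 - ρ / 2 := by linarith
  have hs0 : 0 < s := inv_pos.2 hs1
  have hsB : s * (1 / 2 - ρ / 4) = 1 / 2 := by
    have e : (1 / 2 - ρ / 4 : ℝ) = (1 - ρ / 2) * (1 / 2) := by ring
    rw [hs, e, ← mul_assoc, inv_mul_cancel₀ hs1.ne', one_mul]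
  set a0 := s * (1 / 2 - ρ / 2) with ha0
  have ha00 : 0 < a0 := mul_pos hs0 (by linarith)
  have ha012 : a0 < 1 / 2 := by
    rw [← hsB, ha0]; exact mul_lt_mul_of_pos_left (by linarith) hs0
  have hs12 : 1 / 2 < s * (1 / 2) := by
    conv_lhs => rw [← hsB]
    exact mul_lt_mul_of_pos_left (by linarith) hs0
  obtain ⟨r, hr, y1, hy1, hy1r, H⟩ := handle {i // i ∈ I} {i // i ∉ I} ha00 ha012
  set t : ℝ := 4 * r / ρ with ht
  have ht0 : 0 < t := by positivity
  have htr : t * (ρ / 4) = r := by rw [ht]; field_simp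
  have hty : t * (y1 / t) = y1 := by field_simp
  refine ⟨y1 / t, by positivity, ?_, fun ε hε => ?_⟩
  · rw [div_le_iff₀ ht0]; linarith
  set K := s + t with hK
  have hK0 : 0 < K := by positivity
  set K' := s⁻¹ + t⁻¹ with hK'
  have hK'0 : 0 < K' := by positivity
  obtain ⟨δ, hδ, H⟩ := H (ε / K') (by positivity)
  set δ1 := min δ (s * (1 / 2) - a0) with hδ1
  have hδ10 : 0 < δ1 := lt_min hδ (by linarith)
  refine ⟨δ1 / K, by positivity, fun v g hg hd hid => ?_⟩
  set e := hcoord v I hs0.ne' ht0.ne' with he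
  have hfst := fun p c hc => hcoord_fst v I hs0 ht0 p (c := c) hc
  have hsnd := fun p c hc => hcoord_snd v I hs0 ht0 p (c := c) hc
  rw [← he] at hfst hsnd
  have hDe : ∀ p, p ∈ Df ρ v I ↔ ‖(e p).1‖ < s * (1 / 2) ∧ ‖(e p).2‖ < r := by
    intro p
    rw [hfst p _ (by norm_num), ← htr, hsnd p _ (by linarith)]
    rfl
  have hBe : ∀ p, p ∈ Bf ρ v I ↔ ‖(e p).1‖ < 1 / 2 ∧ ‖(e p).2‖ < r := by
    intro p
    rw [← hsB, hfst p _ (by linarith), ← htr, hsnd p _ (by linarith)]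
    rfl
  have hid' : ∀ p ∈ Df ρ v I, a0 ≤ ‖(e p).1‖ → g p = p := by
    intro p hp hpa
    apply hid p hp
    by_contra hn
    push Not at hn
    exact absurd hpa (not_le.2 ((hfst p _ (by linarith)).2 hn))
  have hde : ∀ p q, dist (e p) (e q) ≤ K * dist p q := hcoord_dist v I hs0 ht0
  have hde' : ∀ p q, dist p q ≤ K' * dist (e p) (e q) := hcoord_dist_inv v I hs0 ht0
  classical
  set G : ({i // i ∈ I} → ℝ) × ({i // i ∉ I} → ℝ) → ({i // i ∈ I} → ℝ) × ({i // i ∉ I} → ℝ) :=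
    fun q => if ‖q.1‖ < s * (1 / 2) then e (g (e.symm q)) else q with hG
  have hG1 : ∀ p, ‖(e p).1‖ < s * (1 / 2) → G (e p) = e (g p) := by
    intro p hp
    simp only [hG, if_pos hp, Homeomorph.symm_apply_apply]
  have hGid : ∀ q, ‖q.2‖ < r → a0 < ‖q.1‖ → G q = q := by
    intro q hq hqa
    by_cases h : ‖q.1‖ < s * (1 / 2)
    · obtain ⟨p, rfl⟩ := e.surjective q
      rw [hG1 p h, hid' p ((hDe p).2 ⟨h, hq⟩) hqa.le]
    · simp only [hG, if_neg h]
  have hGd : ∀ q, ‖q.2‖ < r → dist (G q) q < δ1 := by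
    intro q hq
    by_cases h : ‖q.1‖ < s * (1 / 2)
    · obtain ⟨p, rfl⟩ := e.surjective q
      rw [hG1 p h]
      refine (hde _ _).trans_lt ?_
      have := hd p ((hDe p).2 ⟨h, hq⟩)
      rw [lt_div_iff₀ hK0] at this
      linarith
    · simp only [hG, if_neg h, dist_self]; exact hδ10
  have hmix : ∀ p q, ‖p.2‖ < r → ‖q.2‖ < r → ‖p.1‖ < s * (1 / 2) → ¬ ‖q.1‖ < s * (1 / 2) →
      G p = G q → p = q := by
    intro p q hp hq h1 h2 hpq
    have hq' : G q = q := hGid q hq (by linarith [not_lt.1 h2])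
    rcases lt_or_ge a0 ‖p.1‖ with h3 | h3
    · rw [hGid p hp h3, hq'] at hpq; exact hpq
    · exfalso
      apply h2
      have h4 := hGd p hp
      rw [hpq, hq', Prod.dist_eq, max_lt_iff] at h4
      have h5 := norm_le_norm_add_norm_sub p.1 q.1
      rw [← dist_eq_norm, dist_comm] at h5
      linarith [h4.1, min_le_right δ (s * (1 / 2) - a0)]
  have hGE : OE G {q | ‖q.2‖ < r} := by
    have o1 : IsOpen {q : ({i // i ∈ I} → ℝ) × ({i // i ∉ I} → ℝ) | ‖q.1‖ < s * (1 / 2) ∧ ‖q.2‖ < r} :=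
      IsOpen.and (isOpen_lt (by fun_prop) (by fun_prop)) (isOpen_lt (by fun_prop) (by fun_prop))
    have o2 : IsOpen {q : ({i // i ∈ I} → ℝ) × ({i // i ∉ I} → ℝ) | a0 < ‖q.1‖ ∧ ‖q.2‖ < r} :=
      IsOpen.and (isOpen_lt (by fun_prop) (by fun_prop)) (isOpen_lt (by fun_prop) (by fun_prop))
    have hE1 : OE G {q | ‖q.1‖ < s * (1 / 2) ∧ ‖q.2‖ < r} := by
      have : OE (e ∘ g ∘ e.symm) {q | ‖q.1‖ < s * (1 / 2) ∧ ‖q.2‖ < r} := by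
        refine (OE.of_homeo e univ).comp (hg.comp (OE.of_homeo e.symm _) ?_) (mapsTo_univ _ _)
        intro q hq
        obtain ⟨p, rfl⟩ := e.surjective q
        rw [Homeomorph.symm_apply_apply]
        exact (hDe p).2 hq
      refine this.congr fun q hq => ?_
      simp only [hG, if_pos hq.1, Function.comp_apply]
    refine OE.of_two o1 o2 hE1 ((OE.id _).congr fun q hq => hGid q hq.2 hq.1) ?_ ?_
    · intro q hq
      rcases lt_or_ge ‖q.1‖ (s * (1 / 2)) with h | h
      · exact Or.inl ⟨h, hq⟩
      · exact Or.inr ⟨by linarith, hq⟩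
    · intro p hp q hq hpq
      by_cases h1 : ‖p.1‖ < s * (1 / 2)
      · by_cases h2 : ‖q.1‖ < s * (1 / 2)
        · exact hE1.inj ⟨h1, hp⟩ ⟨h2, hq⟩ hpq
        · exact hmix p q hp hq h1 h2 hpq
      · by_cases h2 : ‖q.1‖ < s * (1 / 2)
        · exact (hmix q p hq hp h2 h1 hpq.symm).symm
        · rw [hGid p hp (by linarith [not_lt.1 h1]), hGid q hq (by linarith [not_lt.1 h2])] at hpq
          exact hpq
  obtain ⟨h, hh1, hh2, hh3⟩ := H G hGE hGid (fun q hq => (hGd q hq).trans_le (min_le_left _ _))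
  have key : ∀ p, ((e.trans h).trans e.symm) p = e.symm (h (e p)) := fun p => rfl
  refine ⟨(e.trans h).trans e.symm, ?_, ?_, ?_⟩
  · intro p
    rw [key]
    refine (hde' _ _).trans_lt ?_
    rw [Homeomorph.apply_symm_apply]
    have := hh3 (e p)
    rw [lt_div_iff₀ hK'0] at this
    linarith
  · intro p hp
    rw [key, hh2, Homeomorph.symm_apply_apply]
    rw [hBe] at hp
    by_contra hn
    push Not at hn
    exact hp hn
  · intro p hp hpy
    have h1 := (hsnd p _ (by positivity)).2 hpy
    rw [hty] at h1
    rw [key, hh1 _ h1.le, hG1 p ((hDe p).1 hp).1, Homeomorph.symm_apply_apply]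

end faces

end EK
end

section
open Topology Set Metric

namespace EK

lemma fin_pos {α : Type*} [Finite α] (f : α → ℝ) (hf : ∀ a, 0 < f a) : ∃ m > 0, ∀ a, m ≤ f a := by
  rcases isEmpty_or_nonempty α with h | h
  · exact ⟨1, one_pos, fun a => isEmptyElim a⟩
  · obtain ⟨a, ha⟩ := Finite.exists_min f
    exact ⟨f a, hf a, ha⟩

section faces
variable {ι : Type*} [Fintype ι] [DecidableEq ι]

/-- lattice point as a real point -/
def rl (v : ι → ℤ) : ι → ℝ := fun i => (v i : ℝ)

lemma Pf_mono {a b : ℝ} (h : a ≤ b) (w : ι → ℤ) (J : Finset ι) : Pf a w J ⊆ Pf b w J :=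
  fun _ hp => ⟨fun i hi => ⟨by linarith [(hp.1 i hi).1], by linarith [(hp.1 i hi).2]⟩,
    fun j hj => (hp.2 j hj).trans_le h⟩

lemma Pf_dist {ρ : ℝ} (hρ0 : 0 ≤ ρ) {w : ι → ℤ} {J : Finset ι} {p : ι → ℝ}
    (hp : p ∈ Pf ρ w J) : dist p (rl w) ≤ 1 + ρ := by
  refine (dist_pi_le_iff (by linarith)).2 fun i => ?_
  rw [Real.dist_eq]
  by_cases hi : i ∈ J
  · have := hp.1 i hi
    rw [rl, abs_le]; constructor <;> linarith
  · have := hp.2 i hi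
    rw [rl]; linarith

lemma Df_sub_Pf {ρ : ℝ} (hρ : 0 < ρ) (v : ι → ℤ) (I : Finset ι) : Df ρ v I ⊆ Pf ρ v I := by
  intro p hp
  refine ⟨fun i hi => ?_, fun j hj => (hp.2 j hj).trans (by linarith)⟩
  have := abs_lt.1 (hp.1 i hi)
  constructor <;> linarith

lemma edge {ρ : ℝ} (hρ : 0 < ρ) {w : ι → ℤ} {J : Finset ι} {p : ι → ℝ} (hp : p ∈ Pf ρ w J) {i : ι}
    (hi : i ∈ J) (h : 1 / 2 - ρ / 2 ≤ |p i - w i - 1 / 2|) :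
    ∃ w' : ι → ℤ, (∀ j, |w' j - w j| ≤ 1) ∧ p ∈ Pf ρ w' (J.erase i) := by
  have hpi := hp.1 i hi
  rcases le_abs.1 h with h1 | h1
  · refine ⟨Function.update w i (w i + 1), ?_, ?_, ?_⟩
    · intro j
      by_cases hj : j = i
      · subst hj; simp
      · simp [Function.update_of_ne hj]
    · intro j hj
      rw [Finset.mem_erase] at hj
      rw [Function.update_of_ne hj.1]
      exact hp.1 j hj.2
    · intro j hj
      by_cases hji : j = i
      · subst hji
        rw [Function.update_self]
        push_cast
        rw [abs_lt]; constructor <;> linarith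
      · rw [Function.update_of_ne hji]
        exact hp.2 j fun hh => hj (Finset.mem_erase.2 ⟨hji, hh⟩)
  · refine ⟨w, by simp, ?_, ?_⟩
    · intro j hj
      exact hp.1 j (Finset.mem_erase.1 hj).2
    · intro j hj
      by_cases hji : j = i
      · subst hji
        rw [abs_lt]; constructor <;> linarith
      · exact hp.2 j fun hh => hj (Finset.mem_erase.2 ⟨hji, hh⟩)

lemma stage (k : ℕ) {ρ : ℝ} (hρ : 0 < ρ) (hρ1 : ρ ≤ 1 / 4) : ∃ ρ' > 0, ρ' ≤ ρ / 4 ∧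
    ∀ ε > 0, ∃ δ > 0, ∀ (V A : Set (ι → ℝ)) (L L' : Set (ι → ℤ)) (g : (ι → ℝ) → (ι → ℝ)),
      L'.Finite → (∀ v ∈ L', ∀ w : ι → ℤ, (∀ i, |w i - v i| ≤ 1) → w ∈ L) →
      (∀ v ∈ L', ∀ p, dist p (rl v) ≤ 2 → p ∈ V) → OE g V → (∀ p ∈ V, dist (g p) p < δ) →
      (∀ w ∈ L, ∀ J : Finset ι, J.card < k → ∀ p ∈ Pf ρ w J, g p = p) →
      (∀ p ∈ A, p ∈ V → g p = p) →
      ∃ h : (ι → ℝ) ≃ₜ (ι → ℝ), (∀ p, dist (h p) p < ε) ∧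
        (∀ p, (∀ v ∈ L', 2 ≤ dist p (rl v)) → h p = p) ∧
        (∀ w ∈ L', ∀ J : Finset ι, J.card < k + 1 → ∀ p ∈ Pf ρ' w J, h p = g p) ∧
        ∀ p, (∀ q, dist q p < 2 → q ∈ A) → h p = p := by
  choose y hy0 hyρ hcell using fun I : Finset ι => handle_cell I hρ hρ1
  obtain ⟨ρ1, hρ10, hρ1y⟩ := fin_pos y hy0
  refine ⟨min ρ1 (ρ / 4), lt_min hρ10 (by linarith), min_le_right _ _, fun ε hε => ?_⟩
  set ρ' := min ρ1 (ρ / 4) with hρ'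
  have hρ'0 : 0 < ρ' := lt_min hρ10 (by linarith)
  have hρ'4 : ρ' ≤ ρ / 4 := min_le_right _ _
  have hρ'y : ∀ I, ρ' ≤ y I := fun I => (min_le_left _ _).trans (hρ1y I)
  choose d hd0 hcell using fun I => hcell I ε hε
  obtain ⟨δ, hδ, hδd⟩ := fin_pos d hd0
  refine ⟨δ, hδ, fun V A L L' g hfin hLL hLV hg hgd hgid hgA => ?_⟩
  have hL'L : L' ⊆ L := fun v hv => hLL v hv v (by simp)
  have hDV : ∀ v ∈ L', ∀ I, Df ρ v I ⊆ V := fun v hv I p hp =>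
    hLV v hv p ((Pf_dist hρ.le (Df_sub_Pf hρ v I hp)).trans (by linarith))
  have hlow : ∀ v ∈ L', ∀ I : Finset ι, I.card = k → ∀ p ∈ Pf ρ v I,
      (∃ i ∈ I, 1 / 2 - ρ / 2 ≤ |p i - v i - 1 / 2|) → g p = p := by
    rintro v hv I hI p hp ⟨i, hi, hpi⟩
    obtain ⟨w', h1, h2⟩ := edge hρ hp hi hpi
    refine hgid w' (hLL v hv w' h1) (I.erase i) ?_ p h2
    rw [Finset.card_erase_of_mem hi]
    have := Finset.card_pos.2 ⟨i, hi⟩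
    omega
  -- individual handle homeomorphisms
  have exh : ∀ σ : (ι → ℤ) × Finset ι, ∃ h : (ι → ℝ) ≃ₜ (ι → ℝ), (∀ p, dist (h p) p < ε) ∧
      (∀ p ∉ Bf ρ σ.1 σ.2, h p = p) ∧ (σ.1 ∈ L' → σ.2.card = k →
        (∀ p ∈ Df ρ σ.1 σ.2, (∀ j ∉ σ.2, |p j - σ.1 j| < y σ.2) → h p = g p) ∧
        ((∀ p ∈ Df ρ σ.1 σ.2, g p = p) → ∀ p, h p = p)) := by
    rintro ⟨v, I⟩
    by_cases h0 : v ∈ L' ∧ I.card = k ∧ ¬ ∀ p ∈ Df ρ v I, g p = p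
    · obtain ⟨hv, hI, hne⟩ := h0
      obtain ⟨h, h1, h2, h3⟩ := hcell I v g (hg.mono (hDV v hv I))
        (fun p hp => (hgd p (hDV v hv I hp)).trans_le (hδd I))
        (fun p hp => hlow v hv I hI p (Df_sub_Pf hρ v I hp))
      exact ⟨h, h1, h2, fun _ _ => ⟨h3, fun hh => absurd hh hne⟩⟩
    · refine ⟨Homeomorph.refl _, fun p => by simpa using hε, fun p _ => rfl, fun hv hI => ⟨?_, fun _ p => rfl⟩⟩
      intro p hp _
      have : ∀ p ∈ Df ρ v I, g p = p := by
        by_contra hn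
        exact h0 ⟨hv, hI, hn⟩
      exact (this p hp).symm
  choose h hh1 hh2 hh3 using exh
  let s : Finset ((ι → ℤ) × Finset ι) :=
    hfin.toFinset ×ˢ (Finset.univ.filter fun I : Finset ι => I.card = k)
  have hs : ∀ σ, σ ∈ s ↔ σ.1 ∈ L' ∧ σ.2.card = k := by
    intro σ
    simp [s]
  obtain ⟨H, hH1, hH2⟩ := disjoint_prod (fun σ : (ι → ℤ) × Finset ι => Bf ρ σ.1 σ.2) h hh2 s (by
    intro σ hσ τ hτ p hp hp'
    rw [hs] at hσ hτ
    obtain ⟨e1, e2⟩ := Pf_Bf_disj hρ hρ1 le_rfl (by rw [hσ.2, hτ.2]) (Bf_sub_Pf hρ _ _ hp) hp'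
    exact Prod.ext e1 e2)
  refine ⟨H, ?_, ?_, ?_, ?_⟩
  · intro p
    by_cases hp : ∀ σ ∈ s, p ∉ Bf ρ σ.1 σ.2
    · rw [hH2 p hp, dist_self]; exact hε
    · push Not at hp
      obtain ⟨σ, hσ, hp⟩ := hp
      rw [hH1 σ hσ p hp]
      exact hh1 σ p
  · intro p hp
    refine hH2 p fun σ hσ hpB => ?_
    rw [hs] at hσ
    have h1 := hp σ.1 hσ.1
    have h2 := Pf_dist (by linarith) (Bf_sub_Pf hρ _ _ hpB)
    linarith
  · intro w hw J hJ p hp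
    have hpρ : p ∈ Pf ρ w J := Pf_mono (by linarith) w J hp
    rcases Nat.lt_succ_iff_lt_or_eq.1 hJ with hJ | hJ
    · rw [hgid w (hL'L hw) J hJ p hpρ]
      refine hH2 p fun σ hσ hpB => ?_
      rw [hs] at hσ
      obtain ⟨-, e2⟩ := Pf_Bf_disj hρ hρ1 hρ'4 (by rw [hσ.2]; exact hJ.le) hp hpB
      rw [e2, hσ.2] at hJ
      exact lt_irrefl _ hJ
    · have hfix : p ∉ Bf ρ w J → H p = p := by
        intro hpn
        refine hH2 p fun σ hσ hpB => ?_
        rw [hs] at hσ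
        obtain ⟨e1, e2⟩ := Pf_Bf_disj hρ hρ1 hρ'4 (by rw [hσ.2, hJ]) hp hpB
        rw [e1, e2] at hpn
        exact hpn hpB
      by_cases hedge : ∃ i ∈ J, 1 / 2 ≤ |p i - w i - 1 / 2|
      · obtain ⟨i, hi, hpi⟩ := hedge
        rw [hlow w hw J hJ p hpρ ⟨i, hi, by linarith⟩]
        apply hfix
        intro hpB
        have := hpB.1 i hi
        linarith
      · push Not at hedge
        have hpD : p ∈ Df ρ w J := ⟨hedge, fun j hj => (hp.2 j hj).trans_le hρ'4⟩
        have h3 := (hh3 (w, J) hw hJ).1 p hpD fun j hj => (hp.2 j hj).trans_le (hρ'y J)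
        by_cases hpB : p ∈ Bf ρ w J
        · rw [hH1 (w, J) ((hs _).2 ⟨hw, hJ⟩) p hpB, h3]
        · rw [hfix hpB, ← h3, hh2 (w, J) p hpB]
  · intro p hpA
    by_cases hp : ∀ σ ∈ s, p ∉ Bf ρ σ.1 σ.2
    · exact hH2 p hp
    · push Not at hp
      obtain ⟨σ, hσ, hp⟩ := hp
      rw [hH1 σ hσ p hp]
      rw [hs] at hσ
      refine (hh3 σ hσ.1 hσ.2).2 (fun q hq => ?_) p
      refine hgA q (hpA q ?_) (hDV _ hσ.1 _ hq)
      refine lt_of_le_of_lt ((dist_pi_le_iff zero_le_one).2 fun i => ?_) one_lt_two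
      have hpD := Bf_sub_Df hρ _ _ hp
      rw [Real.dist_eq, abs_le]
      by_cases hi : i ∈ σ.2
      · have a1 := abs_lt.1 (hpD.1 i hi)
        have a2 := abs_lt.1 (hq.1 i hi)
        constructor <;> linarith
      · have a1 := abs_lt.1 (hpD.2 i hi)
        have a2 := abs_lt.1 (hq.2 i hi)
        constructor <;> linarith

lemma lattice_fin {C : Set (ι → ℝ)} (hC : Bornology.IsBounded C) (t : ℝ) :
    {v : ι → ℤ | ∃ c ∈ C, dist (rl v) c ≤ t}.Finite := by
  obtain ⟨R, hR⟩ := hC.subset_closedBall 0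
  refine (Set.finite_Icc (fun _ : ι => ⌊-(t + R)⌋) (fun _ : ι => ⌈t + R⌉)).subset ?_
  rintro v ⟨c, hc, hv⟩
  have h1 : ∀ i, |(v i : ℝ)| ≤ t + R := by
    intro i
    have a1 := dist_le_pi_dist (rl v) 0 i
    have a2 := dist_triangle (rl v) c 0
    have a3 := hR hc
    rw [mem_closedBall] at a3
    rw [Real.dist_eq] at a1
    simp only [rl, Pi.zero_apply, sub_zero] at a1
    exact a1.trans (by linarith)
  refine ⟨fun i => ?_, fun i => ?_⟩
  · have := (abs_le.1 (h1 i)).1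
    exact_mod_cast (Int.floor_le _).trans this
  · have := (abs_le.1 (h1 i)).2
    exact_mod_cast this.trans (Int.le_ceil _)

lemma iter (k : ℕ) : ∃ ρ > 0, ρ ≤ 1 / 4 ∧ ∀ ε > 0, ∃ δ > 0,
    ∀ (C D V : Set (ι → ℝ)) (g : (ι → ℝ) → (ι → ℝ)) (t : ℝ), Bornology.IsBounded C →
      (∀ p, ∀ c ∈ C, dist p c ≤ t + k + 2 → p ∈ V) → OE g V → (∀ p ∈ V, dist (g p) p < δ) →
      (∀ p ∈ V, ∀ d ∈ D, dist p d < 2 + 2 * k → g p = p) →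
      ∃ h : (ι → ℝ) ≃ₜ (ι → ℝ), (∀ p, dist (h p) p < ε) ∧
        (∀ p, (∀ c ∈ C, t + k + 2 < dist p c) → h p = p) ∧
        (∀ (w : ι → ℤ) (J : Finset ι), J.card < k → (∃ c ∈ C, dist (rl w) c ≤ t) →
          ∀ p ∈ Pf ρ w J, h p = g p) ∧
        ∀ p, ∀ d ∈ D, dist p d < 2 → h p = p := by
  induction k with
  | zero =>
    refine ⟨1 / 4, by norm_num, le_rfl, fun ε hε => ⟨1, one_pos, ?_⟩⟩
    intro C D V g t _ _ _ _ _
    exact ⟨Homeomorph.refl _, fun p => by simpa using hε, fun _ _ => rfl,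
      fun w J hJ => absurd hJ (Nat.not_lt_zero _), fun _ _ _ _ => rfl⟩
  | succ k ih =>
    obtain ⟨ρ, hρ, hρ4, ih⟩ := ih
    obtain ⟨ρ', hρ', hρ'4, hst⟩ := stage (ι := ι) k hρ hρ4
    refine ⟨ρ', hρ', by linarith, fun ε hε => ?_⟩
    obtain ⟨δ1, hδ1, hst⟩ := hst (ε / 2) (by linarith)
    obtain ⟨δ2, hδ2, ih⟩ := ih (min (ε / 2) (δ1 / 2)) (lt_min (by linarith) (by linarith))
    refine ⟨min δ2 (δ1 / 2), lt_min hδ2 (by linarith), ?_⟩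
    intro C D V g t hC hCV hg hgd hgD
    push_cast at hCV hgD
    set D' : Set (ι → ℝ) := {q | ∃ d ∈ D, dist q d < 2} with hD'
    obtain ⟨h0, h01, h02, h03, h04⟩ := ih C D' V g (t + 1) hC
      (fun p c hc hp => hCV p c hc (by linarith)) hg
      (fun p hp => (hgd p hp).trans_le (min_le_left _ _)) (by
        rintro p hp d' ⟨d, hd, hdd⟩ hpd
        refine hgD p hp d hd ?_
        linarith [dist_triangle p d' d])
    have hsymm : ∀ p, dist (h0.symm p) p < min (ε / 2) (δ1 / 2) := by
      intro p
      have := h01 (h0.symm p)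
      rwa [Homeomorph.apply_symm_apply, dist_comm] at this
    obtain ⟨h1, h11, h12, h13, h14⟩ := hst V {q | ∃ d ∈ D', dist q d < 2}
      {v | ∃ c ∈ C, dist (rl v) c ≤ t + 1} {v | ∃ c ∈ C, dist (rl v) c ≤ t} (h0.symm ∘ g)
      (lattice_fin hC t) (by
        rintro v ⟨c, hc, hv⟩ w hw
        refine ⟨c, hc, ?_⟩
        have : dist (rl w) (rl v) ≤ 1 := (dist_pi_le_iff zero_le_one).2 fun i => by
          rw [Real.dist_eq]
          simp only [rl]
          exact_mod_cast hw i
        linarith [dist_triangle (rl w) (rl v) c]) (by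
        rintro v ⟨c, hc, hv⟩ p hp
        refine hCV p c hc ?_
        have : (0 : ℝ) ≤ k := Nat.cast_nonneg k
        linarith [dist_triangle p (rl v) c])
      ((OE.of_homeo h0.symm univ).comp hg (mapsTo_univ _ _)) (by
        intro p hp
        have a1 := (hsymm (g p)).trans_le (min_le_right _ _)
        have a2 := (hgd p hp).trans_le (min_le_right _ _)
        have a3 := dist_triangle (h0.symm (g p)) (g p) p
        simp only [Function.comp_apply]
        linarith) (by
        rintro w ⟨c, hc, hw⟩ J hJ p hp
        simp only [Function.comp_apply]
        rw [← h03 w J hJ ⟨c, hc, hw⟩ p hp, Homeomorph.symm_apply_apply]) (by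
        rintro p ⟨d', ⟨d, hd, hdd⟩, hpd⟩ hpV
        simp only [Function.comp_apply]
        have : (0 : ℝ) ≤ k := Nat.cast_nonneg k
        rw [hgD p hpV d hd (by linarith [dist_triangle p d' d]), Homeomorph.symm_apply_eq,
          h04 p d' ⟨d, hd, hdd⟩ hpd])
    refine ⟨h1.trans h0, ?_, ?_, ?_, ?_⟩
    · intro p
      show dist (h0 (h1 p)) p < ε
      have a1 := (h01 (h1 p)).trans_le (min_le_left _ _)
      have a2 := h11 p
      have a3 := dist_triangle (h0 (h1 p)) (h1 p) p
      linarith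
    · intro p hp
      push_cast at hp
      show h0 (h1 p) = p
      rw [h12 p, h02 p]
      · intro c hc
        linarith [hp c hc]
      · rintro v ⟨c, hc, hv⟩
        have : (0 : ℝ) ≤ k := Nat.cast_nonneg k
        linarith [hp c hc, dist_triangle p (rl v) c]
    · rintro w J hJ ⟨c, hc, hw⟩ p hp
      show h0 (h1 p) = g p
      rw [h13 w ⟨c, hc, hw⟩ J hJ p hp]
      simp
    · intro p d hd hpd
      show h0 (h1 p) = p
      rw [h14 p, h04 p p ⟨d, hd, hpd⟩ (by simp)]
      intro q hq
      exact ⟨p, ⟨d, hd, hpd⟩, hq⟩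

end faces

end EK
end

section
open Topology Set Metric

namespace EK

section lt
variable {ι : Type*} [Fintype ι] [DecidableEq ι]

lemma lt_unit : ∃ N : ℝ, 0 < N ∧ ∀ ε > 0, ∃ δ > 0, ∀ (C D V : Set (ι → ℝ)) (g : (ι → ℝ) → (ι → ℝ)),
    Bornology.IsBounded C → (∀ p, ∀ c ∈ C, dist p c ≤ N → p ∈ V) → OE g V →
    (∀ p ∈ V, dist (g p) p < δ) → (∀ p ∈ V, ∀ d ∈ D, dist p d < N → g p = p) →
    ∃ h : (ι → ℝ) ≃ₜ (ι → ℝ), (∀ p, dist (h p) p < ε) ∧ (∀ p, (∀ c ∈ C, N < dist p c) → h p = p) ∧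
      (∀ p ∈ C, h p = g p) ∧ ∀ p ∈ D, h p = p := by
  set n := Fintype.card ι with hn
  obtain ⟨ρ, hρ, hρ1, H⟩ := iter (ι := ι) (n + 1)
  have hn0 : (0 : ℝ) ≤ n := Nat.cast_nonneg n
  refine ⟨2 * n + 4, by linarith, fun ε hε => ?_⟩
  obtain ⟨δ, hδ, H⟩ := H ε hε
  refine ⟨δ, hδ, fun C D V g hC hCV hg hgd hgD => ?_⟩
  obtain ⟨h, h1, h2, h3, h4⟩ := H C D V g 1 hC
    (fun p c hc hp => hCV p c hc (by push_cast at hp; linarith)) hg hgd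
    (fun p hp d hd hpd => hgD p hp d hd (by push_cast at hpd; linarith))
  refine ⟨h, h1, fun p hp => h2 p fun c hc => ?_, fun p hp => ?_, fun p hp => h4 p p hp (by simp)⟩
  · have := hp c hc
    push_cast; linarith
  · refine h3 (fun i => ⌊p i⌋) Finset.univ (by simp [← hn]) ⟨p, hp, ?_⟩ p ?_
    · rw [dist_pi_le_iff zero_le_one]
      intro i
      rw [Real.dist_eq, rl, abs_le]
      constructor <;> linarith [Int.floor_le (p i), Int.lt_floor_add_one (p i)]
    · refine ⟨fun i _ => ?_, fun j hj => absurd (Finset.mem_univ j) hj⟩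
      constructor <;> linarith [Int.floor_le (p i), Int.lt_floor_add_one (p i)]

lemma lt_scaled {r : ℝ} (hr : 0 < r) {ε : ℝ} (hε : 0 < ε) :
    ∃ δ > 0, ∀ (C D V : Set (ι → ℝ)) (g : (ι → ℝ) → (ι → ℝ)),
    Bornology.IsBounded C → (∀ p, ∀ c ∈ C, dist p c ≤ r → p ∈ V) → OE g V →
    (∀ p ∈ V, dist (g p) p < δ) → (∀ p ∈ V, ∀ d ∈ D, dist p d < r → g p = p) →
    ∃ h : (ι → ℝ) ≃ₜ (ι → ℝ), (∀ p, dist (h p) p < ε) ∧ (∀ p, (∀ c ∈ C, r < dist p c) → h p = p) ∧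
      (∀ p ∈ C, h p = g p) ∧ ∀ p ∈ D, h p = p := by
  obtain ⟨N, hN, H⟩ := lt_unit (ι := ι)
  set s := r / N with hs
  have hs0 : 0 < s := div_pos hr hN
  have hsN : s * N = r := by rw [hs]; field_simp
  obtain ⟨δ, hδ, H⟩ := H (ε / s) (div_pos hε hs0)
  refine ⟨s * δ, mul_pos hs0 hδ, fun C D V g hC hCV hg hgd hgD => ?_⟩
  let m : (ι → ℝ) ≃ₜ (ι → ℝ) := Homeomorph.smulOfNeZero s hs0.ne'
  have hm : ∀ p, m p = s • p := fun p => rfl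
  have hd : ∀ p q, dist (m p) (m q) = s * dist p q := fun p q => by
    rw [hm, hm, dist_smul₀, Real.norm_of_nonneg hs0.le]
  have hd' : ∀ p q, s * dist (m.symm p) q = dist p (m q) := fun p q => by
    rw [← hd, m.apply_symm_apply]
  obtain ⟨h, h1, h2, h3, h4⟩ := H (m ⁻¹' C) (m ⁻¹' D) (m ⁻¹' V) (m.symm ∘ g ∘ m) (by
      have : m ⁻¹' C = (fun p => s⁻¹ • p) '' C := by
        ext p
        constructor
        · intro hp
          exact ⟨m p, hp, by rw [hm]; simp [hs0.ne']⟩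
        · rintro ⟨q, hq, rfl⟩
          show m _ ∈ C
          rw [hm]; simpa [hs0.ne'] using hq
      rw [this]
      exact hC.smul₀ s⁻¹) (by
      intro p c hc hp
      refine hCV _ _ hc ?_
      rw [hd, ← hsN]
      exact mul_le_mul_of_nonneg_left hp hs0.le) (by
      refine (OE.of_homeo m.symm univ).comp (hg.comp (OE.of_homeo m _) (fun p hp => hp)) (fun _ _ => mem_univ _)) (by
      intro p hp
      have := hgd _ hp
      simp only [Function.comp_apply]
      rw [← hd'] at this
      exact lt_of_mul_lt_mul_left this hs0.le) (by
      intro p hp d hpd hdd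
      simp only [Function.comp_apply]
      rw [hgD _ hp _ hpd, m.symm_apply_apply]
      rw [hd, ← hsN]
      exact mul_lt_mul_of_pos_left hdd hs0)
  refine ⟨(m.symm.trans h).trans m, ?_, ?_, ?_, ?_⟩
  · intro p
    show dist (m (h (m.symm p))) p < ε
    have := h1 (m.symm p)
    rw [lt_div_iff₀ hs0, mul_comm, ← hd] at this
    simpa using this
  · intro p hp
    show m (h (m.symm p)) = p
    rw [h2, m.apply_symm_apply]
    intro c hc
    have := hp _ hc
    rw [← hd', ← hsN] at this
    exact lt_of_mul_lt_mul_left this hs0.le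
  · intro p hp
    show m (h (m.symm p)) = g p
    rw [h3 _ (by simpa using hp)]
    simp
  · intro p hp
    show m (h (m.symm p)) = p
    rw [h4 _ (by simpa using hp)]
    simp

end lt

end EK
end

section
open Topology Set Metric

namespace EK

section mfd
variable {ι : Type*} [Fintype ι] [DecidableEq ι] {M : Type*} [MetricSpace M] [CompactSpace M]

lemma chart_step {e : (ι → ℝ) → M} (he : OE e univ) {b : ℝ} (hb : b ≤ 2) {K O : Set M}
    (hK : IsClosed K) (hO : IsOpen O) (hKO : K ⊆ O) {ε : ℝ} (hε : 0 < ε) :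
    ∃ δ > 0, ∀ g : M ≃ₜ M, (∀ x, dist (g x) x < δ) → (∀ x ∈ O, g x = x) →
      ∃ H : M ≃ₜ M, (∀ x ∉ e '' closedBall 0 3, H x = x) ∧ (∀ x ∈ K, H x = x) ∧
        (∀ x ∈ e '' closedBall 0 b, H x = g x) ∧ ∀ x, dist (H x) x < ε := by
  have hec : Continuous e := continuousOn_univ.1 he.cont
  have hei : Function.Injective e := injOn_univ.1 he.inj
  have hW : IsOpen (e '' ball 0 4) := he.opn _ (subset_univ _) isOpen_ball
  have hA : IsCompact (e '' closedBall 0 3) := (isCompact_closedBall _ _).image hec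
  obtain ⟨η, hη, hηW⟩ := hA.exists_thickening_subset_open hW
    (image_mono (closedBall_subset_ball (by norm_num)))
  have hDc : IsCompact (closedBall (0 : ι → ℝ) 3 ∩ e ⁻¹' K) :=
    (isCompact_closedBall _ _).inter_right (hK.preimage hec)
  obtain ⟨r0, hr0, hr0O⟩ := hDc.exists_thickening_subset_open (hO.preimage hec)
    (fun p hp => hKO hp.2)
  have hr : 0 < min r0 (1 / 2) := lt_min hr0 (by norm_num)
  obtain ⟨εE, hεE, hue⟩ := Metric.uniformContinuousOn_iff.1
    ((isCompact_closedBall (0 : ι → ℝ) 3).uniformContinuousOn_of_continuous hec.continuousOn) ε hε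
  obtain ⟨δE, hδE, hlt⟩ := lt_scaled (ι := ι) hr hεE
  have hinv : ContinuousOn (Function.invFunOn e univ) (e '' univ) := he.continuousOn_inv isOpen_univ
  have hie : ∀ p, Function.invFunOn e univ (e p) = p := fun p =>
    he.inj.leftInvOn_invFunOn (mem_univ p)
  obtain ⟨δ1, hδ1, hui⟩ := Metric.uniformContinuousOn_iff.1
    (((isCompact_closedBall (0 : ι → ℝ) 4).image hec).uniformContinuousOn_of_continuous
      (hinv.mono (image_mono (subset_univ _)))) δE hδE
  refine ⟨min η δ1, lt_min hη hδ1, fun g hg hgO => ?_⟩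
  have hgW : ∀ p ∈ ball (0 : ι → ℝ) 3, g (e p) ∈ e '' ball 0 4 := fun p hp => hηW (by
    rw [mem_thickening_iff]
    exact ⟨e p, mem_image_of_mem _ (ball_subset_closedBall hp), (hg _).trans_le (min_le_left _ _)⟩)
  have hs : ∀ p ∈ ball (0 : ι → ℝ) 3, e (Function.invFunOn e univ (g (e p))) = g (e p) := by
    intro p hp
    obtain ⟨q, -, hq⟩ := hgW p hp
    rw [← hq, hie]
  obtain ⟨h, h1, h2, h3, h4⟩ := hlt (closedBall 0 b) (closedBall 0 3 ∩ e ⁻¹' K) (ball 0 3)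
    (fun p => Function.invFunOn e univ (g (e p))) isBounded_closedBall (by
      intro p c hc hp
      have a1 := hp.trans (min_le_right _ _)
      rw [mem_closedBall] at hc
      rw [mem_ball]
      linarith [dist_triangle p c 0]) (by
      refine OE.lift he isOpen_univ (k := g ∘ e) ?_ (fun _ _ => mem_univ _) hs
      exact (OE.of_homeo g univ).comp (he.mono (subset_univ _)) (fun _ _ => mem_univ _)) (by
      intro p hp
      have := hui (g (e p)) (image_mono ball_subset_closedBall (hgW p hp)) (e p)
        (mem_image_of_mem _ (closedBall_subset_closedBall (by norm_num) (ball_subset_closedBall hp)))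
        ((hg _).trans_le (min_le_right _ _))
      rwa [hie] at this) (by
      intro p hp d hd hpd
      have : e p ∈ O := hr0O (by
        rw [mem_thickening_iff]
        exact ⟨d, hd, hpd.trans_le (min_le_left _ _)⟩)
      show Function.invFunOn e univ (g (e p)) = p
      rw [hgO _ this, hie])
  have hS : ∀ p ∉ closedBall (0 : ι → ℝ) (5 / 2), h p = p := by
    intro p hp
    refine h2 p fun c hc => ?_
    rw [mem_closedBall] at hp hc
    push Not at hp
    have := min_le_right r0 (1 / 2)
    linarith [dist_triangle p c 0]
  have hS' : ∀ p ∈ closedBall (0 : ι → ℝ) (5 / 2), h p ∈ closedBall (0 : ι → ℝ) (5 / 2) := by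
    intro p hp
    by_contra hcon
    have := h.injective (hS _ hcon)
    rw [this] at hcon
    exact hcon hp
  have hsub : closedBall (0 : ι → ℝ) (5 / 2) ⊆ closedBall (0 : ι → ℝ) 3 :=
    closedBall_subset_closedBall (by norm_num)
  obtain ⟨H, H1, H2⟩ := transport he isOpen_univ (isCompact_closedBall (0 : ι → ℝ) (5 / 2))
    (subset_univ _) h hS
  refine ⟨H, fun x hx => H2 x fun hx' => hx (image_mono hsub hx'), ?_, ?_, ?_⟩
  · intro x hx
    by_cases hxS : x ∈ e '' closedBall 0 (5 / 2)
    · obtain ⟨p, hp, rfl⟩ := hxS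
      rw [H1 p (mem_univ _), h4 p ⟨hsub hp, hx⟩]
    · exact H2 x hxS
  · rintro _ ⟨p, hp, rfl⟩
    rw [H1 p (mem_univ _), h3 p hp]
    exact hs p (closedBall_subset_ball (by linarith) hp)
  · intro x
    by_cases hxS : x ∈ e '' closedBall 0 (5 / 2)
    · obtain ⟨p, hp, rfl⟩ := hxS
      rw [H1 p (mem_univ _)]
      exact hue _ (hsub (hS' p hp)) _ (hsub hp) (h1 p)
    · rw [H2 x hxS, dist_self]; exact hε

/-- homeomorphisms supported in a member of the cover -/
def Supp (𝒰 : Set (Set M)) : Set (M ≃ₜ M) := {h | ∃ U ∈ 𝒰, ∀ x ∉ U, h x = x}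

lemma near_id_frag (𝒰 : Set (Set M)) (m : ℕ) (e : ℕ → (ι → ℝ) → M)
    (he : ∀ j < m, OE (e j) univ) (heU : ∀ j < m, ∃ U ∈ 𝒰, e j '' closedBall 0 3 ⊆ U)
    (hcov : ∀ x, ∃ j < m, x ∈ e j '' ball 0 1) :
    ∃ δ > 0, ∀ g : M ≃ₜ M, (∀ x, dist (g x) x < δ) → g ∈ Submonoid.closure (Supp 𝒰) := by
  have key : ∀ i ≤ m, ∀ ε > 0, ∃ δ > 0, ∀ g : M ≃ₜ M, (∀ x, dist (g x) x < δ) →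
      ∃ f ∈ Submonoid.closure (Supp 𝒰), ∃ g' : M ≃ₜ M, g = f * g' ∧ (∀ x, dist (g' x) x < ε) ∧
        ∀ j < i, ∀ x ∈ e j '' closedBall 0 (1 + 1 / ((i : ℝ) + 1)), g' x = x := by
    intro i
    induction i with
    | zero =>
      intro _ ε hε
      exact ⟨ε, hε, fun g hg => ⟨1, one_mem _, g, (one_mul g).symm, hg, fun j hj => by omega⟩⟩
    | succ i ih =>
      intro him ε hε
      have hi : i < m := by omega
      have hlt : 1 / (((i + 1 : ℕ) : ℝ) + 1) < 1 / ((i : ℝ) + 1) := by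
        apply one_div_lt_one_div_of_lt
        · positivity
        · push_cast; linarith
      obtain ⟨δ1, hδ1, H1⟩ := chart_step (he i hi) (b := 1 + 1 / (((i + 1 : ℕ) : ℝ) + 1))
        (by
          have : 1 / (((i + 1 : ℕ) : ℝ) + 1) ≤ 1 := by
            rw [div_le_one (by positivity)]
            push_cast
            linarith [(Nat.cast_nonneg i : (0 : ℝ) ≤ i)]
          linarith)
        (K := ⋃ j ∈ Finset.range i, e j '' closedBall 0 (1 + 1 / (((i + 1 : ℕ) : ℝ) + 1)))
        (O := ⋃ j ∈ Finset.range i, e j '' ball 0 (1 + 1 / ((i : ℝ) + 1)))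
        (by
          refine Set.Finite.isClosed_biUnion (Finset.finite_toSet (Finset.range i)) (fun j hj => ?_)
          have hj' : j < i := by simpa using hj
          exact ((isCompact_closedBall _ _).image
            (continuousOn_univ.1 (he j (by omega)).cont)).isClosed)
        (by
          refine isOpen_biUnion fun j hj => ?_
          have hj' : j < i := by simpa using hj
          exact (he j (by omega)).opn _ (subset_univ _) isOpen_ball)
        (by
          refine iUnion₂_mono fun j hj => ?_
          exact image_mono (closedBall_subset_ball (by linarith))) (half_pos hε)
      obtain ⟨δ, hδ, H2⟩ := ih (by omega) (min δ1 (ε / 2)) (lt_min hδ1 (half_pos hε))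
      refine ⟨δ, hδ, fun g hg => ?_⟩
      obtain ⟨f, hf, g', hgf, hg', hgj⟩ := H2 g hg
      obtain ⟨H, a1, a2, a3, a4⟩ := H1 g' (fun x => (hg' x).trans_le (min_le_left _ _)) (by
        intro x hx
        simp only [mem_iUnion, Finset.mem_range, exists_prop] at hx
        obtain ⟨j, hj, hx⟩ := hx
        exact hgj j hj x (image_mono ball_subset_closedBall hx))
      refine ⟨f * H, mul_mem hf (Submonoid.subset_closure ?_), H⁻¹ * g', ?_, ?_, ?_⟩
      · obtain ⟨U, hU, hUe⟩ := heU i hi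
        exact ⟨U, hU, fun x hx => a1 x fun h => hx (hUe h)⟩
      · rw [hgf]; group
      · intro x
        show dist (H.symm (g' x)) x < ε
        have b1 := a4 (H.symm (g' x))
        rw [H.apply_symm_apply, dist_comm] at b1
        have b2 := (hg' x).trans_le (min_le_right _ _)
        linarith [dist_triangle (H.symm (g' x)) (g' x) x]
      · intro j hj x hx
        show H.symm (g' x) = x
        rw [Homeomorph.symm_apply_eq]
        rcases Nat.lt_succ_iff_lt_or_eq.1 hj with hj | rfl
        · rw [a2 x (by
            simp only [mem_iUnion, Finset.mem_range, exists_prop]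
            exact ⟨j, hj, hx⟩)]
          exact hgj j hj x (image_mono (closedBall_subset_closedBall (by linarith)) hx)
        · exact (a3 x hx).symm
  obtain ⟨δ, hδ, H⟩ := key m le_rfl 1 one_pos
  refine ⟨δ, hδ, fun g hg => ?_⟩
  obtain ⟨f, hf, g', hgf, -, hg'⟩ := H g hg
  have : g' = 1 := by
    ext x
    obtain ⟨j, hj, hx⟩ := hcov x
    refine hg' j hj x (image_mono (ball_subset_closedBall.trans
      (closedBall_subset_closedBall ?_)) hx)
    have : 0 ≤ 1 / ((m : ℝ) + 1) := by positivity
    linarith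
  rw [hgf, this, mul_one]
  exact hf

end mfd

end EK
end

section
open Topology Set Metric

namespace EK

lemma exists_chart (d : ℕ) {M : Type*} [TopologicalSpace M]
    (hM : ∀ x : M, ∃ U : Set M, IsOpen U ∧ x ∈ U ∧
      Nonempty (U ≃ₜ EuclideanSpace ℝ (Fin d)))
    (𝒰 : Set (Set M)) (h𝒰open : ∀ U ∈ 𝒰, IsOpen U) (h𝒰cover : ⋃₀ 𝒰 = Set.univ) (x : M) :
    ∃ e : (Fin d → ℝ) → M, OE e univ ∧ (∃ U ∈ 𝒰, e '' closedBall 0 3 ⊆ U) ∧ e 0 = x := by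
  obtain ⟨W, hW, hxW, ⟨φ⟩⟩ := hM x
  obtain ⟨U, hU, hxU⟩ : x ∈ ⋃₀ 𝒰 := by rw [h𝒰cover]; trivial
  let ψ : (Fin d → ℝ) ≃ₜ W := (EuclideanSpace.equiv (Fin d) ℝ).toHomeomorph.symm.trans φ.symm
  set p0 := ψ.symm ⟨x, hxW⟩ with hp0
  have ho : IsOpen {p : Fin d → ℝ | (ψ p : M) ∈ U} :=
    (h𝒰open U hU).preimage (continuous_subtype_val.comp ψ.continuous)
  obtain ⟨r, hr, hrU⟩ := Metric.isOpen_iff.1 ho p0 (by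
    show (ψ p0 : M) ∈ U
    rw [hp0, ψ.apply_symm_apply]; exact hxU)
  have hr4 : 0 < r / 4 := by linarith
  let a : (Fin d → ℝ) ≃ₜ (Fin d → ℝ) :=
    (Homeomorph.smulOfNeZero (r / 4) hr4.ne').trans (Homeomorph.addRight p0)
  have ha : ∀ p, a p = (r / 4) • p + p0 := fun p => rfl
  have hemb : IsOpenEmbedding (fun p => (ψ (a p) : M)) :=
    (hW.isOpenEmbedding_subtypeVal.comp ψ.isOpenEmbedding).comp a.isOpenEmbedding
  refine ⟨fun p => (ψ (a p) : M), OE.of_openEmbedding hemb univ, ⟨U, hU, ?_⟩, ?_⟩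
  · rintro _ ⟨p, hp, rfl⟩
    refine hrU ?_
    rw [mem_ball, ha, dist_eq_norm, add_sub_cancel_right, norm_smul, Real.norm_of_nonneg hr4.le]
    rw [mem_closedBall, dist_zero_right] at hp
    nlinarith
  · show (ψ (a 0) : M) = x
    rw [ha, smul_zero, zero_add, hp0, ψ.apply_symm_apply]

lemma frag (d : ℕ) (M : Type*) [TopologicalSpace M] [CompactSpace M] [T2Space M]
    [SecondCountableTopology M]
    (hM : ∀ x : M, ∃ U : Set M, IsOpen U ∧ x ∈ U ∧
      Nonempty (U ≃ₜ EuclideanSpace ℝ (Fin d)))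
    (𝒰 : Set (Set M)) (h𝒰open : ∀ U ∈ 𝒰, IsOpen U) (h𝒰cover : ⋃₀ 𝒰 = Set.univ)
    (g : M ≃ₜ M) (H : unitInterval × M → M) (Hc : Continuous H) (H0 : ∀ x, H (0, x) = x)
    (H1 : ∀ x, H (1, x) = g x) (Ht : ∀ t : unitInterval, ∃ h : M ≃ₜ M, ∀ x, H (t, x) = h x) :
    ∃ l : List (M ≃ₜ M), (∀ h ∈ l, ∃ U ∈ 𝒰, ∀ x ∉ U, h x = x) ∧ l.prod = g := by
  letI := TopologicalSpace.metrizableSpaceMetric M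
  have hnear : ∃ δ > 0, ∀ g : M ≃ₜ M, (∀ x, dist (g x) x < δ) →
      g ∈ Submonoid.closure (Supp 𝒰) := by
    choose e he heU hex using exists_chart d hM 𝒰 h𝒰open h𝒰cover
    obtain ⟨t, ht⟩ := isCompact_univ.elim_finite_subcover (fun x => e x '' ball 0 1)
      (fun x => (he x).opn _ (subset_univ _) isOpen_ball)
      (fun x _ => mem_iUnion.2 ⟨x, 0, mem_ball_self one_pos, hex x⟩)
    rcases isEmpty_or_nonempty M with hE | ⟨⟨x0⟩⟩
    · refine ⟨1, one_pos, fun g _ => ?_⟩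
      have : g = 1 := by ext x; exact isEmptyElim x
      rw [this]; exact one_mem _
    · refine near_id_frag 𝒰 t.toList.length (fun j => e (t.toList.getD j x0)) (fun j _ => he _)
        (fun j _ => heU _) (fun x => ?_)
      have := ht (mem_univ x)
      simp only [mem_iUnion, exists_prop] at this
      obtain ⟨y, hy, hxy⟩ := this
      obtain ⟨j, hj, hjy⟩ := List.mem_iff_getElem.1 (Finset.mem_toList.2 hy)
      refine ⟨j, hj, ?_⟩
      rw [List.getD_eq_getElem _ _ hj, hjy]
      exact hxy
  obtain ⟨δ, hδ, hnear⟩ := hnear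
  obtain ⟨τ, hτ, hu⟩ := Metric.uniformContinuous_iff.1
    (CompactSpace.uniformContinuous_of_continuous Hc) δ hδ
  choose h hh using Ht
  obtain ⟨n, hn⟩ := exists_nat_one_div_lt hτ
  have hn0 : (0 : ℝ) < (n : ℝ) + 1 := by positivity
  let s : ℕ → unitInterval := fun i => projIcc 0 1 zero_le_one ((i : ℝ) / ((n : ℝ) + 1))
  have key : ∀ i : ℕ, i ≤ n + 1 → h (s i) ∈ Submonoid.closure (Supp 𝒰) := by
    intro i
    induction i with
    | zero =>
      intro _
      have h0 : s 0 = 0 := by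
        simp only [s, Nat.cast_zero, zero_div]
        exact projIcc_left zero_le_one
      have : h (s 0) = 1 := by
        ext x
        rw [h0, ← hh, H0]; rfl
      rw [this]; exact one_mem _
    | succ i ih =>
      intro hi
      have e1 : h (s (i + 1)) = (h (s (i + 1)) * (h (s i))⁻¹) * h (s i) := by group
      rw [e1]
      refine mul_mem (hnear _ fun x => ?_) (ih (by omega))
      obtain ⟨y, rfl⟩ := (h (s i)).surjective x
      have e2 : (h (s (i + 1)) * (h (s i))⁻¹) (h (s i) y) = h (s (i + 1)) y := by
        show h (s (i + 1)) ((h (s i)).symm (h (s i) y)) = _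
        rw [Homeomorph.symm_apply_apply]
      rw [e2, ← hh, ← hh]
      apply hu
      rw [Prod.dist_eq, dist_self, max_lt_iff]
      refine ⟨?_, hτ⟩
      have hmem : ∀ j : ℕ, j ≤ n + 1 → (j : ℝ) / ((n : ℝ) + 1) ∈ Icc (0 : ℝ) 1 := by
        intro j hj
        refine ⟨by positivity, ?_⟩
        rw [div_le_one hn0]
        exact_mod_cast hj
      have e3 : ∀ j : ℕ, j ≤ n + 1 → ((s j : unitInterval) : ℝ) = (j : ℝ) / ((n : ℝ) + 1) := by
        intro j hj
        simp only [s]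
        rw [projIcc_of_mem _ (hmem j hj)]
      rw [Subtype.dist_eq, e3 _ hi, e3 i (by omega), Real.dist_eq, ← sub_div]
      push_cast
      rw [add_sub_cancel_left, abs_of_pos (by positivity)]
      exact hn
  have hlast : s (n + 1) = 1 := by
    have : (((n + 1 : ℕ) : ℝ) / ((n : ℝ) + 1)) = 1 := by
      push_cast; exact div_self hn0.ne'
    simp only [s, this]
    exact projIcc_right zero_le_one
  have hg : g ∈ Submonoid.closure (Supp 𝒰) := by
    have := key (n + 1) le_rfl
    rw [hlast] at this
    have e4 : h 1 = g := by
      ext x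
      rw [← hh, H1]
    rwa [e4] at this
  obtain ⟨l, hl, hlp⟩ := Submonoid.exists_list_of_mem_closure hg
  exact ⟨l, hl, hlp⟩

lemma foldr_prod {M : Type*} [TopologicalSpace M] (l : List (M ≃ₜ M)) :
    (l.map fun h : M ≃ₜ M => (⇑h : M → M)).foldr (· ∘ ·) id = ⇑l.prod := by
  induction l with
  | nil => rfl
  | cons a l ih =>
    rw [List.map_cons, List.foldr_cons, ih, List.prod_cons]
    rfl

end EK
end

/-- Edwards–Kirby fragmentation: if `M` is a compact topological `d`-manifold
without boundary and `𝒰` is an open cover of `M`, then every homeomorphism of `M` isotopic to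
the identity is a composition `g₁ ∘ g₂ ∘ ⋯ ∘ g_k` of homeomorphisms, each supported in a member
of `𝒰`. -/
theorem stmt_3 (d : ℕ) (M : Type*) [TopologicalSpace M] [CompactSpace M] [T2Space M]
    [SecondCountableTopology M]
    (hM : ∀ x : M, ∃ U : Set M, IsOpen U ∧ x ∈ U ∧
      Nonempty (U ≃ₜ EuclideanSpace ℝ (Fin d)))
    (𝒰 : Set (Set M)) (h𝒰open : ∀ U ∈ 𝒰, IsOpen U) (h𝒰cover : ⋃₀ 𝒰 = Set.univ)
    (g : M ≃ₜ M) (hg : IsotopicToId g) :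
    ∃ (k : ℕ) (gs : Fin k → M ≃ₜ M),
      (∀ j, ∃ U ∈ 𝒰, ∀ x ∉ U, gs j x = x) ∧
      ∀ x, g x = (List.ofFn fun j => (⇑(gs j) : M → M)).foldr (· ∘ ·) id x := by
  obtain ⟨H, Hc, H0, H1, Ht⟩ := hg
  obtain ⟨l, hl, hlp⟩ := EK.frag d M hM 𝒰 h𝒰open h𝒰cover g H Hc H0 H1 Ht
  refine ⟨l.length, fun j => l.get j, fun j => hl _ (l.get_mem j), fun x => ?_⟩
  have e : (List.ofFn fun j => (⇑(l.get j) : M → M)) = l.map fun h : M ≃ₜ M => (⇑h : M → M) := by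
    rw [← List.ofFn_get l, List.map_ofFn, List.ofFn_get l]
    rfl
  rw [e, EK.foldr_prod, hlp]
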